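/- There exist constants 0 < c ≤ C < ∞ such that for all n = 2^{j₀} and m = 2^{−i₀}n as above, c·m/n ≤ E(X_{n,m}²) ≤ C·m/n. -/

import Mathlib

/-!
Critical site percolation on the triangular lattice realized on `ℤ²`.
A configuration assigns to each site `true` (open) or `false` (closed),
and `P` is the product Bernoulli(1/2) measure, axiomatized by
`IsBernoulliHalf` below (finite cylinder events have product probability).
-/

open MeasureTheory
open scoped ENNReal

/-- Sites of the lattice: vertices of `ℤ²`. -/
abbrev Site : Type := ℤ × ℤ

/-- A percolation configuration: `true` = open, `false` = closed. -/
abbrev Config : Type := Site → Bool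

/-- Adjacency for the triangular lattice realized on `ℤ²`:
the neighbors of `(x,y)` are `(x±1,y)`, `(x,y±1)`, `(x+1,y-1)`, `(x-1,y+1)`. -/
def Adj (a b : Site) : Prop :=
  (b.1 - a.1, b.2 - a.2) ∈
    ({(1, 0), (-1, 0), (0, 1), (0, -1), (1, -1), (-1, 1)} : Set (ℤ × ℤ))

/-- A (nonempty, self-avoiding) lattice path: a list of distinct sites in which
consecutive sites are neighbors. -/
def IsPath (p : List Site) : Prop := p ≠ [] ∧ p.Nodup ∧ p.Chain' Adj

/-- A path all of whose vertices lie in the set `S`. -/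
def PathIn (S : Set Site) (p : List Site) : Prop := IsPath p ∧ ∀ v ∈ p, v ∈ S

/-- All sites of `p` are open in `ω`. -/
def IsOpenOn (ω : Config) (p : List Site) : Prop := ∀ v ∈ p, ω v = true

/-- All sites of `p` are closed in `ω`. -/
def IsClosedOn (ω : Config) (p : List Site) : Prop := ∀ v ∈ p, ω v = false

/-- The first vertex of `p` lies in `A`. -/
def FirstIn (A : Set Site) (p : List Site) : Prop := ∃ a ∈ A, p.head? = some a

/-- The last vertex of `p` lies in `A`. -/
def LastIn (A : Set Site) (p : List Site) : Prop := ∃ a ∈ A, p.getLast? = some a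

/-- `μ` is the product Bernoulli(1/2) measure on configurations: a probability
measure for which every finite cylinder event has the product probability. -/
def IsBernoulliHalf (μ : Measure Config) : Prop :=
  IsProbabilityMeasure μ ∧
    ∀ (S : Finset Site) (f : Site → Bool),
      μ {ω | ∀ v ∈ S, ω v = f v} = (1 / 2 : ℝ≥0∞) ^ S.card

/-- The lattice rectangle `[x₀,x₁] × [y₀,y₁]`. -/
def rect (x₀ x₁ y₀ y₁ : ℤ) : Set Site :=
  {v | x₀ ≤ v.1 ∧ v.1 ≤ x₁ ∧ y₀ ≤ v.2 ∧ v.2 ≤ y₁}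

/-- The left side of a rectangle. -/
def rectLeft (x₀ x₁ y₀ y₁ : ℤ) : Set Site := {v ∈ rect x₀ x₁ y₀ y₁ | v.1 = x₀}

/-- The right side of a rectangle. -/
def rectRight (x₀ x₁ y₀ y₁ : ℤ) : Set Site := {v ∈ rect x₀ x₁ y₀ y₁ | v.1 = x₁}

/-- The top side of a rectangle. -/
def rectTop (x₀ x₁ y₀ y₁ : ℤ) : Set Site := {v ∈ rect x₀ x₁ y₀ y₁ | v.2 = y₁}

/-- The bottom side of a rectangle. -/
def rectBot (x₀ x₁ y₀ y₁ : ℤ) : Set Site := {v ∈ rect x₀ x₁ y₀ y₁ | v.2 = y₀}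

/-- A horizontal open crossing of the rectangle `[x₀,x₁] × [y₀,y₁]`:
an open path in the rectangle from its left side to its right side. -/
def HorizCrossing (x₀ x₁ y₀ y₁ : ℤ) (ω : Config) (p : List Site) : Prop :=
  PathIn (rect x₀ x₁ y₀ y₁) p ∧ IsOpenOn ω p ∧
    FirstIn (rectLeft x₀ x₁ y₀ y₁) p ∧ LastIn (rectRight x₀ x₁ y₀ y₁) p

/-- `v` is a pivotal site for the box `B(n) = [-n,n]²`: some horizontal open
crossing of `B(n)` contains `v`, and there are two disjoint closed paths in
`B(n)` started from `v` (i.e. starting at a neighbor of `v`), one to the top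
side and one to the bottom side of `B(n)`. -/
def Pivotal (n : ℤ) (ω : Config) (v : Site) : Prop :=
  (∃ p, HorizCrossing (-n) n (-n) n ω p ∧ v ∈ p) ∧
    ∃ q₁ q₂ : List Site,
      PathIn (rect (-n) n (-n) n) q₁ ∧ IsClosedOn ω q₁ ∧
        FirstIn {w | Adj v w} q₁ ∧ LastIn (rectTop (-n) n (-n) n) q₁ ∧
      PathIn (rect (-n) n (-n) n) q₂ ∧ IsClosedOn ω q₂ ∧
        FirstIn {w | Adj v w} q₂ ∧ LastIn (rectBot (-n) n (-n) n) q₂ ∧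
      List.Disjoint q₁ q₂

/-- `Q_n`: the set of pivotal sites for `B(n)`. -/
def Qset (n : ℤ) (ω : Config) : Set Site := {v | Pivotal n ω v}

/-- The block `H_k`: `{(x,y) ∈ B(n) : -n+(k-1)m < x ≤ -n+km, -n ≤ y ≤ -n+m}`. -/
def Hblock (n m : ℤ) (k : ℕ) : Set Site :=
  {v | -n + ((k : ℤ) - 1) * m < v.1 ∧ v.1 ≤ -n + (k : ℤ) * m ∧
        -n ≤ v.2 ∧ v.2 ≤ -n + m}

/-- The dyadic interval `I_j` (for `n = 2^j₀`, `m = 2^{j₀-i₀}`):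
`I_j = (n - 2^{-j}n, n - 2^{-j-1}n]` for `j < i₀` and `I_{i₀} = (n-m, n]`. -/
def Iset (j₀ i₀ j : ℕ) : Set ℤ :=
  if j = i₀ then Set.Ioc ((2 : ℤ) ^ j₀ - 2 ^ (j₀ - i₀)) ((2 : ℤ) ^ j₀)
  else Set.Ioc ((2 : ℤ) ^ j₀ - 2 ^ (j₀ - j)) ((2 : ℤ) ^ j₀ - 2 ^ (j₀ - j - 1))

/-- `X_{n,m}`: the number of indices `k ∈ {1,…,2n/m}` (here `2n/m = 2^{i₀+1}`,
with `n = 2^{j₀}`, `m = 2^{j₀-i₀}`) such that `Q_n ∩ H_k ≠ ∅`. -/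
noncomputable def Xnm (j₀ i₀ : ℕ) (ω : Config) : ℕ :=
  {k : ℕ | 1 ≤ k ∧ k ≤ 2 ^ (i₀ + 1) ∧
    (Qset ((2 : ℤ) ^ j₀) ω ∩ Hblock ((2 : ℤ) ^ j₀) ((2 : ℤ) ^ (j₀ - i₀)) k).Nonempty}.ncard

theorem adj_iff {a b : Site} : Adj a b ↔
    -1 ≤ b.1 - a.1 ∧ b.1 - a.1 ≤ 1 ∧ -1 ≤ b.2 - a.2 ∧ b.2 - a.2 ≤ 1 ∧
      -1 ≤ b.1 - a.1 + (b.2 - a.2) ∧ b.1 - a.1 + (b.2 - a.2) ≤ 1 ∧ (b.1 ≠ a.1 ∨ b.2 ≠ a.2) := by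
  simp only [Adj, Set.mem_insert_iff, Set.mem_singleton_iff, Prod.mk.injEq]
  omega

theorem Adj.symm {a b : Site} (h : Adj a b) : Adj b a := by
  rw [adj_iff] at *; omega

/-- `u` and `v` are joined by a lattice path all of whose sites lie in `S`. -/
def Conn (S : Set Site) (u v : Site) : Prop :=
  u ∈ S ∧ Relation.ReflTransGen (fun a b => Adj a b ∧ b ∈ S) u v

namespace Conn

variable {S T : Set Site} {u v w : Site}

theorem refl (h : u ∈ S) : Conn S u u := ⟨h, Relation.ReflTransGen.refl⟩

theorem mem_left (h : Conn S u v) : u ∈ S := h.1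

theorem mem_right (h : Conn S u v) : v ∈ S := by
  obtain ⟨h1, h2⟩ := h
  induction h2 with
  | refl => exact h1
  | tail _ h _ => exact h.2

theorem trans (h : Conn S u v) (h' : Conn S v w) : Conn S u w := ⟨h.1, h.2.trans h'.2⟩

theorem tail (h : Conn S u v) (ha : Adj v w) (hw : w ∈ S) : Conn S u w :=
  ⟨h.1, h.2.tail ⟨ha, hw⟩⟩

theorem single (hu : u ∈ S) (ha : Adj u v) (hv : v ∈ S) : Conn S u v := (refl hu).tail ha hv

theorem head (hu : u ∈ S) (ha : Adj u v) (h : Conn S v w) : Conn S u w :=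
  (single hu ha h.1).trans h

@[elab_as_elim]
theorem rec_tail {P : Site → Prop} (h : Conn S u v) (h0 : P u)
    (hs : ∀ a b, Conn S u a → Adj a b → b ∈ S → P a → P b) : P v := by
  obtain ⟨h1, h2⟩ := h
  induction h2 with
  | refl => exact h0
  | tail h h' ih => exact hs _ _ ⟨h1, h⟩ h'.1 h'.2 ih

theorem symm (h : Conn S u v) : Conn S v u := by
  refine h.rec_tail (P := fun x => Conn S x u) (refl h.1) ?_
  intro a b _ hab hb ih
  exact head hb hab.symm ih

theorem mono (h : Conn S u v) (hST : S ⊆ T) : Conn T u v := by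
  refine h.rec_tail (refl (hST h.1)) ?_
  intro a b _ hab hb ih
  exact ih.tail hab (hST hb)

/-- A path restricted to the set of sites it visits. -/
theorem restrict (h : Conn S u v) : Conn {x | Conn S u x} u v := by
  refine h.rec_tail (refl (Conn.refl h.1)) ?_
  intro a b ha hab hb ih
  exact ih.tail hab (ha.tail hab hb)

/-- Either the whole path stays in `T`, or there is a first step leaving `T`. -/
theorem exit_or (h : Conn S u v) (hu : u ∈ T) :
    Conn (S ∩ T) u v ∨ ∃ a b, Conn (S ∩ T) u a ∧ Adj a b ∧ b ∈ S ∧ b ∉ T ∧ Conn S b v := by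
  suffices H : ∀ x, Conn S u x → Conn (S ∩ T) u x ∨
      ∃ a b, Conn (S ∩ T) u a ∧ Adj a b ∧ b ∈ S ∧ b ∉ T ∧ Conn S b x from H v h
  intro x hx
  refine hx.rec_tail (Or.inl (refl ⟨h.1, hu⟩)) ?_
  intro a b _ hab hb ih
  rcases ih with ih | ⟨c, d, h1, h2, h3, h4, h5⟩
  · by_cases hbT : b ∈ T
    · exact Or.inl (ih.tail hab ⟨hb, hbT⟩)
    · exact Or.inr ⟨a, b, ih, hab, hb, hbT, refl hb⟩
  · exact Or.inr ⟨c, d, h1, h2, h3, h4, h5.tail hab hb⟩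

theorem exit (h : Conn S u v) (hu : u ∈ T) (hv : v ∉ T) :
    ∃ a b, Conn (S ∩ T) u a ∧ Adj a b ∧ b ∈ S ∧ b ∉ T ∧ Conn S b v := by
  rcases h.exit_or hu with h' | h'
  · exact absurd h'.mem_right.2 hv
  · exact h'

/-- Transport of a path along an adjacency-preserving map. -/
theorem map (f : Site → Site) (hf : ∀ a b, Adj a b → Adj (f a) (f b) ∨ f a = f b)
    (hST : ∀ a ∈ S, f a ∈ T) (h : Conn S u v) : Conn T (f u) (f v) := by
  refine h.rec_tail (P := fun x => Conn T (f u) (f x)) (refl (hST _ h.1)) ?_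
  intro a b _ hab hb ih
  rcases hf a b hab with h' | h'
  · exact ih.tail h' (hST _ hb)
  · rwa [← h']

/-- A set closed under steps within `S` contains everything reachable. -/
theorem mem_of_closed (h : Conn S u v) (hu : u ∈ T)
    (hT : ∀ a b, a ∈ T → Adj a b → b ∈ S → b ∈ T) : v ∈ T :=
  h.rec_tail hu fun a b _ hab hb ha => hT a b ha hab hb

theorem exists_list (h : Conn S u v) :
    ∃ p, PathIn S p ∧ p.head? = some u ∧ p.getLast? = some v := by
  have H : ∀ x, Conn S v x → ∃ p, PathIn S p ∧ p.head? = some x ∧ p.getLast? = some v := by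
    intro x hx
    refine hx.rec_tail ⟨[v], ⟨⟨by simp, by simp, List.isChain_singleton _⟩, by simpa using hx.1⟩,
      by simp, by simp⟩ ?_
    rintro a b ha hab hb ⟨p, ⟨⟨hp0, hp1, hp2⟩, hpS⟩, hh, hl⟩
    by_cases hbp : b ∈ p
    · obtain ⟨s, t, rfl⟩ := List.append_of_mem hbp
      refine ⟨b :: t, ⟨⟨by simp, (List.nodup_append.1 hp1).2.1, ?_⟩, ?_⟩, by simp, ?_⟩
      · exact List.IsChain.right_of_append hp2
      · intro w hw; exact hpS w (by simp at hw ⊢; tauto)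
      · simpa [List.getLast?_append] using hl
    · refine ⟨b :: p, ⟨⟨by simp, List.nodup_cons.2 ⟨hbp, hp1⟩, ?_⟩, ?_⟩, by simp, ?_⟩
      · refine List.IsChain.cons hp2 ?_
        intro y hy
        rw [hh] at hy
        simp at hy; subst hy; exact hab.symm
      · intro w hw
        rcases List.mem_cons.1 hw with rfl | hw
        · exact hb
        · exact hpS w hw
      · rw [List.getLast?_cons, hl]; simp
  exact H u h.symm

theorem of_list {p : List Site} (hp : PathIn S p) (hu : p.head? = some u) (hw : w ∈ p) :
    Conn S u w := by
  obtain ⟨⟨hp0, hp1, hp2⟩, hpS⟩ := hp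
  clear hp1
  induction p generalizing u with
  | nil => simp at hw
  | cons a t ih =>
    simp at hu; subst hu
    rcases List.mem_cons.1 hw with rfl | hw
    · exact refl (hpS _ (by simp))
    · cases t with
      | nil => simp at hw
      | cons b t =>
        have h1 := List.isChain_cons_cons.1 hp2
        exact head (hpS _ (by simp)) h1.1
          (ih rfl hw (fun v hv => hpS v (List.mem_cons_of_mem _ hv)) (by simp) h1.2)

end Conn

/-- The triangular board of side `n` for the game of Y. -/
def triBoard (n : ℤ) : Set Site := {v | 0 ≤ v.1 ∧ 0 ≤ v.2 ∧ v.1 + v.2 ≤ n}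

/-- The set `A` contains a connected set touching all three sides of the triangular board. -/
def YWin (n : ℤ) (A : Set Site) : Prop :=
  ∃ a b c, Conn (triBoard n ∩ A) a b ∧ Conn (triBoard n ∩ A) a c ∧ a.1 = 0 ∧ b.2 = 0 ∧ c.1 + c.2 = n

/-- Corners of the upward triangle based at `v`. -/
def corner (v w : Site) : Prop := w = v ∨ w = (v.1 + 1, v.2) ∨ w = (v.1, v.2 + 1)

/-- The majority colouring of upward triangles. -/
def majority (A : Set Site) : Set Site :=
  {v | (v ∈ A ∧ (v.1 + 1, v.2) ∈ A) ∨ (v ∈ A ∧ (v.1, v.2 + 1) ∈ A) ∨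
    ((v.1 + 1, v.2) ∈ A ∧ (v.1, v.2 + 1) ∈ A)}

theorem majority_compl (A : Set Site) : majority Aᶜ = (majority A)ᶜ := by
  ext v
  simp only [majority, Set.mem_ofPred_eq, Set.mem_compl_iff]
  tauto

theorem corner_iff {v w : Site} : corner v w ↔
    v.1 ≤ w.1 ∧ v.2 ≤ w.2 ∧ w.1 + w.2 ≤ v.1 + v.2 + 1 := by
  obtain ⟨a, b⟩ := v
  obtain ⟨c, d⟩ := w
  simp only [corner, Prod.mk.injEq]
  omega

theorem mem_majority_of {A : Set Site} {v x y : Site} (hx : corner v x) (hy : corner v y)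
    (hxA : x ∈ A) (hyA : y ∈ A) (hxy : x ≠ y) : v ∈ majority A := by
  simp only [majority, Set.mem_ofPred_eq]
  rcases hx with rfl | rfl | rfl <;> rcases hy with rfl | rfl | rfl <;> tauto

theorem Site.eq_or_adj {x y : Site} (h : -1 ≤ y.1 - x.1 ∧ y.1 - x.1 ≤ 1 ∧ -1 ≤ y.2 - x.2 ∧
    y.2 - x.2 ≤ 1 ∧ -1 ≤ y.1 - x.1 + (y.2 - x.2) ∧ y.1 - x.1 + (y.2 - x.2) ≤ 1) :
    x = y ∨ Adj x y := by
  by_cases hxy : x = y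
  · exact Or.inl hxy
  · right
    rw [adj_iff]
    have : y.1 ≠ x.1 ∨ y.2 ≠ x.2 := by
      by_contra hc
      push Not at hc
      exact hxy (Prod.ext hc.1.symm hc.2.symm)
    omega

theorem conn_of_eq_or_adj {S : Set Site} {x y : Site} (hx : x ∈ S) (hy : y ∈ S)
    (h : x = y ∨ Adj x y) : Conn S x y := by
  rcases h with rfl | h
  · exact Conn.refl hx
  · exact Conn.single hx h hy

theorem corner_mem_triBoard {n : ℤ} {t x : Site} (ht : t ∈ triBoard n) (h : corner t x) :
    x ∈ triBoard (n + 1) := by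
  rw [corner_iff] at h
  simp only [triBoard, Set.mem_ofPred_eq] at *
  omega

theorem exists_corner_pair {A : Set Site} {s t : Site} (h : Adj s t) (hs : s ∈ majority A)
    (ht : t ∈ majority A) :
    ∃ x y, corner s x ∧ corner t y ∧ x ∈ A ∧ y ∈ A ∧ (x = y ∨ Adj x y) := by
  by_contra hcon
  push Not at hcon
  have key : ∀ x y, corner s x → corner t y → (x = y ∨ Adj x y) → x ∈ A → y ∈ A → False :=
    fun x y h1 h2 h3 h4 h5 => by
      have := hcon x y h1 h2 h4 h5
      tauto
  obtain ⟨a, b⟩ := s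
  obtain ⟨c, d⟩ := t
  simp only [majority, Set.mem_ofPred_eq] at hs ht
  have K : ∀ x1 x2 y1 y2 : ℤ, (x1, x2) ∈ A → (y1, y2) ∈ A →
      ¬ (a ≤ x1 ∧ b ≤ x2 ∧ x1 + x2 ≤ a + b + 1 ∧ c ≤ y1 ∧ d ≤ y2 ∧ y1 + y2 ≤ c + d + 1 ∧
        -1 ≤ y1 - x1 ∧ y1 - x1 ≤ 1 ∧ -1 ≤ y2 - x2 ∧ y2 - x2 ≤ 1 ∧
        -1 ≤ y1 - x1 + (y2 - x2) ∧ y1 - x1 + (y2 - x2) ≤ 1) := by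
    rintro x1 x2 y1 y2 hx hy ⟨h1, h2, h3, h4, h5, h6, h7⟩
    exact key (x1, x2) (y1, y2) (corner_iff.2 ⟨h1, h2, h3⟩) (corner_iff.2 ⟨h4, h5, h6⟩)
      (Site.eq_or_adj (by simpa using h7)) hx hy
  simp only [adj_iff] at h
  rcases hs with ⟨h1, h2⟩ | ⟨h1, h2⟩ | ⟨h1, h2⟩ <;>
    rcases ht with ⟨h3, h4⟩ | ⟨h3, h4⟩ | ⟨h3, h4⟩ <;>
  · have q1 := K _ _ _ _ h1 h3
    have q2 := K _ _ _ _ h1 h4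
    have q3 := K _ _ _ _ h2 h3
    have q4 := K _ _ _ _ h2 h4
    omega

theorem YWin.majority_of {n : ℤ} (hn : 0 ≤ n) {A : Set Site} (h : YWin (n + 1) A) :
    YWin n (majority A) := by
  obtain ⟨a, b, c, hab, hac, ha, hb, hc⟩ := h
  have step : ∀ u v, Adj u v → u ∈ triBoard (n + 1) ∩ A → v ∈ triBoard (n + 1) ∩ A →
      ∃ t, corner t u ∧ corner t v ∧ t ∈ triBoard n ∩ majority A := by
    intro u v huv hu hv
    refine ⟨(min u.1 v.1, min u.2 v.2), ?_⟩
    have hne : u ≠ v := by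
      rintro rfl
      simp [adj_iff] at huv
    have h1 : corner (min u.1 v.1, min u.2 v.2) u := by
      rw [corner_iff]; rw [adj_iff] at huv; dsimp only; omega
    have h2 : corner (min u.1 v.1, min u.2 v.2) v := by
      rw [corner_iff]; rw [adj_iff] at huv; dsimp only; omega
    refine ⟨h1, h2, ?_, mem_majority_of h1 h2 hu.2 hv.2 hne⟩
    have := hu.1
    have := hv.1
    simp only [triBoard, Set.mem_ofPred_eq] at *
    rw [adj_iff] at huv
    omega
  have same : ∀ s t x, corner s x → corner t x → (s = t ∨ Adj s t) := by
    intro s t x h1 h2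
    rw [corner_iff] at h1 h2
    apply Site.eq_or_adj
    omega
  have lift : ∀ u v s, Conn (triBoard (n + 1) ∩ A) u v → corner s u → s ∈ triBoard n ∩ majority A →
      ∃ t, corner t v ∧ Conn (triBoard n ∩ majority A) s t := by
    intro u v s h hs hsm
    refine h.rec_tail ⟨s, hs, Conn.refl hsm⟩ ?_
    rintro p q hp hpq hq ⟨t, ht, hst⟩
    obtain ⟨t', h1, h2, h3⟩ := step p q hpq hp.mem_right hq
    exact ⟨t', h2, hst.trans (conn_of_eq_or_adj hst.mem_right h3 (same t t' p ht h1))⟩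
  obtain ⟨s, hs, hsm⟩ : ∃ s, corner s a ∧ s ∈ triBoard n ∩ majority A := by
    have nb : ∀ x, Conn (triBoard (n + 1) ∩ A) a x → x ≠ a →
        ∃ s, corner s a ∧ s ∈ triBoard n ∩ majority A := by
      intro x hx hxa
      obtain ⟨p, q, h1, h2, h3, h4, -⟩ := hx.exit (T := {a}) rfl hxa
      have hpa : p = a := h1.mem_right.2
      subst hpa
      obtain ⟨t, h5, -, h6⟩ := step p q h2 hx.1 h3
      exact ⟨t, h5, h6⟩
    by_cases hba : b = a
    · refine nb c hac ?_
      rintro rfl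
      subst hba
      omega
    · exact nb b hab hba
  obtain ⟨tb, htb, hcb⟩ := lift a b s hab hs hsm
  obtain ⟨tc, htc, hcc⟩ := lift a c s hac hs hsm
  refine ⟨s, tb, tc, hcb, hcc, ?_, ?_, ?_⟩
  · have := hsm.1
    simp only [triBoard, Set.mem_ofPred_eq] at this
    rw [corner_iff] at hs
    omega
  · have := hcb.mem_right.1
    simp only [triBoard, Set.mem_ofPred_eq] at this
    rw [corner_iff] at htb
    omega
  · have := hcc.mem_right.1
    simp only [triBoard, Set.mem_ofPred_eq] at this
    rw [corner_iff] at htc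
    omega

theorem YWin.of_majority {n : ℤ} {A : Set Site} (h : YWin n (majority A)) :
    YWin (n + 1) A := by
  obtain ⟨a, b, c, hab, hac, ha, hb, hc⟩ := h
  have lift : ∀ s t, Conn (triBoard n ∩ majority A) s t → ∀ x y, corner s x → x ∈ A → corner t y →
      y ∈ A → Conn (triBoard (n + 1) ∩ A) x y := by
    intro s t h x y hx hxA hy hyA
    suffices H : ∀ y, corner t y → y ∈ A → Conn (triBoard (n + 1) ∩ A) x y from H y hy hyA
    have base : ∀ s, s ∈ triBoard n → ∀ x y, corner s x → x ∈ A → corner s y → y ∈ A →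
        Conn (triBoard (n + 1) ∩ A) x y := by
      intro s hs x y hx hxA hy hyA
      refine conn_of_eq_or_adj ⟨corner_mem_triBoard hs hx, hxA⟩
        ⟨corner_mem_triBoard hs hy, hyA⟩ (Site.eq_or_adj ?_)
      rw [corner_iff] at hx hy
      omega
    refine h.rec_tail (fun y hy hyA => base s h.1.1 x y hx hxA hy hyA) ?_
    intro p q hp hpq hq ih y hy hyA
    obtain ⟨z, z', h1, h2, h3, h4, h5⟩ := exists_corner_pair hpq hp.mem_right.2 hq.2
    have hz := corner_mem_triBoard hp.mem_right.1 h1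
    have hz' := corner_mem_triBoard hq.1 h2
    exact ((ih z h1 h3).trans (conn_of_eq_or_adj ⟨hz, h3⟩ ⟨hz', h4⟩ h5)).trans
      (base q hq.1 _ _ h2 h4 hy hyA)
  have ha' := hab.1
  have hb' := hab.mem_right
  have hc' := hac.mem_right
  have pick : ∀ t ∈ majority A, (∃ x, corner t x ∧ x ∈ A ∧ x.1 = t.1) ∧
      (∃ x, corner t x ∧ x ∈ A ∧ x.2 = t.2) ∧
      (∃ x, corner t x ∧ x ∈ A ∧ x.1 + x.2 = t.1 + t.2 + 1) := by
    rintro t (⟨h1, h2⟩ | ⟨h1, h2⟩ | ⟨h1, h2⟩)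
    · exact ⟨⟨_, Or.inl rfl, h1, rfl⟩, ⟨_, Or.inl rfl, h1, rfl⟩,
        ⟨_, Or.inr (Or.inl rfl), h2, by dsimp only; omega⟩⟩
    · exact ⟨⟨_, Or.inl rfl, h1, rfl⟩, ⟨_, Or.inl rfl, h1, rfl⟩,
        ⟨_, Or.inr (Or.inr rfl), h2, by dsimp only; omega⟩⟩
    · exact ⟨⟨_, Or.inr (Or.inr rfl), h2, rfl⟩, ⟨_, Or.inr (Or.inl rfl), h1, rfl⟩,
        ⟨_, Or.inr (Or.inr rfl), h2, by dsimp only; omega⟩⟩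
  obtain ⟨x, h1, h2, h3⟩ := (pick a ha'.2).1
  obtain ⟨y, h4, h5, h6⟩ := (pick b hb'.2).2.1
  obtain ⟨z, h7, h8, h9⟩ := (pick c hc'.2).2.2
  exact ⟨x, y, z, lift a b hab x y h1 h2 h4 h5, lift a c hac x z h1 h2 h7 h8, by omega, by omega,
    by omega⟩

theorem yWin_compl_iff (n : ℕ) (A : Set Site) : YWin n Aᶜ ↔ ¬ YWin n A := by
  induction n generalizing A with
  | zero =>
    have key : ∀ A : Set Site, YWin ((0 : ℕ) : ℤ) A ↔ ((0, 0) : Site) ∈ A := by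
      intro A
      constructor
      · rintro ⟨a, b, c, hab, hac, ha, hb, hc⟩
        have h1 := hab.1
        have h2 := hab.1.1
        simp only [triBoard, Set.mem_ofPred_eq] at h2
        have : a = (0, 0) := by ext <;> simp <;> omega
        exact this ▸ h1.2
      · intro h
        refine ⟨(0, 0), (0, 0), (0, 0), Conn.refl ⟨?_, h⟩, Conn.refl ⟨?_, h⟩, rfl, rfl, rfl⟩ <;>
          simp [triBoard]
    rw [key, key]; rfl
  | succ n ih =>
    have key : ∀ A : Set Site, YWin ((n + 1 : ℕ) : ℤ) A ↔ YWin n (majority A) := by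
      intro A
      push_cast
      exact ⟨YWin.majority_of (by omega), YWin.of_majority⟩
    rw [key, key, majority_compl, ih]

theorem mem_rect {x₀ x₁ y₀ y₁ : ℤ} {v : Site} :
    v ∈ rect x₀ x₁ y₀ y₁ ↔ x₀ ≤ v.1 ∧ v.1 ≤ x₁ ∧ y₀ ≤ v.2 ∧ v.2 ≤ y₁ := Iff.rfl

/-- Left-right crossing of a rectangle by sites of `A`. -/
def LR (x₀ x₁ y₀ y₁ : ℤ) (A : Set Site) : Prop :=
  ∃ u v, Conn (rect x₀ x₁ y₀ y₁ ∩ A) u v ∧ u.1 = x₀ ∧ v.1 = x₁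

/-- Top-bottom crossing of a rectangle by sites of `A`. -/
def TB (x₀ x₁ y₀ y₁ : ℤ) (A : Set Site) : Prop :=
  ∃ u v, Conn (rect x₀ x₁ y₀ y₁ ∩ A) u v ∧ u.2 = y₁ ∧ v.2 = y₀

theorem conn_col {S : Set Site} {x y₁ y₂ : ℤ} (h : y₁ ≤ y₂)
    (hS : ∀ y, y₁ ≤ y → y ≤ y₂ → (x, y) ∈ S) : Conn S (x, y₁) (x, y₂) := by
  induction y₂, h using Int.leInduction with
  | base => exact Conn.refl (hS _ le_rfl le_rfl)
  | succ n hn ih =>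
    refine (ih fun y h1 h2 => hS y h1 (by omega)).tail ?_ (hS _ (by omega) le_rfl)
    rw [adj_iff]; dsimp only; omega

theorem conn_row {S : Set Site} {y x₁ x₂ : ℤ} (h : x₁ ≤ x₂)
    (hS : ∀ x, x₁ ≤ x → x ≤ x₂ → (x, y) ∈ S) : Conn S (x₁, y) (x₂, y) := by
  induction x₂, h using Int.leInduction with
  | base => exact Conn.refl (hS _ le_rfl le_rfl)
  | succ n hn ih =>
    refine (ih fun y h1 h2 => hS y h1 (by omega)).tail ?_ (hS _ (by omega) le_rfl)
    rw [adj_iff]; dsimp only; omega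

/-- Embedding of a rectangular colouring into the board of the game of Y. -/
def hexColour (w h : ℤ) (A : Set Site) : Set Site :=
  {v | w < v.1 ∨ (v.1 ≤ w ∧ v.2 ≤ h ∧ v ∈ A)}

theorem YWin.to_LR {w h : ℤ} (hw : 0 ≤ w) {A : Set Site} (H : YWin (w + h + 1) (hexColour w h A)) :
    LR 0 w 0 h A := by
  obtain ⟨a, b, c, -, hac, ha, -, hc⟩ := H
  have h1 := hac.mem_right
  have hcw : w < c.1 := by
    rcases h1.2 with h | h
    · exact h
    · omega
  obtain ⟨p, q, h2, h3, h4, h5, -⟩ := hac.exit (T := {v | v.1 ≤ w}) (by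
    rw [Set.mem_ofPred_eq]; omega) (by rw [Set.mem_ofPred_eq]; omega)
  rw [Set.mem_ofPred_eq] at h5
  refine ⟨a, p, h2.mono ?_, ha, ?_⟩
  · rintro v ⟨⟨⟨h6, h7, h8⟩, h9⟩, h10⟩
    rw [Set.mem_ofPred_eq] at h10
    rcases h9 with h9 | h9
    · omega
    · exact ⟨⟨h6, h9.1, h7, h9.2.1⟩, h9.2.2⟩
  · have := h2.mem_right.2
    rw [Set.mem_ofPred_eq] at this
    rw [adj_iff] at h3
    omega

theorem YWin.to_TB {w h : ℤ} (hh : 0 ≤ h) {A : Set Site}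
    (H : YWin (w + h + 1) (hexColour w h A)ᶜ) : TB 0 w 0 h Aᶜ := by
  obtain ⟨a, b, c, hab, hac, -, hb, hc⟩ := H
  have hbc := hab.symm.trans hac
  have h1 := hac.mem_right.2
  have hch : h < c.2 := by
    simp only [hexColour, Set.mem_compl_iff, Set.mem_ofPred_eq] at h1
    omega
  obtain ⟨p, q, h2, h3, h4, h5, -⟩ := hbc.exit (T := {v | v.2 ≤ h}) (by
    rw [Set.mem_ofPred_eq]; omega) (by rw [Set.mem_ofPred_eq]; omega)
  rw [Set.mem_ofPred_eq] at h5
  refine ⟨p, b, h2.symm.mono ?_, ?_, hb⟩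
  · rintro v ⟨⟨⟨h6, h7, h8⟩, h9⟩, h10⟩
    rw [Set.mem_ofPred_eq] at h10
    simp only [hexColour, Set.mem_compl_iff, Set.mem_ofPred_eq, not_or, not_and] at h9
    exact ⟨⟨h6, by omega, h7, h10⟩, h9.2 (by omega) h10⟩
  · have := h2.mem_right.2
    rw [Set.mem_ofPred_eq] at this
    rw [adj_iff] at h3
    omega

theorem LR.to_yWin {w h : ℤ} {A : Set Site} (H : LR 0 w 0 h A) :
    YWin (w + h + 1) (hexColour w h A) := by
  obtain ⟨u, v, huv, hu, hv⟩ := H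
  have h1 : Conn (triBoard (w + h + 1) ∩ hexColour w h A) u v := by
    refine huv.mono ?_
    rintro z ⟨⟨h1, h2, h3, h4⟩, h5⟩
    exact ⟨⟨h1, h3, by omega⟩, Or.inr ⟨h2, h4, h5⟩⟩
  have hv' := huv.mem_right.1
  rw [mem_rect] at hv'
  have hu' := huv.1.1
  rw [mem_rect] at hu'
  have hcol : ∀ y, 0 ≤ y → y ≤ h → (w + 1, y) ∈ triBoard (w + h + 1) ∩ hexColour w h A := by
    intro y h1 h2
    refine ⟨⟨?_, ?_, ?_⟩, Or.inl ?_⟩ <;> dsimp only <;> omega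
  have h2 : Conn (triBoard (w + h + 1) ∩ hexColour w h A) u (w + 1, v.2) :=
    h1.tail (by rw [adj_iff]; dsimp only; omega) (hcol _ hv'.2.2.1 hv'.2.2.2)
  have h3 : Conn (triBoard (w + h + 1) ∩ hexColour w h A) (w + 1, 0) (w + 1, v.2) :=
    conn_col hv'.2.2.1 fun y h1 h2 => hcol y h1 (by omega)
  have h4 : Conn (triBoard (w + h + 1) ∩ hexColour w h A) (w + 1, v.2) (w + 1, h) :=
    conn_col hv'.2.2.2 fun y h1 h2 => hcol y (by omega) h2
  exact ⟨u, _, _, h2.trans h3.symm, h2.trans h4, hu, rfl, by dsimp only; omega⟩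

theorem TB.to_yWin {w h : ℤ} {A : Set Site} (H : TB 0 w 0 h Aᶜ) :
    YWin (w + h + 1) (hexColour w h A)ᶜ := by
  obtain ⟨u, v, huv, hu, hv⟩ := H
  have h1 : Conn (triBoard (w + h + 1) ∩ (hexColour w h A)ᶜ) u v := by
    refine huv.mono ?_
    rintro z ⟨⟨h1, h2, h3, h4⟩, h5⟩
    refine ⟨⟨h1, h3, by omega⟩, ?_⟩
    rintro (h | h)
    · omega
    · exact h5 h.2.2
  have hu' := huv.1.1
  rw [mem_rect] at hu'
  have hrow : ∀ x, 0 ≤ x → x ≤ w → (x, h + 1) ∈ triBoard (w + h + 1) ∩ (hexColour w h A)ᶜ := by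
    intro x h1 h2
    refine ⟨⟨?_, ?_, ?_⟩, ?_⟩
    any_goals (dsimp only; omega)
    simp only [hexColour, Set.mem_compl_iff, Set.mem_ofPred_eq]
    omega
  have h0 : Conn (triBoard (w + h + 1) ∩ (hexColour w h A)ᶜ) (u.1, h + 1) v :=
    Conn.head (hrow _ hu'.1 hu'.2.1) (by rw [adj_iff]; dsimp only; omega) h1
  have h3 : Conn (triBoard (w + h + 1) ∩ (hexColour w h A)ᶜ) (0, h + 1) (u.1, h + 1) :=
    conn_row hu'.1 fun y h1 h2 => hrow y h1 (by omega)
  have h4 : Conn (triBoard (w + h + 1) ∩ (hexColour w h A)ᶜ) (u.1, h + 1) (w, h + 1) :=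
    conn_row hu'.2.1 fun y h1 h2 => hrow y (by omega) h2
  exact ⟨_, v, _, h3.trans h0, h3.trans h4, rfl, hv, by dsimp only; omega⟩

/-- Adding a fixed vector preserves connections. -/
theorem Conn.translate {S T : Set Site} {u v : Site} (d : Site) (h : Conn S u v)
    (hST : ∀ a ∈ S, a + d ∈ T) : Conn T (u + d) (v + d) := by
  refine h.map (fun a => a + d) (fun a b hab => Or.inl ?_) hST
  rw [adj_iff] at *
  simp only [Prod.fst_add, Prod.snd_add]
  omega

theorem LR.translate {x₀ x₁ y₀ y₁ : ℤ} {A B : Set Site} (d : Site) (h : LR x₀ x₁ y₀ y₁ A)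
    (hAB : ∀ a ∈ A, a + d ∈ B) : LR (x₀ + d.1) (x₁ + d.1) (y₀ + d.2) (y₁ + d.2) B := by
  obtain ⟨u, v, huv, hu, hv⟩ := h
  refine ⟨u + d, v + d, huv.translate d ?_, by simp [hu], by simp [hv]⟩
  rintro a ⟨h1, h2⟩
  refine ⟨?_, hAB a h2⟩
  simpa [mem_rect] using h1

theorem TB.translate {x₀ x₁ y₀ y₁ : ℤ} {A B : Set Site} (d : Site) (h : TB x₀ x₁ y₀ y₁ A)
    (hAB : ∀ a ∈ A, a + d ∈ B) : TB (x₀ + d.1) (x₁ + d.1) (y₀ + d.2) (y₁ + d.2) B := by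
  obtain ⟨u, v, huv, hu, hv⟩ := h
  refine ⟨u + d, v + d, huv.translate d ?_, by simp [hu], by simp [hv]⟩
  rintro a ⟨h1, h2⟩
  refine ⟨?_, hAB a h2⟩
  simpa [mem_rect] using h1

/-- Hex: the two players cannot both connect. -/
theorem LR.not_TB {x₀ x₁ y₀ y₁ : ℤ} {A : Set Site} (h : LR x₀ x₁ y₀ y₁ A) :
    ¬ TB x₀ x₁ y₀ y₁ Aᶜ := by
  intro h'
  have hx : x₀ ≤ x₁ ∧ y₀ ≤ y₁ := by
    obtain ⟨u, v, huv, hu, hv⟩ := h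
    have := huv.1.1
    rw [mem_rect] at this
    omega
  have k1 := h.translate (B := {v | v + (x₀, y₀) ∈ A}) (-x₀, -y₀) (fun a ha => by
    have : a + (-x₀, -y₀) + (x₀, y₀) = a := by ext <;> simp
    simpa only [Set.mem_ofPred_eq, Set.mem_compl_iff, this] using ha)
  have k2 := h'.translate (B := {v | v + (x₀, y₀) ∈ A}ᶜ) (-x₀, -y₀) (fun a ha => by
    have : a + (-x₀, -y₀) + (x₀, y₀) = a := by ext <;> simp
    simpa only [Set.mem_ofPred_eq, Set.mem_compl_iff, this] using ha)
  simp only [add_neg_cancel, ← sub_eq_add_neg] at k1 k2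
  have k3 := k1.to_yWin
  have k4 := k2.to_yWin
  have := yWin_compl_iff (x₁ - x₀ + (y₁ - y₀) + 1).toNat
    (hexColour (x₁ - x₀) (y₁ - y₀) {v | v + (x₀, y₀) ∈ A})
  rw [Int.toNat_of_nonneg (by omega)] at this
  exact this.1 k4 k3

/-- Hex: one of the two players connects. -/
theorem LR_or_TB {x₀ x₁ y₀ y₁ : ℤ} (hx : x₀ ≤ x₁) (hy : y₀ ≤ y₁) (A : Set Site) :
    LR x₀ x₁ y₀ y₁ A ∨ TB x₀ x₁ y₀ y₁ Aᶜ := by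
  have := yWin_compl_iff (x₁ - x₀ + (y₁ - y₀) + 1).toNat
    (hexColour (x₁ - x₀) (y₁ - y₀) {v | v + (x₀, y₀) ∈ A})
  rw [Int.toNat_of_nonneg (by omega)] at this
  by_cases h : YWin (x₁ - x₀ + (y₁ - y₀) + 1) (hexColour (x₁ - x₀) (y₁ - y₀) {v | v + (x₀, y₀) ∈ A})
  · left
    have := (h.to_LR (by omega)).translate (B := A) (x₀, y₀) (fun a ha => ha)
    simpa using this
  · right
    have := ((this.2 h).to_TB (by omega)).translate (B := Aᶜ) (x₀, y₀) (fun a ha => ha)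
    simpa using this

/-- A left-right path and a top-bottom path of the same rectangle meet. -/
theorem Conn.meet {x₀ x₁ y₀ y₁ : ℤ} {K L : Set Site} {u v p q : Site}
    (h : Conn (rect x₀ x₁ y₀ y₁ ∩ K) u v) (hu : u.1 = x₀) (hv : v.1 = x₁)
    (h' : Conn (rect x₀ x₁ y₀ y₁ ∩ L) p q) (hp : p.2 = y₁) (hq : q.2 = y₀) :
    ∃ z, Conn (rect x₀ x₁ y₀ y₁ ∩ K) u z ∧ Conn (rect x₀ x₁ y₀ y₁ ∩ L) p z := by
  by_contra hcon
  push Not at hcon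
  have h1 : LR x₀ x₁ y₀ y₁ {z | Conn (rect x₀ x₁ y₀ y₁ ∩ K) u z} :=
    ⟨u, v, h.restrict.mono fun z hz => ⟨hz.mem_right.1, hz⟩, hu, hv⟩
  refine h1.not_TB ⟨p, q, h'.restrict.mono fun z hz => ⟨hz.mem_right.1, fun hz' => ?_⟩, hp, hq⟩
  exact hcon z hz' hz

theorem LR.mono {x₀ x₁ y₀ y₁ : ℤ} {A B : Set Site} (h : LR x₀ x₁ y₀ y₁ A)
    (hAB : rect x₀ x₁ y₀ y₁ ∩ A ⊆ B) : LR x₀ x₁ y₀ y₁ B := by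
  obtain ⟨u, v, huv, hu, hv⟩ := h
  exact ⟨u, v, huv.mono fun z hz => ⟨hz.1, hAB hz⟩, hu, hv⟩

theorem TB.mono {x₀ x₁ y₀ y₁ : ℤ} {A B : Set Site} (h : TB x₀ x₁ y₀ y₁ A)
    (hAB : rect x₀ x₁ y₀ y₁ ∩ A ⊆ B) : TB x₀ x₁ y₀ y₁ B := by
  obtain ⟨u, v, huv, hu, hv⟩ := h
  exact ⟨u, v, huv.mono fun z hz => ⟨hz.1, hAB hz⟩, hu, hv⟩

/-- A coordinate-like function changing by at most one along edges. -/
def StepOne (f : Site → ℤ) : Prop := ∀ a b, Adj a b → f b ≤ f a + 1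

theorem stepOne_fst : StepOne Prod.fst := fun a b h => by rw [adj_iff] at h; omega

theorem stepOne_snd : StepOne Prod.snd := fun a b h => by rw [adj_iff] at h; omega

theorem stepOne_neg_fst : StepOne (fun v => -v.1) := fun a b h => by
  rw [adj_iff] at h; dsimp only; omega

theorem stepOne_neg_snd : StepOne (fun v => -v.2) := fun a b h => by
  rw [adj_iff] at h; dsimp only; omega

theorem Conn.first_hit {S : Set Site} {u v : Site} {f : Site → ℤ} (hf : StepOne f) {c : ℤ}
    (h : Conn S u v) (hu : f u ≤ c) (hv : c ≤ f v) :
    ∃ b, Conn (S ∩ {z | f z ≤ c}) u b ∧ f b = c ∧ Conn S b v := by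
  by_cases huc : f u = c
  · exact ⟨u, Conn.refl ⟨h.1, hu⟩, huc, h⟩
  · obtain ⟨a, b, h1, h2, h3, h4, h5⟩ := h.exit (T := {z | f z < c}) (lt_of_le_of_ne hu huc)
      (by rw [Set.mem_ofPred_eq]; omega)
    have h6 := hf a b h2
    have h7 := h1.mem_right.2
    rw [Set.mem_ofPred_eq] at h4 h7
    have h8 : f b = c := by omega
    refine ⟨b, (h1.mono ?_).tail h2 ⟨h3, h8.le⟩, h8, h5⟩
    exact Set.inter_subset_inter_right S fun z (hz : f z < c) => hz.le

theorem Conn.strip {S : Set Site} {u v : Site} {f : Site → ℤ} (hf : StepOne f) {c d : ℤ}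
    (hcd : c ≤ d) (h : Conn S u v) (hu : f u ≤ c) (hv : d ≤ f v) :
    ∃ a b, Conn (S ∩ {z | c ≤ f z ∧ f z ≤ d}) a b ∧ f a = c ∧ f b = d ∧ Conn S u a := by
  obtain ⟨b, h1, h2, -⟩ := h.first_hit hf (hu.trans hcd) hv
  have hf' : ∀ a b, Adj a b → -f b ≤ -f a + 1 := fun a b hab => by
    have := hf b a hab.symm
    omega
  obtain ⟨a, h3, h4, h5⟩ := h1.symm.first_hit (f := fun z => -f z) (c := -c) hf'
    (by omega) (by omega)
  refine ⟨a, b, h3.symm.mono ?_, by omega, h2, h5.symm.mono Set.inter_subset_left⟩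
  rintro z ⟨⟨h6, h7⟩, h8⟩
  simp only [Set.mem_ofPred_eq] at h7 h8
  exact ⟨h6, by omega, h7⟩

/-- The set of open sites of a configuration. -/
def opn (ω : Config) : Set Site := {v | ω v = true}

/-- Probability of an event expressed through the set of open sites. -/
noncomputable def pr (μ : Measure Config) (E : Set Site → Prop) : ℝ := μ.real {ω | E (opn ω)}

/-- The event `E` depends only on the sites of `S`. -/
def DepOn (S : Set Site) (E : Set Site → Prop) : Prop := ∀ A B, A ∩ S = B ∩ S → (E A ↔ E B)

/-- The event depends on finitely many sites. -/
def LocalEv (E : Set Site → Prop) : Prop := ∃ S : Set Site, S.Finite ∧ DepOn S E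

theorem inter_eq_of_subset {A B S T : Set Site} (hST : S ⊆ T) (h : A ∩ T = B ∩ T) :
    A ∩ S = B ∩ S := by
  rw [← Set.inter_eq_right.2 hST, ← Set.inter_assoc, ← Set.inter_assoc, h]

theorem DepOn.mono {S T : Set Site} {E : Set Site → Prop} (h : DepOn S E) (hST : S ⊆ T) :
    DepOn T E := fun A B hAB => h A B (inter_eq_of_subset hST hAB)

theorem DepOn.and {S : Set Site} {E F : Set Site → Prop} (hE : DepOn S E) (hF : DepOn S F) :
    DepOn S (fun A => E A ∧ F A) := fun A B h => and_congr (hE A B h) (hF A B h)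

theorem DepOn.not {S : Set Site} {E : Set Site → Prop} (hE : DepOn S E) :
    DepOn S (fun A => ¬ E A) := fun A B h => not_congr (hE A B h)

theorem DepOn.local {S : Set Site} {E : Set Site → Prop} (hE : DepOn S E) (hS : S.Finite) :
    LocalEv E := ⟨S, hS, hE⟩

theorem LocalEv.and {E F : Set Site → Prop} (hE : LocalEv E) (hF : LocalEv F) :
    LocalEv (fun A => E A ∧ F A) := by
  obtain ⟨S, hS, hE⟩ := hE
  obtain ⟨T, hT, hF⟩ := hF
  exact ⟨S ∪ T, hS.union hT, (hE.mono Set.subset_union_left).and (hF.mono Set.subset_union_right)⟩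

theorem LocalEv.not {E : Set Site → Prop} (hE : LocalEv E) : LocalEv (fun A => ¬ E A) := by
  obtain ⟨S, hS, hE⟩ := hE
  exact ⟨S, hS, hE.not⟩

theorem LocalEv.compl {E : Set Site → Prop} (hE : LocalEv E) : LocalEv (fun A => E Aᶜ) := by
  obtain ⟨S, hS, hE⟩ := hE
  refine ⟨S, hS, fun A B h => hE _ _ ?_⟩
  ext v
  have := congrArg (v ∈ ·) h
  simp only [Set.mem_inter_iff, Set.mem_compl_iff, eq_iff_iff] at this ⊢
  tauto

theorem LocalEv.equiv {E : Set Site → Prop} (hE : LocalEv E) (e : Site ≃ Site) :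
    LocalEv (fun A => E (e ⁻¹' A)) := by
  obtain ⟨S, hS, hE⟩ := hE
  refine ⟨e '' S, hS.image e, fun A B h => hE _ _ ?_⟩
  ext v
  have := congrArg (e v ∈ ·) h
  simpa using this

theorem DepOn.iff_inter {S : Set Site} {E : Set Site → Prop} (hE : DepOn S E) (A : Set Site) :
    E A ↔ E (A ∩ S) := hE _ _ (by rw [Set.inter_assoc, Set.inter_self])

section Counting

variable {μ : Measure Config}

open Classical in
theorem pr_eq_card (hμ : IsBernoulliHalf μ)
    {Λ : Finset Site} {E : Set Site → Prop} (hE : DepOn ↑Λ E) :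
    MeasurableSet {ω | E (opn ω)} ∧
      pr μ E = ((Λ.powerset.filter fun s : Finset Site => E ↑s).card : ℝ) / 2 ^ Λ.card := by
  have := hμ.1
  have hcyl : ∀ s : Finset Site, MeasurableSet {ω : Config | ∀ v ∈ Λ, ω v = decide (v ∈ s)} := by
    intro s
    have : {ω : Config | ∀ v ∈ Λ, ω v = decide (v ∈ s)} =
        ⋂ v ∈ Λ, (fun ω : Config => ω v) ⁻¹' {decide (v ∈ s)} := by
      ext ω; simp
    rw [this]
    exact Finset.measurableSet_biInter _ fun v _ =>
      measurable_pi_apply v (measurableSet_singleton _)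
  have hset : {ω | E (opn ω)} = ⋃ s ∈ Λ.powerset.filter fun s : Finset Site => E ↑s,
      {ω : Config | ∀ v ∈ Λ, ω v = decide (v ∈ s)} := by
    ext ω
    simp only [Set.mem_ofPred_eq, Set.mem_iUnion, Finset.mem_filter, Finset.mem_powerset,
      exists_prop]
    constructor
    · intro h
      refine ⟨Λ.filter fun v => ω v = true, ⟨Finset.filter_subset _ _, ?_⟩, ?_⟩
      · refine (hE _ _ ?_).1 h
        ext v
        simp +contextual [opn]
      · intro v hv
        simp [hv]
    · rintro ⟨s, ⟨hs, h⟩, hω⟩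
      refine (hE _ _ ?_).1 h
      ext v
      simp only [Set.mem_inter_iff, Finset.mem_coe, opn, Set.mem_ofPred_eq]
      refine and_congr_left fun hv => ?_
      rw [hω v hv]
      simp
  refine ⟨hset ▸ Finset.measurableSet_biUnion _ fun s _ => hcyl s, ?_⟩
  rw [pr, hset, measureReal_biUnion_finset]
  · have : ∀ s : Finset Site, μ.real {ω : Config | ∀ v ∈ Λ, ω v = decide (v ∈ s)} =
        (1 / 2) ^ Λ.card := by
      intro s
      rw [measureReal_def, hμ.2 Λ fun v => decide (v ∈ s)]
      simp
    simp only [this]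
    rw [Finset.sum_const, nsmul_eq_mul]
    simp [div_eq_mul_inv]
  · intro s hs t ht hst
    rw [Function.onFun, Set.disjoint_left]
    intro ω h1 h2
    apply hst
    simp only [Finset.coe_filter, Finset.mem_powerset, Set.mem_ofPred_eq] at hs ht h1 h2
    ext v
    by_cases hv : v ∈ Λ
    · have := (h1 v hv).symm.trans (h2 v hv)
      simpa using this
    · exact ⟨fun h => absurd (hs.1 h) hv, fun h => absurd (ht.1 h) hv⟩
  · exact fun s _ => hcyl s

theorem LocalEv.measurableSet (hμ : IsBernoulliHalf μ) {E : Set Site → Prop} (hE : LocalEv E) :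
    MeasurableSet {ω | E (opn ω)} := by
  obtain ⟨S, hS, hE⟩ := hE
  exact (pr_eq_card hμ (Λ := hS.toFinset) (by simpa using hE)).1

theorem pr_indep (hμ : IsBernoulliHalf μ)
    {S T : Set Site} {E F : Set Site → Prop} (hS : S.Finite) (hT : T.Finite)
    (hST : Disjoint S T) (hE : DepOn S E) (hF : DepOn T F) :
    pr μ (fun A => E A ∧ F A) = pr μ E * pr μ F := by
  classical
  lift S to Finset Site using hS
  lift T to Finset Site using hT
  rw [Finset.disjoint_coe] at hST
  have hEF : DepOn ↑(S ∪ T) (fun A => E A ∧ F A) := by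
    rw [Finset.coe_union]
    exact (hE.mono Set.subset_union_left).and (hF.mono Set.subset_union_right)
  rw [(pr_eq_card hμ hE).2, (pr_eq_card hμ hF).2, (pr_eq_card hμ hEF).2,
    Finset.card_union_of_disjoint hST, pow_add, div_mul_div_comm, ← Nat.cast_mul,
    ← Finset.card_product]
  congr 2
  have h1 : ∀ s t : Finset Site, s ⊆ S → t ⊆ T → (s ∪ t) ∩ S = s ∧ (s ∪ t) ∩ T = t := by
    intro s t hs ht
    rw [Finset.disjoint_left] at hST
    constructor <;> ext v <;> simp only [Finset.mem_inter, Finset.mem_union]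
    · exact ⟨fun h => h.1.elim id fun h' => absurd (ht h') (hST h.2), fun h => ⟨Or.inl h, hs h⟩⟩
    · exact ⟨fun h => h.1.elim (fun h' => absurd h.2 (hST (hs h'))) id, fun h => ⟨Or.inr h, ht h⟩⟩
  refine Finset.card_nbij' (fun s => (s ∩ S, s ∩ T)) (fun p => p.1 ∪ p.2) ?_ ?_ ?_ ?_
  · intro s hs
    simp only [Finset.coe_filter, Finset.mem_powerset, Set.mem_ofPred_eq] at hs
    simp only [Finset.coe_product, Set.mem_prod, Finset.coe_filter, Finset.mem_powerset,
      Set.mem_ofPred_eq, Finset.coe_inter]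
    exact ⟨⟨Finset.inter_subset_right, (hE.iff_inter _).1 hs.2.1⟩,
      ⟨Finset.inter_subset_right, (hF.iff_inter _).1 hs.2.2⟩⟩
  · rintro ⟨s, t⟩ hst
    simp only [Finset.coe_product, Set.mem_prod, Finset.coe_filter, Finset.mem_powerset,
      Set.mem_ofPred_eq] at hst
    obtain ⟨⟨h2, h3⟩, h4, h5⟩ := hst
    have h6 := h1 s t h2 h4
    simp only [Finset.coe_filter, Finset.mem_powerset, Set.mem_ofPred_eq]
    refine ⟨Finset.union_subset_union h2 h4, (hE.iff_inter _).2 ?_, (hF.iff_inter _).2 ?_⟩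
    · rw [← Finset.coe_inter, h6.1]; exact h3
    · rw [← Finset.coe_inter, h6.2]; exact h5
  · intro s hs
    simp only [Finset.coe_filter, Finset.mem_powerset, Set.mem_ofPred_eq] at hs
    dsimp only
    rw [← Finset.inter_union_distrib_left, Finset.inter_eq_left.2 hs.1]
  · rintro ⟨s, t⟩ hst
    simp only [Finset.coe_product, Set.mem_prod, Finset.coe_filter, Finset.mem_powerset,
      Set.mem_ofPred_eq] at hst
    obtain ⟨⟨h2, h3⟩, h4, h5⟩ := hst
    have h6 := h1 s t h2 h4
    exact Prod.ext h6.1 h6.2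

theorem pr_harris (hμ : IsBernoulliHalf μ)
    {E F : Set Site → Prop} (hE : LocalEv E) (hF : LocalEv F) (hEm : Monotone E)
    (hFm : Monotone F) : pr μ E * pr μ F ≤ pr μ (fun A => E A ∧ F A) := by
  classical
  obtain ⟨Λ, hE, hF⟩ : ∃ Λ : Finset Site, DepOn ↑Λ E ∧ DepOn ↑Λ F := by
    obtain ⟨S, hS, hE⟩ := hE
    obtain ⟨T, hT, hF⟩ := hF
    refine ⟨(hS.union hT).toFinset, ?_, ?_⟩ <;> rw [Set.Finite.coe_toFinset]
    · exact hE.mono Set.subset_union_left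
    · exact hF.mono Set.subset_union_right
  have key : ∀ G : Set Site → Prop, (Λ.powerset.filter fun s : Finset Site => G ↑s).card =
      (Finset.univ.filter fun s : Finset Λ => G ↑(s.map (Function.Embedding.subtype _))).card := by
    intro G
    symm
    refine Finset.card_nbij' (fun s => s.map (Function.Embedding.subtype _))
      (fun s => s.subtype _) ?_ ?_ ?_ ?_
    · intro s hs
      simp only [Finset.coe_filter, Finset.mem_univ, true_and, Set.mem_ofPred_eq,
        Finset.mem_powerset] at hs ⊢
      refine ⟨?_, hs⟩
      intro v hv
      simp at hv
      exact hv.1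
    · intro s hs
      simp only [Finset.coe_filter, Finset.mem_univ, true_and, Set.mem_ofPred_eq,
        Finset.mem_powerset] at hs ⊢
      rw [Finset.subtype_map, Finset.filter_true_of_mem hs.1]
      exact hs.2
    · intro s hs
      ext v
      simp
    · intro s hs
      simp only [Finset.coe_filter, Set.mem_ofPred_eq, Finset.mem_powerset] at hs ⊢
      rw [Finset.subtype_map, Finset.filter_true_of_mem hs.1]
  have up : ∀ G : Set Site → Prop, Monotone G → IsUpperSet
      ((Finset.univ.filter fun s : Finset Λ => G ↑(s.map (Function.Embedding.subtype _)) :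
        Finset (Finset Λ)) : Set (Finset Λ)) := by
    intro G hG s t hst hs
    simp only [Finset.coe_filter, Finset.mem_univ, true_and, Set.mem_ofPred_eq] at hs ⊢
    exact hG (Finset.coe_subset.2 (Finset.map_subset_map.2 hst)) hs
  have main := (up E hEm).le_card_inter_finset (up F hFm)
  have hcap := key (fun A => E A ∧ F A)
  rw [← Finset.filter_and, ← key, ← key, Fintype.card_coe] at main
  have h3 : pr μ (fun A => E A ∧ F A) =
      ((Finset.univ.filter fun s : Finset Λ => E ↑(s.map (Function.Embedding.subtype _)) ∧
        F ↑(s.map (Function.Embedding.subtype _))).card : ℝ) / 2 ^ Λ.card := by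
    rw [(pr_eq_card hμ (hE.and hF)).2]
    congr 2
    convert hcap
  rw [(pr_eq_card hμ hE).2, (pr_eq_card hμ hF).2, h3]
  rw [div_mul_div_comm, div_le_div_iff₀ (by positivity) (by positivity)]
  have main' := (Nat.cast_le (α := ℝ)).2 main
  rw [Nat.cast_mul, Nat.cast_mul, Nat.cast_pow, Nat.cast_ofNat] at main'
  refine (mul_le_mul_of_nonneg_right main' (by positivity)).trans (le_of_eq ?_)
  rw [mul_comm (2 ^ _), mul_assoc]

theorem pr_equiv (hμ : IsBernoulliHalf μ) {E : Set Site → Prop} (hE : LocalEv E) (e : Site ≃ Site) :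
    pr μ (fun A => E (e ⁻¹' A)) = pr μ E := by
  classical
  obtain ⟨S, hS, hE⟩ := hE
  lift S to Finset Site using hS
  have hE' : DepOn ↑(S.map e.toEmbedding) (fun A => E (e ⁻¹' A)) := by
    refine fun A B h => hE _ _ ?_
    ext v
    have := congrArg (e v ∈ ·) h
    simpa using this
  rw [(pr_eq_card hμ hE).2, (pr_eq_card hμ hE').2, Finset.card_map]
  congr 2
  symm
  refine Finset.card_nbij' (fun s => s.map e.toEmbedding) (fun s => s.map e.symm.toEmbedding)
    ?_ ?_ ?_ ?_
  · intro s hs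
    simp only [Finset.coe_filter, Finset.mem_powerset, Set.mem_ofPred_eq] at hs ⊢
    refine ⟨Finset.map_subset_map.2 hs.1, ?_⟩
    simpa [Set.preimage_image_eq _ e.injective] using hs.2
  · intro s hs
    simp only [Finset.coe_filter, Finset.mem_powerset, Set.mem_ofPred_eq] at hs ⊢
    constructor
    · intro v hv
      simp only [Finset.mem_map_equiv, Equiv.symm_symm] at hv
      have := hs.1 hv
      simpa using this
    · have h := hs.2
      rw [← Equiv.image_symm_eq_preimage] at h
      simpa using h
  · intro s _
    ext v; simp
  · intro s _
    ext v; simp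

theorem pr_compl (hμ : IsBernoulliHalf μ) {E : Set Site → Prop} (hE : LocalEv E) :
    pr μ (fun A => E Aᶜ) = pr μ E := by
  classical
  obtain ⟨S, hS, hE⟩ := hE
  lift S to Finset Site using hS
  have hE' : DepOn ↑S (fun A => E Aᶜ) := by
    refine fun A B h => hE _ _ ?_
    ext v
    have := congrArg (v ∈ ·) h
    simp only [Set.mem_inter_iff, Set.mem_compl_iff, eq_iff_iff] at this ⊢
    tauto
  rw [(pr_eq_card hμ hE).2, (pr_eq_card hμ hE').2]
  congr 2
  have key : ∀ s : Finset Site, (E ((s : Set Site)ᶜ) ↔ E ↑(S \ s)) := by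
    intro s
    refine hE _ _ ?_
    ext v
    simp +contextual
  refine Finset.card_nbij' (fun s => S \ s) (fun s => S \ s) ?_ ?_ ?_ ?_
  · intro s hs
    simp only [Finset.coe_filter, Finset.mem_powerset, Set.mem_ofPred_eq] at hs ⊢
    exact ⟨Finset.sdiff_subset, (key s).1 hs.2⟩
  · intro s hs
    simp only [Finset.coe_filter, Finset.mem_powerset, Set.mem_ofPred_eq] at hs ⊢
    refine ⟨Finset.sdiff_subset, (key _).2 ?_⟩
    rw [Finset.sdiff_sdiff_eq_self hs.1]
    exact hs.2
  · intro s hs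
    simp only [Finset.coe_filter, Finset.mem_powerset, Set.mem_ofPred_eq] at hs
    exact Finset.sdiff_sdiff_eq_self hs.1
  · intro s hs
    simp only [Finset.coe_filter, Finset.mem_powerset, Set.mem_ofPred_eq] at hs
    exact Finset.sdiff_sdiff_eq_self hs.1

end Counting

section Algebra

variable {μ : Measure Config}

theorem pr_nonneg (μ : Measure Config) (E : Set Site → Prop) : 0 ≤ pr μ E := measureReal_nonneg

theorem pr_mono (hμ : IsBernoulliHalf μ)
    {E F : Set Site → Prop} (h : ∀ A, E A → F A) : pr μ E ≤ pr μ F := by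
  have := hμ.1
  exact measureReal_mono fun ω hω => h _ hω

theorem pr_le_one (hμ : IsBernoulliHalf μ) (E : Set Site → Prop) : pr μ E ≤ 1 := by
  have := hμ.1
  exact measureReal_le_one

theorem pr_congr (hμ : IsBernoulliHalf μ)
    {E F : Set Site → Prop} (h : ∀ A, E A ↔ F A) : pr μ E = pr μ F :=
  le_antisymm (pr_mono hμ fun A => (h A).1) (pr_mono hμ fun A => (h A).2)

theorem pr_not (hμ : IsBernoulliHalf μ)
    {E : Set Site → Prop} (hE : LocalEv E) : pr μ (fun A => ¬ E A) = 1 - pr μ E := by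
  have := hμ.1
  have h := probReal_compl_eq_one_sub (μ := μ) (hE.measurableSet hμ)
  exact h

theorem pr_or_le (hμ : IsBernoulliHalf μ)
    (E F : Set Site → Prop) : pr μ (fun A => E A ∨ F A) ≤ pr μ E + pr μ F := by
  have := hμ.1
  exact measureReal_union_le {ω | E (opn ω)} {ω | F (opn ω)}

theorem pr_sum_disjoint (hμ : IsBernoulliHalf μ)
    {ι : Type*} (s : Finset ι) {E : ι → Set Site → Prop}
    (hE : ∀ i ∈ s, LocalEv (E i)) (hd : ∀ i ∈ s, ∀ j ∈ s, i ≠ j → ∀ A, E i A → ¬ E j A) :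
    ∑ i ∈ s, pr μ (E i) = pr μ (fun A => ∃ i ∈ s, E i A) := by
  have := hμ.1
  have h : {ω | ∃ i ∈ s, E i (opn ω)} = ⋃ i ∈ s, {ω | E i (opn ω)} := by
    ext ω; simp
  rw [pr, h, measureReal_biUnion_finset]
  · rfl
  · intro i hi j hj hij
    rw [Function.onFun, Set.disjoint_left]
    exact fun ω h1 h2 => hd i hi j hj hij _ h1 h2
  · exact fun i hi => (hE i hi).measurableSet hμ

/-- Conditioning on a finite-range observable. -/
theorem pr_le_of_cond (hμ : IsBernoulliHalf μ)
    {Λ : Set Site} (hΛ : Λ.Finite) {α : Type*} (κ : Set Site → α)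
    (hκ : ∀ A B, A ∩ Λ = B ∩ Λ → κ A = κ B) {E E' : Set Site → Prop} (hE : LocalEv E)
    (hE' : LocalEv E') (c : ℝ)
    (h : ∀ A₀, E A₀ → c * pr μ (fun A => κ A = κ A₀ ∧ E A) ≤ pr μ (fun A => κ A = κ A₀ ∧ E' A)) :
    c * pr μ E ≤ pr μ E' := by
  classical
  lift Λ to Finset Site using hΛ
  have key : ∀ F : Set Site → Prop, LocalEv F → pr μ F =
      ∑ k ∈ Λ.powerset.image fun s : Finset Site => κ ↑s, pr μ (fun A => κ A = k ∧ F A) := by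
    intro F hF
    rw [pr_sum_disjoint hμ]
    · refine pr_congr hμ fun A => ⟨fun h => ⟨κ A, ?_, rfl, h⟩, fun ⟨_, _, _, h⟩ => h⟩
      rw [Finset.mem_image]
      refine ⟨Λ.filter fun v => v ∈ A, Finset.mem_powerset.2 (Finset.filter_subset _ _), hκ _ _ ?_⟩
      ext v
      simp +contextual
    · intro k _
      exact LocalEv.and ⟨Λ, Λ.finite_toSet, fun A B hAB => by
        simp only [hκ A B hAB]⟩ hF
    · rintro k _ l _ hkl A ⟨h1, -⟩ ⟨h2, -⟩
      exact hkl (h1.symm.trans h2)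
  rw [key E hE, key E' hE', Finset.mul_sum]
  refine Finset.sum_le_sum fun k _ => ?_
  by_cases hk : ∃ A₀, κ A₀ = k ∧ E A₀
  · obtain ⟨A₀, rfl, hA₀⟩ := hk
    exact h A₀ hA₀
  · have : pr μ (fun A => κ A = k ∧ E A) = 0 := by
      have h0 : {ω : Config | κ (opn ω) = k ∧ E (opn ω)} = ∅ := by
        ext ω
        simp only [Set.mem_ofPred_eq, Set.mem_empty_iff_false, iff_false]
        exact fun hh => hk ⟨_, hh⟩
      rw [pr, h0, measureReal_empty]
    rw [this, mul_zero]
    exact pr_nonneg _ _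

theorem pr_harris_anti (hμ : IsBernoulliHalf μ)
    {E F : Set Site → Prop} (hE : LocalEv E) (hF : LocalEv F) (hEm : Antitone E)
    (hFm : Antitone F) : pr μ E * pr μ F ≤ pr μ (fun A => E A ∧ F A) := by
  have h := pr_harris hμ hE.compl hF.compl (fun A B hAB => hEm (Set.compl_subset_compl.2 hAB))
    (fun A B hAB => hFm (Set.compl_subset_compl.2 hAB))
  rwa [pr_compl hμ hE, pr_compl hμ hF, pr_compl hμ (E := fun A => E A ∧ F A) (hE.and hF)] at h

end Algebra

theorem Monotone.and_ev {E F : Set Site → Prop} (hE : Monotone E) (hF : Monotone F) :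
    Monotone (fun A => E A ∧ F A) := fun _ _ h hA => ⟨hE h hA.1, hF h hA.2⟩

theorem Antitone.and_ev {E F : Set Site → Prop} (hE : Antitone E) (hF : Antitone F) :
    Antitone (fun A => E A ∧ F A) := fun _ _ h hA => ⟨hE h hA.1, hF h hA.2⟩

theorem rect_finite (x₀ x₁ y₀ y₁ : ℤ) : (rect x₀ x₁ y₀ y₁).Finite := by
  refine ((Finset.Icc x₀ x₁ ×ˢ Finset.Icc y₀ y₁).finite_toSet).subset ?_
  rintro v ⟨h1, h2, h3, h4⟩
  rw [Finset.coe_product, Finset.coe_Icc, Finset.coe_Icc]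
  exact ⟨⟨h1, h2⟩, ⟨h3, h4⟩⟩

theorem LR.depOn (x₀ x₁ y₀ y₁ : ℤ) : DepOn (rect x₀ x₁ y₀ y₁) (LR x₀ x₁ y₀ y₁) := by
  intro A B h
  rw [Set.inter_comm, Set.inter_comm B] at h
  rw [LR, LR, h]

theorem TB.depOn (x₀ x₁ y₀ y₁ : ℤ) : DepOn (rect x₀ x₁ y₀ y₁) (TB x₀ x₁ y₀ y₁) := by
  intro A B h
  rw [Set.inter_comm, Set.inter_comm B] at h
  rw [TB, TB, h]

theorem LR.local (x₀ x₁ y₀ y₁ : ℤ) : LocalEv (LR x₀ x₁ y₀ y₁) :=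
  (LR.depOn _ _ _ _).local (rect_finite _ _ _ _)

theorem TB.local (x₀ x₁ y₀ y₁ : ℤ) : LocalEv (TB x₀ x₁ y₀ y₁) :=
  (TB.depOn _ _ _ _).local (rect_finite _ _ _ _)

theorem LR.monotone (x₀ x₁ y₀ y₁ : ℤ) : Monotone (LR x₀ x₁ y₀ y₁) := fun _ _ h hA =>
  hA.mono (Set.inter_subset_right.trans h)

theorem TB.monotone (x₀ x₁ y₀ y₁ : ℤ) : Monotone (TB x₀ x₁ y₀ y₁) := fun _ _ h hA =>
  hA.mono (Set.inter_subset_right.trans h)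

/-- Reflection of the lattice in the diagonal. -/
def swapEquiv : Site ≃ Site := Equiv.prodComm ℤ ℤ

theorem Conn.swap {S T : Set Site} {u v : Site} (h : Conn S u v)
    (hST : ∀ a ∈ S, (a.2, a.1) ∈ T) : Conn T (u.2, u.1) (v.2, v.1) := by
  refine h.map (fun a => (a.2, a.1)) (fun a b hab => Or.inl ?_) hST
  rw [adj_iff] at *
  omega

theorem LR.swap {x₀ x₁ y₀ y₁ : ℤ} {A : Set Site} (h : LR x₀ x₁ y₀ y₁ (swapEquiv ⁻¹' A)) :
    TB y₀ y₁ x₀ x₁ A := by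
  obtain ⟨u, v, huv, hu, hv⟩ := h
  refine ⟨_, _, (huv.swap (T := rect y₀ y₁ x₀ x₁ ∩ A) ?_).symm, hv, hu⟩
  rintro a ⟨⟨h1, h2, h3, h4⟩, h5⟩
  exact ⟨⟨h3, h4, h1, h2⟩, h5⟩

theorem TB.swap {x₀ x₁ y₀ y₁ : ℤ} {A : Set Site} (h : TB x₀ x₁ y₀ y₁ (swapEquiv ⁻¹' A)) :
    LR y₀ y₁ x₀ x₁ A := by
  obtain ⟨u, v, huv, hu, hv⟩ := h
  refine ⟨_, _, (huv.swap (T := rect y₀ y₁ x₀ x₁ ∩ A) ?_).symm, hv, hu⟩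
  rintro a ⟨⟨h1, h2, h3, h4⟩, h5⟩
  exact ⟨⟨h3, h4, h1, h2⟩, h5⟩

theorem pr_TB_swap {μ : Measure Config} (hμ : IsBernoulliHalf μ) (x₀ x₁ y₀ y₁ : ℤ) :
    pr μ (TB x₀ x₁ y₀ y₁) = pr μ (LR y₀ y₁ x₀ x₁) := by
  rw [← pr_equiv hμ (LR.local y₀ y₁ x₀ x₁) swapEquiv]
  refine pr_congr hμ fun A => ⟨fun h => ?_, fun h => h.swap⟩
  refine TB.swap ?_
  exact h

theorem pr_LR_translate {μ : Measure Config} (hμ : IsBernoulliHalf μ) (x₀ x₁ y₀ y₁ a b : ℤ) :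
    pr μ (LR (x₀ + a) (x₁ + a) (y₀ + b) (y₁ + b)) = pr μ (LR x₀ x₁ y₀ y₁) := by
  rw [← pr_equiv hμ (LR.local x₀ x₁ y₀ y₁) (Equiv.addRight (a, b))]
  refine pr_congr hμ fun A => ⟨fun h => ?_, fun h => h.translate (a, b) fun a h => h⟩
  have h1 := h.translate (-a, -b) (B := Equiv.addRight (a, b) ⁻¹' A) ?_
  · simpa using h1
  · intro v hv
    have : v + (-a, -b) + (a, b) = v := by ext <;> simp
    simpa only [Set.mem_preimage, Equiv.coe_addRight, this] using hv

/-- The crossing probability of a square is one half. -/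
theorem pr_LR_square {μ : Measure Config} (hμ : IsBernoulliHalf μ) {N : ℤ} (hN : 0 ≤ N) :
    pr μ (LR 0 N 0 N) = 1 / 2 := by
  have h1 : pr μ (fun A => TB 0 N 0 N Aᶜ) = pr μ (LR 0 N 0 N) := by
    rw [pr_compl hμ (TB.local _ _ _ _), pr_TB_swap hμ]
  have h2 : pr μ (fun A => TB 0 N 0 N Aᶜ) = 1 - pr μ (LR 0 N 0 N) := by
    rw [← pr_not hμ (LR.local _ _ _ _)]
    exact pr_congr hμ fun A => ⟨fun h h' => h'.not_TB h, fun h => (LR_or_TB hN hN A).resolve_left h⟩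
  linarith

/-- Sites joined to the seed set `V` through closed sites of the region `Y`. -/
def clus (V Y A : Set Site) : Set Site := {z | ∃ v ∈ V, Conn (V ∪ Y \ A) v z}

/-- A cluster together with its neighbours in the region. -/
def clusBar (Y s : Set Site) : Set Site := s ∪ {v | v ∈ Y ∧ ∃ w ∈ s, Adj w v}

section Cluster

variable {V Y A : Set Site}

theorem subset_clus : V ⊆ clus V Y A := fun v hv => ⟨v, hv, Conn.refl (Or.inl hv)⟩

theorem clus_subset : clus V Y A ⊆ V ∪ Y \ A := fun _ ⟨_, _, h⟩ => h.mem_right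

theorem clus_step {a b : Site} (ha : a ∈ clus V Y A) (hab : Adj a b) (hb : b ∈ V ∪ Y \ A) :
    b ∈ clus V Y A := by
  obtain ⟨v, hv, h⟩ := ha
  exact ⟨v, hv, h.tail hab hb⟩

theorem clus_conn {a b : Site} (ha : a ∈ clus V Y A) (h : Conn (V ∪ Y \ A) a b) :
    b ∈ clus V Y A := by
  obtain ⟨v, hv, h'⟩ := ha
  exact ⟨v, hv, h'.trans h⟩

theorem conn_clus {z : Site} (hz : z ∈ clus V Y A) : ∃ v ∈ V, Conn (clus V Y A) v z := by
  obtain ⟨v, hv, h⟩ := hz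
  exact ⟨v, hv, h.restrict.mono fun x hx => ⟨v, hv, hx⟩⟩

theorem clusBar_subset {s : Set Site} (hs : s ⊆ V ∪ Y) : clusBar Y s ⊆ V ∪ Y := by
  rintro v (h | h)
  · exact hs h
  · exact Or.inr h.1

theorem clus_dep {s : Set Site} : DepOn (clusBar Y s ∩ Y) (fun A => clus V Y A = s) := by
  have key : ∀ A B : Set Site, A ∩ (clusBar Y s ∩ Y) = B ∩ (clusBar Y s ∩ Y) → clus V Y A = s →
      clus V Y B = s := by
    intro A B hAB hA
    have hmem : ∀ v, v ∈ clusBar Y s → v ∈ Y → (v ∈ A ↔ v ∈ B) := by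
      intro v h1 h2
      have := congrArg (v ∈ ·) hAB
      simpa [h1, h2] using this
    apply Set.Subset.antisymm
    · rintro z ⟨v, hv, h⟩
      refine h.mem_of_closed (T := s) (hA ▸ subset_clus hv) ?_
      rintro a b ha hab (hb | hb)
      · exact hA ▸ subset_clus hb
      · rw [← hA] at ha ⊢
        refine clus_step ha hab (Or.inr ⟨hb.1, fun hbA => hb.2 ?_⟩)
        exact (hmem b (Or.inr ⟨hb.1, a, hA ▸ ha, hab⟩) hb.1).1 hbA
    · intro z hz
      rw [← hA] at hz
      obtain ⟨v, hv, h⟩ := conn_clus hz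
      refine ⟨v, hv, h.mono fun x hx => ?_⟩
      rcases clus_subset hx with hx' | hx'
      · exact Or.inl hx'
      · refine Or.inr ⟨hx'.1, fun hxB => hx'.2 ?_⟩
        exact (hmem x (Or.inl (hA ▸ hx)) hx'.1).2 hxB
  exact fun A B h => ⟨key A B h, key B A h.symm⟩

theorem clus_congr {A B : Set Site} (h : A ∩ Y = B ∩ Y) : clus V Y A = clus V Y B := by
  have : Y \ A = Y \ B := by
    ext v
    have := congrArg (v ∈ ·) h
    simp only [Set.mem_inter_iff, eq_iff_iff, Set.mem_sdiff] at this ⊢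
    tauto
  rw [clus, clus, this]

end Cluster

/-- Twice the signed distance to the symmetry axis of the lattice through the origin. -/
def cX (v : Site) : ℤ := 2 * v.1 + v.2

/-- Slanted strip of height `h` between two symmetry axes. -/
def slab (h d : ℤ) : Set Site := {v | 0 ≤ v.2 ∧ v.2 ≤ h ∧ 0 < cX v ∧ cX v < d}

/-- There is a closed vertical crossing of the slanted strip. -/
def Blk (h d : ℤ) (A : Set Site) : Prop := ∃ u g, Conn (slab h d \ A) u g ∧ u.2 = h ∧ g.2 = 0

/-- Reflection in a symmetry axis of the lattice. -/
def reflEquiv (a : ℤ) : Site ≃ Site where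
  toFun v := (a - v.1 - v.2, v.2)
  invFun v := (a - v.1 - v.2, v.2)
  left_inv v := Prod.ext (by dsimp only; ring) rfl
  right_inv v := Prod.ext (by dsimp only; ring) rfl

theorem cX_refl (a : ℤ) (v : Site) : cX (reflEquiv a v) = 2 * a - cX v := by
  simp only [cX, reflEquiv, Equiv.coe_fn_mk]; ring

theorem refl_snd (a : ℤ) (v : Site) : (reflEquiv a v).2 = v.2 := rfl

theorem refl_fst (a : ℤ) (v : Site) : (reflEquiv a v).1 = a - v.1 - v.2 := rfl

theorem refl_refl (a : ℤ) (v : Site) : reflEquiv a (reflEquiv a v) = v :=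
  (reflEquiv a).left_inv v

theorem Adj.reflEquiv {v w : Site} (a : ℤ) (h : Adj v w) :
    Adj (reflEquiv a v) (reflEquiv a w) := by
  rw [adj_iff] at *
  simp only [refl_fst, refl_snd]
  omega

theorem Conn.reflEquiv {S T : Set Site} {u v : Site} (a : ℤ) (h : Conn S u v)
    (hST : ∀ z ∈ S, reflEquiv a z ∈ T) : Conn T (reflEquiv a u) (reflEquiv a v) :=
  h.map (_root_.reflEquiv a) (fun _ _ hab => Or.inl (hab.reflEquiv a)) hST

theorem slab_finite (h d : ℤ) : (slab h d).Finite := by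
  refine (rect_finite (-h) d 0 h).subset ?_
  rintro v ⟨h1, h2, h3, h4⟩
  simp only [cX] at *
  exact ⟨by omega, by omega, h1, h2⟩

theorem diff_eq_of_inter_eq {A B S : Set Site} (h : A ∩ S = B ∩ S) : S \ A = S \ B := by
  ext v
  have := congrArg (v ∈ ·) h
  simp only [Set.mem_inter_iff, eq_iff_iff, Set.mem_sdiff] at this ⊢
  tauto

section RSW

variable {h a : ℤ}

/-- Virtual closed seeds above the left half of the strip. -/
def seedRow (h a : ℤ) : Set Site := {v | v.2 = h + 1 ∧ cX v < a ∧ -(h + 1) ≤ v.1}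

/-- Sites of the strip unaffected by an exploration `S` and its mirror image. -/
def freeSites (h a : ℤ) (S : Set Site) : Set Site :=
  {v | v ∈ slab h (2 * a) ∧ v ∉ S ∧ reflEquiv a v ∉ S}

/-- Closed connection from the mirror image of `S` to the bottom left. -/
def closedLink (h a : ℤ) (S A : Set Site) : Prop :=
  ∃ f g t, Conn (freeSites h a S \ A) f g ∧ t ∈ S ∧ Adj f (reflEquiv a t) ∧ g.2 = 0 ∧ cX g ≤ a

/-- Closed vertical crossing of the double strip ending at the bottom left. -/
def leftBlk (h a : ℤ) (A : Set Site) : Prop :=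
  ∃ u g, Conn (slab h (2 * a) \ A) u g ∧ u.2 = h ∧ g.2 = 0 ∧ cX g ≤ a

theorem cX_step {v w : Site} (hvw : Adj v w) (h1 : cX v < a) (h2 : a ≤ cX w) :
    cX w = a ∨ w = reflEquiv a v := by
  rw [adj_iff] at hvw
  simp only [cX] at *
  by_cases h3 : 2 * w.1 + w.2 = a
  · exact Or.inl h3
  · right
    ext
    · rw [refl_fst]; omega
    · rw [refl_snd]; omega

theorem refl_eq_self {v : Site} (hv : cX v = a) : reflEquiv a v = v := by
  simp only [cX] at hv
  ext
  · rw [refl_fst]; omega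
  · rfl

theorem closedLink_of_leftBlk (hh : 0 ≤ h) {A s : Set Site}
    (hs : clus (seedRow h a) (slab h a) A = s) (hG : ∀ v ∈ s, v.2 ≠ 0) (hb : leftBlk h a A) :
    closedLink h a (clusBar (slab h a) s) A := by
  obtain ⟨u, p, hup, hu, hp, hpa⟩ := hb
  have hpu := hup.symm
  have hsub : s ⊆ seedRow h a ∪ slab h a \ A := hs ▸ clus_subset
  have hstep : ∀ v w, v ∈ s → Adj v w → w ∈ slab h a → w ∉ A → w ∈ s := by
    intro v w h1 h2 h3 h4
    rw [← hs] at h1 ⊢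
    exact clus_step h1 h2 (Or.inr ⟨h3, h4⟩)
  have hSs : ∀ v ∈ clusBar (slab h a) s, v ∉ A → v ∈ s := by
    rintro v (h1 | ⟨h1, w, h2, h3⟩) h4
    · exact h1
    · exact hstep w v h2 h3 h1 h4
  have hSX : ∀ v ∈ clusBar (slab h a) s, v ∈ seedRow h a ∨ v ∈ slab h a := fun v hv =>
    clusBar_subset (V := seedRow h a)
      (hsub.trans (Set.union_subset_union_right _ Set.sdiff_subset)) hv
  have hnear : ∀ v ∈ slab h a, v.2 = h → v ∈ clusBar (slab h a) s := by
    intro v hv hvh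
    refine Or.inr ⟨hv, (v.1 - 1, v.2 + 1), ?_, ?_⟩
    · rw [← hs]
      refine subset_clus ⟨?_, ?_, ?_⟩
      · dsimp only; omega
      · have := hv.2.2.2
        simp only [cX] at *; omega
      · have := hv.2.2.1
        simp only [cX] at *; omega
    · rw [adj_iff]; dsimp only; omega
  have hpF : p ∈ freeSites h a (clusBar (slab h a) s) := by
    refine ⟨hup.mem_right.1, fun h1 => hG p (hSs p h1 hup.mem_right.2) hp, fun h1 => ?_⟩
    rcases hSX _ h1 with h2 | h2
    · have := h2.1
      rw [refl_snd] at this; omega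
    · have := h2.2.2.2
      rw [cX_refl] at this; omega
  have key : ∀ f, Conn (freeSites h a (clusBar (slab h a) s) \ A) p f → cX f = a →
      (∃ t ∈ clusBar (slab h a) s, Adj f t) → closedLink h a (clusBar (slab h a) s) A := by
    rintro f hf hfa ⟨t, ht, hft⟩
    refine ⟨f, p, t, hf.symm, ht, ?_, hp, hpa⟩
    have := hft.reflEquiv a
    rwa [refl_eq_self hfa] at this
  rcases hpu.exit_or hpF with hin | ⟨f, b, hf, hfb, hb, hbF, -⟩
  · have huF := hin.mem_right.2
    have huslab := huF.1
    have hge : a ≤ cX u := by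
      by_contra hlt
      exact huF.2.1 (hnear u ⟨huslab.1, huslab.2.1, huslab.2.2.1, by omega⟩ hu)
    have hle : cX u ≤ a := by
      by_contra hlt
      refine huF.2.2 (hnear _ ⟨huslab.1, huslab.2.1, ?_, ?_⟩ hu) <;> rw [cX_refl]
      · have := huslab.2.2.2
        omega
      · omega
    refine key u (hin.mono fun z hz => ⟨hz.2, hz.1.2⟩) (le_antisymm hle hge)
      ⟨(u.1 - 1, u.2 + 1), Or.inl ?_, ?_⟩
    · rw [← hs]
      refine subset_clus ⟨?_, ?_, ?_⟩
      · dsimp only; omega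
      · simp only [cX] at *; omega
      · have := huslab.2.2.1
        simp only [cX] at *; omega
    · rw [adj_iff]; dsimp only; omega
  · have hf' : Conn (freeSites h a (clusBar (slab h a) s) \ A) p f :=
      hf.mono fun z hz => ⟨hz.2, hz.1.2⟩
    have hfF := hf'.mem_right.1
    by_cases hbσ : reflEquiv a b ∈ clusBar (slab h a) s
    · refine ⟨f, p, _, hf'.symm, hbσ, ?_, hp, hpa⟩
      rwa [refl_refl]
    · have hbS : b ∈ clusBar (slab h a) s := by
        by_contra hbS
        exact hbF ⟨hb.1, hbS, hbσ⟩
      have hbs := hSs b hbS hb.2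
      have hbX : cX b < a := by
        rcases hSX b hbS with h1 | h1
        · exact h1.2.1
        · exact h1.2.2.2
      have hfX : a ≤ cX f := by
        by_contra hlt
        exact hfF.2.1 (Or.inr ⟨⟨hfF.1.1, hfF.1.2.1, hfF.1.2.2.1, by omega⟩, b, hbs, hfb.symm⟩)
      rcases cX_step hfb.symm hbX hfX with h1 | h1
      · exact key f hf' h1 ⟨b, hbS, hfb⟩
      · exfalso
        apply hfF.2.2
        rw [h1, refl_refl]
        exact hbS

/-- The closed link and the mirrored open link exclude each other. -/
theorem closedLink_disjoint (hh : 0 ≤ h) {A₀ A s : Set Site}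
    (hs : clus (seedRow h a) (slab h a) A₀ = s) (hc : closedLink h a (clusBar (slab h a) s) A) :
    ¬ closedLink h a (clusBar (slab h a) s) (reflEquiv a ⁻¹' A)ᶜ := by
  rintro ⟨f', g', t', hfg', ht', hft', hg', hga'⟩
  obtain ⟨f, g, t, hfg, ht, hft, hg, hga⟩ := hc
  set S := clusBar (slab h a) s with hS
  have hsub : s ⊆ seedRow h a ∪ slab h a :=
    hs ▸ clus_subset.trans (Set.union_subset_union_right _ Set.sdiff_subset)
  have hSsub : S ⊆ seedRow h a ∪ slab h a := clusBar_subset hsub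
  have hSrange : ∀ v ∈ S, 0 ≤ v.2 ∧ v.2 ≤ h + 1 ∧ cX v < a ∧ -(h + 1) ≤ v.1 := by
    intro v hv
    rcases hSsub hv with ⟨h1, h2, h3⟩ | ⟨h1, h2, h3, h4⟩
    · exact ⟨by omega, by omega, h2, h3⟩
    · simp only [cX] at *
      exact ⟨by omega, by omega, h4, by omega⟩
  have hroot : ∀ t ∈ S, ∃ v ∈ seedRow h a, Conn S v t := by
    rintro t (h1 | ⟨h1, w, h2, h3⟩)
    · obtain ⟨v, hv, h4⟩ := conn_clus (hs ▸ h1)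
      exact ⟨v, hv, h4.mono (by rw [hs]; exact Set.subset_union_left)⟩
    · obtain ⟨v, hv, h4⟩ := conn_clus (hs ▸ h2)
      exact ⟨v, hv, (h4.mono (by rw [hs]; exact Set.subset_union_left)).tail h3
        (Or.inr ⟨h1, w, h2, h3⟩)⟩
  have hfree : ∀ v ∈ freeSites h a S, reflEquiv a v ∈ freeSites h a S := by
    rintro v ⟨⟨h1, h2, h3, h4⟩, h5, h6⟩
    refine ⟨⟨h1, h2, ?_, ?_⟩, h6, ?_⟩
    · rw [cX_refl]; omega
    · rw [cX_refl]; omega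
    · rwa [refl_refl]
  -- the open path
  obtain ⟨v', hv', hvt'⟩ := hroot t' ht'
  obtain ⟨v, hv, hvt⟩ := hroot t ht
  have hopen : Conn (freeSites h a S ∩ A) (reflEquiv a f') (reflEquiv a g') := by
    refine hfg'.reflEquiv a ?_
    rintro z ⟨h1, h2⟩
    exact ⟨hfree z h1, by simpa using h2⟩
  have hadj' : Adj t' (reflEquiv a f') := by
    have := (hft'.reflEquiv a).symm
    rwa [refl_refl] at this
  set O : Set Site := S ∪ (freeSites h a S ∩ A) ∪ {v | v.2 = -1 ∧ a < cX v} with hO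
  set K : Set Site := {v | reflEquiv a v ∈ S} ∪ (freeSites h a S \ A) ∪ {v | v.2 = -1 ∧ cX v < a}
    with hK
  have hfr : ∀ v ∈ freeSites h a S, v ∈ rect (-(h + 1)) (a + h + 1) (-1) (h + 1) := by
    rintro v ⟨⟨h1, h2, h3, h4⟩, -, -⟩
    simp only [cX] at *
    exact ⟨by omega, by omega, by omega, by omega⟩
  have ha0 : 0 < a := by
    have := hfg.1.1.1.2.2
    omega
  have hSr : ∀ v ∈ S, v ∈ rect (-(h + 1)) (a + h + 1) (-1) (h + 1) := by
    intro v hv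
    have := hSrange v hv
    simp only [cX] at *
    exact ⟨by omega, by omega, by omega, by omega⟩
  have hSr' : ∀ v, reflEquiv a v ∈ S → v ∈ rect (-(h + 1)) (a + h + 1) (-1) (h + 1) := by
    intro v hv
    have := hSrange _ hv
    rw [cX_refl, refl_fst, refl_snd] at this
    simp only [cX] at *
    exact ⟨by omega, by omega, by omega, by omega⟩
  set R := rect (-(h + 1)) (a + h + 1) (-1) (h + 1) with hR
  have c1 : Conn (R ∩ O) (-(h + 1), h + 1) v' := by
    have e : v' = (v'.1, h + 1) := Prod.ext rfl hv'.1
    rw [e]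
    refine conn_row hv'.2.2 fun x h1 h2 => ?_
    have h3 : ((x, h + 1) : Site) ∈ S := by
      refine Or.inl (hs ▸ subset_clus ⟨rfl, ?_, h1⟩)
      have := hv'.2.1
      have := hv'.1
      simp only [cX] at *
      omega
    exact ⟨hSr _ h3, Or.inl (Or.inl h3)⟩
  have c2 : Conn (R ∩ O) v' t' := hvt'.mono fun z hz => ⟨hSr z hz, Or.inl (Or.inl hz)⟩
  have c3 : Conn (R ∩ O) (reflEquiv a f') (reflEquiv a g') :=
    hopen.mono fun z hz => ⟨hfr z hz.1, Or.inl (Or.inr hz)⟩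
  have c4 : Conn (R ∩ O) (-(h + 1), h + 1) (reflEquiv a g') :=
    ((c1.trans c2).tail hadj' c3.mem_left).trans c3
  have hgX := cX_refl a g'
  have hgr := hfr _ hopen.mem_right.1
  rw [hR, mem_rect] at hgr
  have hslab := hopen.mem_right.1.1
  obtain ⟨hs1, hs2, hs3, hs4⟩ := hslab
  have hg2 : (reflEquiv a g').2 = 0 := hg'
  set q := reflEquiv a g' with hq
  have hrow : ∀ x, q.1 + 1 ≤ x → x ≤ a + h + 1 → ((x, -1) : Site) ∈ R ∩ O := by
    intro x h1 h2
    refine ⟨⟨?_, ?_, ?_, ?_⟩, Or.inr ⟨rfl, ?_⟩⟩ <;> simp only [cX] at * <;> omega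
  have hq1 : q.1 + 1 ≤ a + h + 1 := by
    simp only [cX] at *; omega
  have c5 : Conn (R ∩ O) (-(h + 1), h + 1) (a + h + 1, -1) :=
    (c4.tail (by rw [adj_iff]; dsimp only; omega) (hrow (q.1 + 1) le_rfl hq1)).trans
      (conn_row hq1 hrow)
  have d1 : Conn (R ∩ K) (reflEquiv a v) (reflEquiv a t) := by
    refine hvt.reflEquiv a fun z hz => ?_
    have : reflEquiv a (reflEquiv a z) ∈ S := by rwa [refl_refl]
    exact ⟨hSr' _ this, Or.inl (Or.inl this)⟩
  have d2 : Conn (R ∩ K) f g := hfg.mono fun z hz => ⟨hfr z hz.1, Or.inl (Or.inr hz)⟩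
  have hgr2 := hfr _ hfg.mem_right.1
  rw [hR, mem_rect] at hgr2
  have d3 : Conn (R ∩ K) (reflEquiv a v) (g.1, -1) := by
    refine ((d1.tail hft.symm d2.mem_left).trans d2).tail ?_ ⟨⟨?_, ?_, ?_, ?_⟩, Or.inr ⟨rfl, ?_⟩⟩
    · rw [adj_iff]; dsimp only; omega
    all_goals simp only [cX] at *; omega
  obtain ⟨z, hz1, hz2⟩ := c5.meet rfl rfl d3 hv.1 rfl
  have hz1 := hz1.mem_right.2
  have hz2 := hz2.mem_right.2
  have hXS : ∀ v ∈ S, reflEquiv a v ∉ S := by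
    intro v h1 h2
    have h3 := (hSrange v h1).2.2.1
    have h4 := (hSrange _ h2).2.2.1
    rw [cX_refl] at h4
    omega
  rcases hz1 with (hz1 | hz1) | hz1 <;> rcases hz2 with (hz2 | hz2) | hz2
  · exact hXS z hz1 hz2
  · exact hz2.1.2.1 hz1
  · have := (hSrange z hz1).1
    have := hz2.1
    omega
  · exact hz1.1.2.2 hz2
  · exact hz2.2 hz1.2
  · have := hz1.1.1.1
    have := hz2.1
    omega
  · have := (hSrange _ hz2).1
    rw [refl_snd] at this
    have := hz1.1
    omega
  · have := hz2.1.1.1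
    have := hz1.1
    omega
  · have := hz2.2
    have := hz1.2
    omega

end RSW

theorem leftBlk.local (h a : ℤ) : LocalEv (leftBlk h a) :=
  DepOn.local (fun A B hAB => by rw [leftBlk, leftBlk, diff_eq_of_inter_eq hAB])
    (slab_finite h (2 * a))

theorem not_leftBlk_monotone (h a : ℤ) : Monotone (fun A => ¬ leftBlk h a A) := by
  rintro A B hAB hA ⟨u, g, hug, h'⟩
  exact hA ⟨u, g, hug.mono (Set.sdiff_subset_sdiff_right hAB), h'⟩

theorem closedLink.depOn (h a : ℤ) (S : Set Site) :
    DepOn (freeSites h a S) (closedLink h a S) := fun A B hAB => by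
  rw [closedLink, closedLink, diff_eq_of_inter_eq hAB]

theorem freeSites_finite (h a : ℤ) (S : Set Site) : (freeSites h a S).Finite :=
  (slab_finite h (2 * a)).subset fun _ hv => hv.1

theorem not_Blk_of_LR {h : ℤ} {A : Set Site} (hA : LR (-(h / 2)) (-(h / 2) + h) 0 h A) :
    ¬ Blk h h A := by
  rintro ⟨u, g, hug, hu, hg⟩
  refine hA.not_TB ⟨u, g, hug.mono ?_, hu, hg⟩
  rintro v ⟨⟨h1, h2, h3, h4⟩, h5⟩
  simp only [cX] at *
  exact ⟨⟨by omega, by omega, h1, h2⟩, h5⟩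

theorem clus_avoid_of_not_Blk {h a : ℤ} {A : Set Site} (hh : 0 ≤ h) (hA : ¬ Blk h a A) :
    ∀ v ∈ clus (seedRow h a) (slab h a) A, v.2 ≠ 0 := by
  rintro v ⟨u, hu, huv⟩ hv
  have h1 := hu.1
  obtain ⟨p, q, hpq, hp, hq, -⟩ := huv.strip stepOne_neg_snd (c := -h) (d := 0)
    (by omega) (by omega) (by omega)
  refine hA ⟨p, q, hpq.mono ?_, by omega, by omega⟩
  rintro z ⟨hz | hz, hz', hz''⟩
  · have := hz.1
    omega
  · exact hz

theorem not_Blk_double {h a : ℤ} {A : Set Site} (h1 : ¬ leftBlk h a A)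
    (h2 : ¬ leftBlk h a (reflEquiv a ⁻¹' A)) : ¬ Blk h (2 * a) A := by
  rintro ⟨u, g, hug, hu, hg⟩
  by_cases hga : cX g ≤ a
  · exact h1 ⟨u, g, hug, hu, hg, hga⟩
  · refine h2 ⟨reflEquiv a u, reflEquiv a g, hug.reflEquiv a ?_, hu, hg, ?_⟩
    · rintro z ⟨⟨h3, h4, h5, h6⟩, h7⟩
      refine ⟨⟨h3, h4, ?_, ?_⟩, ?_⟩
      · rw [cX_refl]; omega
      · rw [cX_refl]; omega
      · rwa [Set.mem_preimage, refl_refl]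
    · rw [cX_refl]; omega

section RSWProb

variable {μ : Measure Config}

theorem pr_closedLink_le (hμ : IsBernoulliHalf μ) {h a : ℤ} (hh : 0 ≤ h) {A₀ : Set Site} :
    pr μ (closedLink h a (clusBar (slab h a) (clus (seedRow h a) (slab h a) A₀))) ≤ 1 / 2 := by
  set S := clusBar (slab h a) (clus (seedRow h a) (slab h a) A₀) with hS
  have hloc : LocalEv (closedLink h a S) := (closedLink.depOn h a S).local (freeSites_finite h a S)
  have h1 : pr μ (fun A => closedLink h a S (reflEquiv a ⁻¹' A)ᶜ) = pr μ (closedLink h a S) :=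
    (pr_equiv hμ hloc.compl (reflEquiv a)).trans (pr_compl hμ hloc)
  have h2 : pr μ (fun A => closedLink h a S (reflEquiv a ⁻¹' A)ᶜ) ≤
      pr μ (fun A => ¬ closedLink h a S A) :=
    pr_mono hμ fun A h3 h4 => closedLink_disjoint hh rfl h4 h3
  rw [pr_not hμ hloc] at h2
  linarith

theorem pr_not_leftBlk (hμ : IsBernoulliHalf μ) {h a : ℤ} (hh : 0 ≤ h) :
    1 / 2 * pr μ (fun A => ¬ Blk h a A) ≤ pr μ (fun A => ¬ leftBlk h a A) := by
  set V := seedRow h a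
  set Y := slab h a
  have hY : Y.Finite := slab_finite h a
  have hκ : ∀ A B, A ∩ Y = B ∩ Y → clus V Y A = clus V Y B := fun A B => clus_congr
  have hG : LocalEv (fun A => ∀ v ∈ clus V Y A, v.2 ≠ 0) :=
    DepOn.local (S := Y) (fun A B hAB => by simp only [hκ A B hAB]) hY
  have hE' : LocalEv (fun A => ¬ leftBlk h a A) := (leftBlk.local h a).not
  have h1 : pr μ (fun A => ¬ Blk h a A) ≤ pr μ (fun A => ∀ v ∈ clus V Y A, v.2 ≠ 0) :=
    pr_mono hμ fun A hA => clus_avoid_of_not_Blk hh hA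
  refine (mul_le_mul_of_nonneg_left h1 (by norm_num)).trans ?_
  refine pr_le_of_cond hμ hY (clus V Y) hκ hG hE' _ fun A₀ hA₀ => ?_
  set S := clusBar Y (clus V Y A₀) with hS
  have hind := pr_indep hμ (S := S ∩ Y) (T := freeSites h a S) (hY.subset Set.inter_subset_right)
    (freeSites_finite h a S) (Set.disjoint_left.2 fun v hv hv' => hv'.2.1 hv.1)
    (clus_dep (V := V) (Y := Y) (s := clus V Y A₀)) (closedLink.depOn h a S).not
  have h2 : pr μ (fun A => clus V Y A = clus V Y A₀ ∧ ¬ closedLink h a S A) ≤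
      pr μ (fun A => clus V Y A = clus V Y A₀ ∧ ¬ leftBlk h a A) := by
    refine pr_mono hμ fun A hA => ⟨hA.1, fun hl => hA.2 ?_⟩
    exact closedLink_of_leftBlk hh hA.1 hA₀ hl
  have h3 : 1 / 2 ≤ pr μ (fun A => ¬ closedLink h a S A) := by
    rw [pr_not hμ ((closedLink.depOn h a S).local (freeSites_finite h a S))]
    have := pr_closedLink_le hμ (a := a) hh (A₀ := A₀)
    linarith
  have h4 : pr μ (fun A => clus V Y A = clus V Y A₀ ∧ ∀ v ∈ clus V Y A, v.2 ≠ 0) ≤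
      pr μ (fun A => clus V Y A = clus V Y A₀) := pr_mono hμ fun A hA => hA.1
  have h5 := pr_nonneg μ (fun A => clus V Y A = clus V Y A₀)
  nlinarith

theorem pr_not_Blk_double (hμ : IsBernoulliHalf μ) {h a : ℤ} (hh : 0 ≤ h) :
    pr μ (fun A => ¬ Blk h a A) ^ 2 / 4 ≤ pr μ (fun A => ¬ Blk h (2 * a) A) := by
  have hl : LocalEv (fun A => ¬ leftBlk h a A) := (leftBlk.local h a).not
  have h1 := pr_not_leftBlk hμ (a := a) hh
  have h2 := pr_harris hμ hl (hl.equiv (reflEquiv a)) (not_leftBlk_monotone h a)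
    (fun A B hAB => not_leftBlk_monotone h a (Set.preimage_mono hAB))
  rw [pr_equiv hμ hl] at h2
  have h3 : pr μ (fun A => ¬ leftBlk h a A ∧ ¬ leftBlk h a (reflEquiv a ⁻¹' A)) ≤
      pr μ (fun A => ¬ Blk h (2 * a) A) := pr_mono hμ fun A hA => not_Blk_double hA.1 hA.2
  have h4 := pr_nonneg μ (fun A => ¬ Blk h a A)
  nlinarith

end RSWProb

theorem exists_pr_not_Blk (k : ℕ) : ∃ c : ℝ, 0 < c ∧ ∀ μ : Measure Config, IsBernoulliHalf μ →
    ∀ h : ℤ, 0 ≤ h → c ≤ pr μ (fun A => ¬ Blk h (2 ^ k * h) A) := by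
  induction k with
  | zero =>
    refine ⟨1 / 2, by norm_num, fun μ hμ h hh => ?_⟩
    have h1 := pr_LR_translate hμ 0 h 0 h (-(h / 2)) 0
    rw [pr_LR_square hμ hh] at h1
    rw [← h1, pow_zero, one_mul]
    refine pr_mono hμ fun A hA => not_Blk_of_LR ?_
    convert hA using 1 <;> ring
  | succ k ih =>
    obtain ⟨c, hc, ih⟩ := ih
    refine ⟨c ^ 2 / 4, by positivity, fun μ hμ h hh => ?_⟩
    have h1 := pr_not_Blk_double hμ (a := 2 ^ k * h) hh
    have h2 := ih μ hμ h hh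
    rw [show (2 : ℤ) ^ (k + 1) * h = 2 * (2 ^ k * h) by ring]
    refine le_trans ?_ h1
    gcongr

/-- **Russo–Seymour–Welsh**: long rectangles are crossed with probability bounded below. -/
theorem rsw (K : ℕ) : ∃ c : ℝ, 0 < c ∧ ∀ μ : Measure Config, IsBernoulliHalf μ →
    ∀ x₀ x₁ y₀ y₁ : ℤ, x₀ ≤ x₁ → y₀ < y₁ → x₁ - x₀ ≤ K * (y₁ - y₀) →
      c ≤ pr μ (LR x₀ x₁ y₀ y₁) := by
  obtain ⟨k, hk⟩ := pow_unbounded_of_one_lt (2 * (K : ℤ) + 4) (one_lt_two)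
  obtain ⟨c, hc, H⟩ := exists_pr_not_Blk k
  refine ⟨c, hc, fun μ hμ x₀ x₁ y₀ y₁ hx hy hK => ?_⟩
  have h1 := H μ hμ (y₁ - y₀) (by omega)
  have h2 := pr_LR_translate hμ 1 (1 + (x₁ - x₀)) 0 (y₁ - y₀) (x₀ - 1) y₀
  have h3 : pr μ (LR x₀ x₁ y₀ y₁) = pr μ (LR 1 (1 + (x₁ - x₀)) 0 (y₁ - y₀)) := by
    rw [← h2]
    congr 2 <;> ring
  rw [h3]
  refine h1.trans (pr_mono hμ fun A hA => ?_)
  refine (LR_or_TB (by omega) (by omega) A).resolve_right ?_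
  rintro ⟨u, g, hug, hu, hg⟩
  refine hA ⟨u, g, hug.mono ?_, hu, hg⟩
  rintro z ⟨⟨h4, h5, h6, h7⟩, h8⟩
  refine ⟨⟨h6, h7, ?_, ?_⟩, h8⟩
  · simp only [cX]; omega
  · have : (2 * (K : ℤ) + 4) * (y₁ - y₀) ≤ 2 ^ k * (y₁ - y₀) :=
      mul_le_mul_of_nonneg_right hk.le (by omega)
    simp only [cX]
    linarith

/-- Crossings forming an inverted `U` around the point `(c, β)`, truncated to the columns between
`a₁` and `a₂`. -/
def Cap (a₁ a₂ β c r : ℤ) (K : Set Site) : Prop :=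
  LR (max (c - 2 * r) a₁) (min (c + 2 * r) a₂) (β + 2 * r) (β + 4 * r) K ∧
  (c + 2 * r ≤ a₂ → TB (c + r) (c + 2 * r) β (β + 4 * r) K) ∧
  (a₁ ≤ c - 2 * r → TB (c - 2 * r) (c - r) β (β + 4 * r) K)

section Cap

variable {a₁ a₂ β c r : ℤ} {K S : Set Site}

theorem Cap.mono {L : Set Site} (h : Cap a₁ a₂ β c r K)
    (hKL : ∀ v ∈ K, v ∈ rect (max (c - 2 * r) a₁) (min (c + 2 * r) a₂) β (β + 4 * r) → v ∈ L)
    (h₁ : a₁ ≤ c) (h₂ : c ≤ a₂) : Cap a₁ a₂ β c r L := by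
  refine ⟨h.1.mono ?_, fun h3 => (h.2.1 h3).mono ?_, fun h3 => (h.2.2 h3).mono ?_⟩
  all_goals
    rintro v ⟨⟨h4, h5, h6, h7⟩, h8⟩
    exact hKL v h8 ⟨by omega, by omega, by omega, by omega⟩

theorem Cap.monotone (h₁ : a₁ ≤ c) (h₂ : c ≤ a₂) : Monotone (Cap a₁ a₂ β c r) :=
  fun _ _ hAB hA => hA.mono (fun _ hv _ => hAB hv) h₁ h₂

theorem Cap.depOn (h₁ : a₁ ≤ c) (h₂ : c ≤ a₂) :
    DepOn (rect (max (c - 2 * r) a₁) (min (c + 2 * r) a₂) β (β + 4 * r)) (Cap a₁ a₂ β c r) := by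
  have key : ∀ A B : Set Site,
      A ∩ rect (max (c - 2 * r) a₁) (min (c + 2 * r) a₂) β (β + 4 * r) =
        B ∩ rect (max (c - 2 * r) a₁) (min (c + 2 * r) a₂) β (β + 4 * r) →
      Cap a₁ a₂ β c r A → Cap a₁ a₂ β c r B := fun A B h hA =>
    hA.mono (fun v hv hv' => (h.subset ⟨hv, hv'⟩ :).1) h₁ h₂
  exact fun A B h => ⟨key A B h, key B A h.symm⟩

theorem Cap.to_bottom (hr : 0 ≤ r) (h₁ : a₁ ≤ c) (h₂ : c ≤ a₂)
    (hleg : c + 2 * r ≤ a₂ ∨ a₁ ≤ c - 2 * r) (hK : Cap a₁ a₂ β c r K) {u v : Site}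
    (huv : Conn (rect (max (c - 2 * r) a₁) (min (c + 2 * r) a₂) (β + 2 * r) (β + 4 * r) ∩ K) u v)
    (hu : u.1 = max (c - 2 * r) a₁) (hv : v.1 = min (c + 2 * r) a₂) :
    ∃ e, Conn (rect (max (c - 2 * r) a₁) (min (c + 2 * r) a₂) β (β + 4 * r) ∩ K) u e ∧
      e.2 = β := by
  have hO : rect (max (c - 2 * r) a₁) (min (c + 2 * r) a₂) (β + 2 * r) (β + 4 * r) ∩ K ⊆
      rect (max (c - 2 * r) a₁) (min (c + 2 * r) a₂) β (β + 4 * r) ∩ K := by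
    rintro z ⟨⟨h4, h5, h6, h7⟩, h8⟩
    exact ⟨⟨h4, h5, by omega, h7⟩, h8⟩
  rcases hleg with hl | hl
  · obtain ⟨p, q, hpq, hp, hq⟩ := hK.2.1 hl
    obtain ⟨s, t, hst, hs, ht, hus⟩ := huv.strip stepOne_fst (c := c + r)
      (d := c + 2 * r) (by omega)
      (by omega) (by omega)
    obtain ⟨s', t', hst', hs', ht', hps⟩ := hpq.strip stepOne_neg_snd (c := -(β + 4 * r))
      (d := -(β + 2 * r)) (by omega) (by omega) (by omega)
    have e1 : Conn (rect (c + r) (c + 2 * r) (β + 2 * r) (β + 4 * r) ∩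
        (rect (max (c - 2 * r) a₁) (min (c + 2 * r) a₂) (β + 2 * r) (β + 4 * r) ∩ K)) s t := by
      refine hst.mono ?_
      rintro z ⟨h3, h4, h5⟩
      exact ⟨⟨h4, h5, h3.1.2.2.1, h3.1.2.2.2⟩, h3⟩
    have e2 : Conn (rect (c + r) (c + 2 * r) (β + 2 * r) (β + 4 * r) ∩
        (rect (c + r) (c + 2 * r) β (β + 4 * r) ∩ K)) s' t' := by
      refine hst'.mono ?_
      rintro z ⟨h3, h4, h5⟩
      exact ⟨⟨h3.1.1, h3.1.2.1, by omega, by omega⟩, h3⟩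
    obtain ⟨z, hz1, hz2⟩ := e1.meet hs ht e2 (by omega) (by omega)
    have f1 := (hus.mono hO).trans ((hz1.mono Set.inter_subset_right).mono hO)
    have f2 := ((hz2.mono Set.inter_subset_right).symm.trans hps.symm).trans hpq
    refine ⟨q, f1.trans (f2.mono ?_), hq⟩
    rintro z ⟨⟨h4, h5, h6, h7⟩, h8⟩
    exact ⟨⟨by omega, by omega, by omega, by omega⟩, h8⟩
  · obtain ⟨p, q, hpq, hp, hq⟩ := hK.2.2 hl
    obtain ⟨s, t, hst, hs, ht, hus⟩ := huv.symm.strip stepOne_neg_fst (c := -(c - r))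
      (d := -(c - 2 * r)) (by omega) (by omega) (by omega)
    obtain ⟨s', t', hst', hs', ht', hps⟩ := hpq.strip stepOne_neg_snd (c := -(β + 4 * r))
      (d := -(β + 2 * r)) (by omega) (by omega) (by omega)
    have e1 : Conn (rect (c - 2 * r) (c - r) (β + 2 * r) (β + 4 * r) ∩
        (rect (max (c - 2 * r) a₁) (min (c + 2 * r) a₂) (β + 2 * r) (β + 4 * r) ∩ K)) s t := by
      refine hst.mono ?_
      rintro z ⟨h3, h4, h5⟩
      exact ⟨⟨by omega, by omega, h3.1.2.2.1, h3.1.2.2.2⟩, h3⟩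
    have e2 : Conn (rect (c - 2 * r) (c - r) (β + 2 * r) (β + 4 * r) ∩
        (rect (c - 2 * r) (c - r) β (β + 4 * r) ∩ K)) s' t' := by
      refine hst'.mono ?_
      rintro z ⟨h3, h4, h5⟩
      exact ⟨⟨h3.1.1, h3.1.2.1, by omega, by omega⟩, h3⟩
    obtain ⟨z, hz1, hz2⟩ := e1.symm.meet (by omega) (by omega) e2 (by omega) (by omega)
    have f0 : Conn (rect (max (c - 2 * r) a₁) (min (c + 2 * r) a₂) (β + 2 * r)
        (β + 4 * r) ∩ K) u z :=
      huv.trans (hus.trans ((hst.mono Set.inter_subset_left).trans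
        (hz1.mono Set.inter_subset_right)))
    have f1 := f0.mono hO
    have f2 := ((hz2.mono Set.inter_subset_right).symm.trans hps.symm).trans hpq
    refine ⟨q, f1.trans (f2.mono ?_), hq⟩
    rintro z ⟨⟨h4, h5, h6, h7⟩, h8⟩
    exact ⟨⟨by omega, by omega, by omega, by omega⟩, h8⟩

/-- A path from far away to the point below a cap meets a piece of the cap attached to the base. -/
theorem Cap.meet (hr : 0 ≤ r) (h₁ : a₁ ≤ c) (h₂ : c ≤ a₂)
    (hleg : c + 2 * r ≤ a₂ ∨ a₁ ≤ c - 2 * r) (hK : Cap a₁ a₂ β c r K) {p w : Site}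
    (hpw : Conn S p w) (hS : ∀ v ∈ S, a₁ ≤ v.1 ∧ v.1 ≤ a₂ ∧ β ≤ v.2) (hw₁ : c - r ≤ w.1)
    (hw₂ : w.1 ≤ c + r) (hw₃ : w.2 ≤ β + 2 * r)
    (hp : p.1 ≤ c - 2 * r ∨ c + 2 * r ≤ p.1 ∨ β + 4 * r ≤ p.2) :
    ∃ z e, Conn S p z ∧
      Conn (rect (max (c - 2 * r) a₁) (min (c + 2 * r) a₂) β (β + 4 * r) ∩ K) z e ∧ e.2 = β := by
  set O := rect (max (c - 2 * r) a₁) (min (c + 2 * r) a₂) β (β + 4 * r) with hO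
  obtain ⟨b, hwb, hb⟩ : ∃ b, Conn (S ∩ O) w b ∧
      (b.1 ≤ c - 2 * r ∨ c + 2 * r ≤ b.1 ∨ β + 4 * r ≤ b.2) := by
    by_cases hwT : w.1 ≤ c - 2 * r ∨ c + 2 * r ≤ w.1 ∨ β + 4 * r ≤ w.2
    · have := hS w hpw.mem_right
      exact ⟨w, Conn.refl ⟨hpw.mem_right, by omega, by omega, by omega, by omega⟩, hwT⟩
    · obtain ⟨a, b, h3, h4, h5, h6, -⟩ := hpw.symm.exit
        (T := {v | ¬ (v.1 ≤ c - 2 * r ∨ c + 2 * r ≤ v.1 ∨ β + 4 * r ≤ v.2)}) hwT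
        (fun h => h hp)
      rw [Set.mem_ofPred_eq, not_not] at h6
      have h7 : Conn (S ∩ O) w a := h3.mono fun z hz => by
        have h8 := hS z hz.1
        have h9 := hz.2
        rw [Set.mem_ofPred_eq] at h9
        exact ⟨hz.1, by omega, by omega, by omega, by omega⟩
      have h8 := hS b h5
      have h9 := h3.mem_right.2
      rw [Set.mem_ofPred_eq] at h9
      rw [adj_iff] at h4
      exact ⟨b, h7.tail (adj_iff.2 h4) ⟨h5, by omega, by omega, by omega, by omega⟩, h6⟩
  have hSO : S ∩ O ⊆ S := Set.inter_subset_left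
  have hbO := hwb.mem_right.2
  rw [hO, mem_rect] at hbO
  rcases hb with hb | hb | hb
  · obtain ⟨s, t, hst, hs, ht, hws⟩ := hwb.strip stepOne_neg_fst (c := -(c - r))
      (d := -(c - 2 * r)) (by omega) (by omega) (by omega)
    have e1 : Conn (rect (c - 2 * r) (c - r) β (β + 4 * r) ∩ S) s t := by
      refine hst.mono ?_
      rintro z ⟨⟨h3, h4⟩, h5, h6⟩
      exact ⟨⟨by omega, by omega, h4.2.2.1, h4.2.2.2⟩, h3⟩
    obtain ⟨p', q, hpq, hp', hq⟩ := hK.2.2 (by omega)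
    obtain ⟨z, hz1, hz2⟩ := e1.symm.meet (by omega) (by omega) hpq hp' hq
    refine ⟨z, q, (hpw.trans ((hws.trans (hst.mono Set.inter_subset_left)).mono hSO)).trans
      (hz1.mono Set.inter_subset_right), (hz2.symm.trans hpq).mono ?_, hq⟩
    rintro z ⟨⟨h4, h5, h6, h7⟩, h8⟩
    exact ⟨⟨by omega, by omega, by omega, by omega⟩, h8⟩
  · obtain ⟨s, t, hst, hs, ht, hws⟩ := hwb.strip stepOne_fst (c := c + r)
      (d := c + 2 * r) (by omega) (by omega) (by omega)
    have e1 : Conn (rect (c + r) (c + 2 * r) β (β + 4 * r) ∩ S) s t := by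
      refine hst.mono ?_
      rintro z ⟨⟨h3, h4⟩, h5, h6⟩
      exact ⟨⟨by omega, by omega, h4.2.2.1, h4.2.2.2⟩, h3⟩
    obtain ⟨p', q, hpq, hp', hq⟩ := hK.2.1 (by omega)
    obtain ⟨z, hz1, hz2⟩ := e1.meet (by omega) (by omega) hpq hp' hq
    refine ⟨z, q, (hpw.trans (hws.mono hSO)).trans
      (hz1.mono Set.inter_subset_right), (hz2.symm.trans hpq).mono ?_, hq⟩
    rintro z ⟨⟨h4, h5, h6, h7⟩, h8⟩
    exact ⟨⟨by omega, by omega, by omega, by omega⟩, h8⟩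
  · obtain ⟨s, t, hst, hs, ht, hws⟩ := hwb.strip stepOne_snd (c := β + 2 * r)
      (d := β + 4 * r) (by omega) (by omega) (by omega)
    have e1 : Conn (rect (max (c - 2 * r) a₁) (min (c + 2 * r) a₂) (β + 2 * r) (β + 4 * r) ∩ S)
        s t := by
      refine hst.mono ?_
      rintro z ⟨⟨h3, h4⟩, h5, h6⟩
      exact ⟨⟨h4.1, h4.2.1, by omega, by omega⟩, h3⟩
    obtain ⟨u, v, huv, hu, hv⟩ := hK.1
    obtain ⟨z, hz1, hz2⟩ := huv.meet hu hv e1.symm (by omega) (by omega)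
    obtain ⟨e, hue, he⟩ := hK.to_bottom hr h₁ h₂ hleg huv hu hv
    refine ⟨z, e, (hpw.trans ((hws.trans (hst.mono Set.inter_subset_left)).mono hSO)).trans
      (hz2.mono Set.inter_subset_right), (hz1.symm.mono ?_).trans hue, he⟩
    rintro z ⟨⟨h4, h5, h6, h7⟩, h8⟩
    exact ⟨⟨by omega, by omega, by omega, by omega⟩, h8⟩

end Cap

theorem pr_Cap : ∃ δ : ℝ, 0 < δ ∧ ∀ μ : Measure Config, IsBernoulliHalf μ →
    ∀ a₁ a₂ β c r : ℤ, 1 ≤ r → a₁ ≤ c → c ≤ a₂ → δ ≤ pr μ (Cap a₁ a₂ β c r) := by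
  obtain ⟨δ, hδ, H⟩ := rsw 4
  refine ⟨δ * (δ * δ), by positivity, fun μ hμ a₁ a₂ β c r hr h₁ h₂ => ?_⟩
  have t1 := H μ hμ (max (c - 2 * r) a₁) (min (c + 2 * r) a₂) (β + 2 * r) (β + 4 * r) (by omega)
    (by omega) (by push_cast; omega)
  have hδ1 : δ ≤ 1 := t1.trans (pr_le_one hμ _)
  have leg : ∀ (P : Prop) (x : ℤ), δ ≤ pr μ (fun A => P → TB x (x + r) β (β + 4 * r) A) := by
    intro P x
    refine (H μ hμ β (β + 4 * r) x (x + r) (by omega) (by omega) (by push_cast; omega)).trans ?_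
    rw [← pr_TB_swap hμ]
    exact pr_mono hμ fun A hA _ => hA
  have hloc : ∀ (P : Prop) (x : ℤ), LocalEv (fun A => P → TB x (x + r) β (β + 4 * r) A) :=
    fun P x => DepOn.local (fun A B hAB => by rw [TB.depOn _ _ _ _ A B hAB]) (rect_finite _ _ _ _)
  have hmon : ∀ (P : Prop) (x : ℤ), Monotone (fun A => P → TB x (x + r) β (β + 4 * r) A) :=
    fun P x A B hAB hA hP => TB.monotone _ _ _ _ hAB (hA hP)
  have h3 := pr_harris hμ (hloc (c + 2 * r ≤ a₂) (c + r)) (hloc (a₁ ≤ c - 2 * r) (c - 2 * r))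
    (hmon _ _) (hmon _ _)
  have h4 := pr_harris hμ
    (LR.local (max (c - 2 * r) a₁) (min (c + 2 * r) a₂) (β + 2 * r) (β + 4 * r))
    ((hloc (c + 2 * r ≤ a₂) (c + r)).and (hloc (a₁ ≤ c - 2 * r) (c - 2 * r))) (LR.monotone _ _ _ _)
    (Monotone.and_ev (hmon _ _) (hmon _ _))
  have e1 : c + r + r = c + 2 * r := by ring
  have e2 : c - 2 * r + r = c - r := by ring
  have h5 := (mul_le_mul (leg (c + 2 * r ≤ a₂) (c + r)) (leg (a₁ ≤ c - 2 * r) (c - 2 * r)) hδ.le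
    (pr_nonneg _ _)).trans h3
  have h6 := (mul_le_mul t1 h5 (by positivity) (pr_nonneg _ _)).trans h4
  rw [e1, e2] at h6
  exact h6

/-- The row of virtual seeds above a rectangle. -/
def topSeed (x₀ x₁ t : ℤ) : Set Site := {v | v.2 = t + 1 ∧ x₀ ≤ v.1 ∧ v.1 ≤ x₁}

/-- The closed cluster of the top side of a rectangle, together with the virtual seeds. -/
def topClus (x₀ x₁ b t : ℤ) (A : Set Site) : Set Site :=
  clus (topSeed x₀ x₁ t) (rect x₀ x₁ b t) A

section TopClus

variable {x₀ x₁ b t y : ℤ} {A : Set Site} {u v : Site}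

theorem topClus_mem (hv : v ∈ topClus x₀ x₁ b t A) (ht : v.2 ≤ t) :
    v ∈ rect x₀ x₁ b t ∧ v ∉ A := by
  rcases clus_subset hv with h | h
  · have := h.1
    omega
  · exact h

theorem topClus_le (hv : v ∈ topClus x₀ x₁ b t A) : x₀ ≤ v.1 ∧ v.1 ≤ x₁ ∧ v.2 ≤ t + 1 := by
  rcases clus_subset hv with h | h
  · exact ⟨h.2.1, h.2.2, h.1.le⟩
  · have := h.1.2.2.2
    exact ⟨h.1.1, h.1.2.1, by omega⟩

theorem mem_topClus_of_top (hu : u ∈ rect x₀ x₁ b t) (huA : u ∉ A) (hut : u.2 = t) :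
    u ∈ topClus x₀ x₁ b t A := by
  refine clus_step (a := (u.1, u.2 + 1)) (subset_clus ⟨by dsimp only; omega, hu.1, hu.2.1⟩) ?_
    (Or.inr ⟨hu, huA⟩)
  rw [adj_iff]; dsimp only; omega

theorem mem_topClus_of_conn (h : Conn (rect x₀ x₁ b t \ A) u v) (hu : u.2 = t) :
    v ∈ topClus x₀ x₁ b t A :=
  clus_conn (mem_topClus_of_top h.mem_left.1 h.mem_left.2 hu) (h.mono Set.subset_union_right)

/-- Inside the top cluster every site is joined to the top side. -/
theorem topClus_conn (hv : v ∈ topClus x₀ x₁ b t A) (ht : v.2 ≤ t) :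
    ∃ u, Conn (topClus x₀ x₁ b t A ∩ {z | z.2 ≤ t}) v u ∧ u.2 = t := by
  obtain ⟨w, hw, hwv⟩ := conn_clus hv
  have := hw.1
  obtain ⟨u, h1, h2, -⟩ := hwv.symm.first_hit stepOne_snd (c := t) ht (by omega)
  exact ⟨u, h1, h2⟩

theorem topClus_above (hA : LR x₀ x₁ y t A) (hv : v ∈ topClus x₀ x₁ b t A) :
    y < v.2 := by
  by_contra hvy
  have hyt : y ≤ t := by
    obtain ⟨p, q, hpq, -⟩ := hA
    have := hpq.mem_left.1
    exact this.2.2.1.trans this.2.2.2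
  obtain ⟨w, hw, hwv⟩ := conn_clus hv
  have := hw.1
  obtain ⟨p, q, hpq, hp, hq, -⟩ := hwv.strip stepOne_neg_snd (c := -t) (d := -y)
    (by omega) (by omega)
    (by omega)
  refine hA.not_TB ⟨p, q, hpq.mono ?_, by omega, by omega⟩
  rintro z ⟨h1, h2, h3⟩
  have := topClus_mem h1 (by omega)
  exact ⟨⟨this.1.1, this.1.2.1, by omega, by omega⟩, this.2⟩

end TopClus

theorem Pivotal.of_conn {n : ℤ} (hn : 0 ≤ n) {ω : Config} {b f e w : Site}
    (hC : ∀ v ∈ topClus (-n) n (-n) n (opn ω), -n < v.2)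
    (hw : w ∈ topClus (-n) n (-n) n (opn ω)) (hwn : w.2 ≤ n) (hb : b ∈ rect (-n) n (-n) n)
    (hbw : Adj b w) (hbf : Adj b f)
    (hfe : Conn ((rect (-n) n (-n) n \ opn ω) \ topClus (-n) n (-n) n (opn ω)) f e)
    (he : e.2 = -n) : Pivotal n ω b := by
  set R := rect (-n) n (-n) n with hR
  set C := topClus (-n) n (-n) n (opn ω) with hCdef
  set A := opn ω with hA
  have hclosed : ∀ v, v ∉ A → ω v = false := fun v hv => by
    rw [hA, opn, Set.mem_ofPred_eq, Bool.not_eq_true] at hv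
    exact hv
  obtain ⟨t, hwt, ht⟩ := topClus_conn hw hwn
  constructor
  · have hLR : LR (-n) n (-n) n A := by
      refine (LR_or_TB (by omega) (by omega) A).resolve_right ?_
      rintro ⟨p, q, hpq, hp, hq⟩
      have := hC q (mem_topClus_of_conn hpq hp)
      omega
    obtain ⟨u, v, huv, hu, hv⟩ := hLR
    obtain ⟨p, hp, hpu, hpv⟩ := huv.exists_list
    refine ⟨p, ⟨⟨hp.1, fun z hz => (hp.2 z hz).1⟩, fun z hz => (hp.2 z hz).2,
      ⟨u, ⟨huv.mem_left.1, hu⟩, hpu⟩, ⟨v, ⟨huv.mem_right.1, hv⟩, hpv⟩⟩, ?_⟩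
    have hp' : PathIn (R ∩ (A ∩ {z | z ∈ p})) p :=
      ⟨hp.1, fun z hz => ⟨(hp.2 z hz).1, (hp.2 z hz).2, hz⟩⟩
    have huv' := Conn.of_list hp' hpu (List.mem_of_getLast? hpv)
    have h1 : Conn (R ∩ (Aᶜ ∪ {b})) t b := by
      refine (hwt.mono ?_).symm.tail hbw.symm ⟨hb, Or.inr rfl⟩
      rintro z ⟨hz1, hz2⟩
      have := topClus_mem hz1 hz2
      exact ⟨this.1, Or.inl this.2⟩
    have h2 : Conn (R ∩ (Aᶜ ∪ {b})) f e := hfe.mono fun z hz => ⟨hz.1.1, Or.inl hz.1.2⟩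
    obtain ⟨z, hz1, hz2⟩ := huv'.meet hu hv ((h1.tail hbf h2.mem_left).trans h2) ht he
    have hz := hz1.mem_right.2
    rcases hz2.mem_right.2 with h3 | h3
    · exact absurd hz.1 h3
    · rw [Set.mem_singleton_iff] at h3
      exact h3 ▸ hz.2
  · obtain ⟨q₁, h1, h2, h3⟩ := hwt.exists_list
    obtain ⟨q₂, h4, h5, h6⟩ := hfe.exists_list
    have hmem : ∀ v ∈ q₁, v ∈ R ∧ v ∉ A := fun v hv => topClus_mem (h1.2 v hv).1 (h1.2 v hv).2
    refine ⟨q₁, q₂, ⟨h1.1, fun v hv => (hmem v hv).1⟩, fun v hv => hclosed v (hmem v hv).2,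
      ⟨w, hbw, h2⟩, ⟨t, ⟨(hmem t (List.mem_of_getLast? h3)).1, ht⟩, h3⟩,
      ⟨h4.1, fun v hv => (h4.2 v hv).1.1⟩, fun v hv => hclosed v (h4.2 v hv).1.2,
      ⟨f, hbf, h5⟩, ⟨e, ⟨hfe.mem_right.1.1, he⟩, h6⟩, ?_⟩
    exact fun v hv hv' => (h4.2 v hv').2 (h1.2 v hv).1

theorem LR_preimage {x₀ x₁ y₀ y₁ a b : ℤ} {A : Set Site} :
    LR x₀ x₁ y₀ y₁ (Equiv.addRight ((a, b) : Site) ⁻¹' A) ↔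
      LR (x₀ + a) (x₁ + a) (y₀ + b) (y₁ + b) A := by
  refine ⟨fun h => h.translate (a, b) fun a h => h, fun h => ?_⟩
  have h1 := h.translate (-a, -b) (B := Equiv.addRight (a, b) ⁻¹' A) ?_
  · simpa using h1
  · intro v hv
    have : v + (-a, -b) + (a, b) = v := by ext <;> simp
    simpa only [Set.mem_preimage, Equiv.coe_addRight, this] using hv

/-- The lowest open crossing of the box passes at distance less than `M` from the bottom. -/
def LowCrossing (n M : ℤ) (A : Set Site) : Prop :=
  LR (-n) n (-n + 1) n A ∧ ¬ LR (-n) n (-n + 1 + M) n A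

theorem LowCrossing.depOn {n M : ℤ} (hM : 0 ≤ M) :
    DepOn (rect (-n) n (-n) n) (LowCrossing n M) := by
  refine DepOn.and ((LR.depOn _ _ _ _).mono ?_) ((LR.depOn _ _ _ _).mono ?_).not
  all_goals
    rintro v ⟨h1, h2, h3, h4⟩
    exact ⟨h1, h2, by omega, h4⟩

theorem LR.mono_rect {x₀ x₁ y₀ y₁ y₀' y₁' : ℤ} {A : Set Site} (h : LR x₀ x₁ y₀ y₁ A)
    (h0 : y₀' ≤ y₀) (h1 : y₁ ≤ y₁') : LR x₀ x₁ y₀' y₁' A := by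
  obtain ⟨u, v, huv, hu, hv⟩ := h
  refine ⟨u, v, huv.mono ?_, hu, hv⟩
  rintro z ⟨⟨h2, h3, h4, h5⟩, h6⟩
  exact ⟨⟨h2, h3, by omega, by omega⟩, h6⟩

theorem pr_exists_lt_le {μ : Measure Config} (hμ : IsBernoulliHalf μ) (E : ℕ → Set Site → Prop)
    {q : ℝ} (N : ℕ) (hE : ∀ i < N, pr μ (E i) ≤ q) : pr μ (fun A => ∃ i < N, E i A) ≤ N * q := by
  induction N with
  | zero => simp [pr]
  | succ N ih =>
    have h1 := pr_or_le hμ (fun A => ∃ i < N, E i A) (E N)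
    have h2 : pr μ (fun A => ∃ i < N + 1, E i A) ≤ pr μ (fun A => (∃ i < N, E i A) ∨ E N A) := by
      refine pr_mono hμ ?_
      rintro A ⟨i, hi, hA⟩
      rcases Nat.lt_succ_iff_lt_or_eq.1 hi with h | rfl
      · exact Or.inl ⟨i, h, hA⟩
      · exact Or.inr hA
    have h3 := ih fun i hi => hE i (by omega)
    have h4 := hE N (by omega)
    push_cast
    linarith

theorem pr_lowCrossing : ∃ δ : ℝ, 0 < δ ∧ ∀ μ : Measure Config, IsBernoulliHalf μ →
    ∀ n M : ℕ, 1 ≤ M → M ≤ n → δ * M / n ≤ pr μ (LowCrossing n M) := by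
  obtain ⟨δ, hδ, H⟩ := rsw 3
  refine ⟨δ * δ / 3, by positivity, fun μ hμ n M hM hMn => ?_⟩
  set I := 2 * n / M + 1 with hI
  have hI1 : 2 * n ≤ I * M := by
    have := Nat.div_add_mod (2 * n) M
    have := Nat.mod_lt (2 * n) hM
    rw [hI]
    nlinarith
  have hI2 : I * M ≤ 3 * n := by
    have := Nat.div_mul_le_self (2 * n) M
    rw [hI]
    nlinarith
  have p1 : δ ≤ pr μ (LR (-n) n 0 (2 * n - 1)) :=
    H μ hμ _ _ _ _ (by omega) (by omega) (by push_cast; omega)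
  have p2 : δ ≤ pr μ (fun A => ¬ LR (-n) n (I * M) (I * M + (2 * n - 1)) A) := by
    refine (H μ hμ (I * M) (I * M + (2 * n - 1)) (-n) n (by omega) (by omega)
      (by push_cast; omega)).trans ?_
    rw [← pr_TB_swap hμ, ← pr_compl hμ (TB.local _ _ _ _)]
    exact pr_mono hμ fun A h1 h2 => h2.not_TB h1
  have hdis : Disjoint (rect (-n) n 0 (2 * n - 1)) (rect (-n) n (I * M) (I * M + (2 * n - 1))) := by
    refine Set.disjoint_left.2 ?_
    rintro v ⟨-, -, -, h1⟩ ⟨-, -, h2, -⟩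
    have : (2 * n : ℤ) ≤ I * M := by exact_mod_cast hI1
    omega
  have hind := pr_indep hμ (rect_finite _ _ _ _) (rect_finite _ _ _ _) hdis
    (LR.depOn (-n) n 0 (2 * n - 1)) (LR.depOn (-n) n (I * M) (I * M + (2 * n - 1))).not
  have hstep : ∀ i < I, pr μ (fun A => LowCrossing n M
      (Equiv.addRight ((0, n - 1 + i * M) : Site) ⁻¹' A)) ≤ pr μ (LowCrossing n M) := fun i _ =>
    (pr_equiv hμ ((LowCrossing.depOn (by omega)).local (rect_finite _ _ _ _)) _).le
  have hU := pr_exists_lt_le hμ (fun i A => LowCrossing n M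
      (Equiv.addRight ((0, n - 1 + i * M) : Site) ⁻¹' A)) I hstep
  have hsub : pr μ (fun A => LR (-n) n 0 (2 * n - 1) A ∧
      ¬ LR (-n) n (I * M) (I * M + (2 * n - 1)) A) ≤
      pr μ (fun A => ∃ i < I,
        LowCrossing n M (Equiv.addRight ((0, n - 1 + i * M) : Site) ⁻¹' A)) := by
    refine pr_mono hμ ?_
    rintro A ⟨h1, h2⟩
    by_contra! hcon
    have key : ∀ i ≤ I, LR (-n) n (i * M) (i * M + (2 * n - 1)) A := by
      intro i
      induction i with
      | zero => intro _; simpa using h1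
      | succ i ih =>
        intro hi
        have h3 := ih (by omega)
        have h4 := hcon i (by omega)
        rw [LowCrossing, LR_preimage, LR_preimage, not_and_not_right] at h4
        have h5 := h4 (by convert h3 using 1 <;> ring)
        have h6 := h5.mono_rect (y₀' := ((i + 1 : ℕ) : ℤ) * M)
          (y₁' := ((i + 1 : ℕ) : ℤ) * M + (2 * n - 1)) (by push_cast; linarith)
          (by push_cast; linarith)
        simpa using h6
    exact h2 (key I le_rfl)
  have h7 : δ * δ ≤ I * pr μ (LowCrossing n M) :=
    calc δ * δ ≤ _ := mul_le_mul p1 p2 hδ.le (pr_nonneg _ _)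
      _ = _ := hind.symm
      _ ≤ _ := hsub.trans hU
  have hn : (0 : ℝ) < n := by exact_mod_cast (by omega : 0 < n)
  have hM' : (0 : ℝ) < M := by exact_mod_cast hM
  rw [div_le_iff₀ hn]
  have h8 : (I * M : ℝ) ≤ 3 * n := by exact_mod_cast hI2
  have h9 := pr_nonneg μ (LowCrossing n M)
  have h10 : δ * δ * M ≤ I * M * pr μ (LowCrossing n M) := by nlinarith
  have h11 : I * M * pr μ (LowCrossing n M) ≤ 3 * n * pr μ (LowCrossing n M) :=
    mul_le_mul_of_nonneg_right h8 h9
  linarith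

open Classical in
/-- The configuration with a given set of open sites. -/
noncomputable def cfg (A : Set Site) : Config := fun v => decide (v ∈ A)

theorem opn_cfg (A : Set Site) : opn (cfg A) = A := by
  ext v
  simp [opn, cfg]

theorem cfg_opn (ω : Config) : cfg (opn ω) = ω := by
  funext v
  by_cases h : ω v = true <;> simp [opn, cfg, h]

theorem Pivotal.congr {n : ℤ} {ω ω' : Config} {v : Site}
    (h : ∀ z ∈ rect (-n) n (-n) n, ω z = ω' z) (hv : Pivotal n ω v) : Pivotal n ω' v := by
  obtain ⟨⟨p, ⟨h1, h2, h3⟩, h4⟩, q₁, q₂, h5, h6, h7, h8, h9, h10, h11⟩ := hv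
  exact ⟨⟨p, ⟨h1, fun z hz => (h z (h1.2 z hz)).symm.trans (h2 z hz), h3⟩, h4⟩, q₁, q₂, h5,
    fun z hz => (h z (h5.2 z hz)).symm.trans (h6 z hz), h7, h8, h9,
    fun z hz => (h z (h9.2 z hz)).symm.trans (h10 z hz), h11⟩

theorem cfg_eq_of_inter {A B S : Set Site} (h : A ∩ S = B ∩ S) {v : Site} (hv : v ∈ S) :
    cfg A v = cfg B v := by
  have := congrArg (v ∈ ·) h
  simp only [Set.mem_inter_iff, hv, and_true, eq_iff_iff] at this
  simp [cfg, this]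

/-- A property of sites is met by some pivotal site. -/
def HasPivotal (n : ℤ) (H : Set Site) (A : Set Site) : Prop := ∃ v ∈ H, Pivotal n (cfg A) v

theorem HasPivotal.depOn (n : ℤ) (H : Set Site) :
    DepOn (rect (-n) n (-n) n) (HasPivotal n H) := fun _ _ h =>
  ⟨fun ⟨v, h1, h2⟩ => ⟨v, h1, h2.congr fun _ hz => cfg_eq_of_inter h hz⟩,
    fun ⟨v, h1, h2⟩ => ⟨v, h1, h2.congr fun _ hz => cfg_eq_of_inter h.symm hz⟩⟩

/-- The low part of the box covered by the blocks. -/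
def lowStrip (n m : ℤ) : Set Site := {v | -n < v.1 ∧ v.1 ≤ n ∧ -n ≤ v.2 ∧ v.2 ≤ -n + m}

section Lower

variable {μ : Measure Config}

theorem pr_hasPivotal_of (hμ : IsBernoulliHalf μ)
    {n m M : ℤ} (hM : 1 ≤ M) (hMn : M + 1 ≤ 2 * n) {δ : ℝ} (hδ : 0 ≤ δ)
    (H : ∀ A₀, (∀ v ∈ topClus (-n) n (-n) n A₀, -n + 1 < v.2) →
      ∀ c ∈ topClus (-n) n (-n) n A₀, c.2 ≤ -n + 1 + M →
      ∃ T F, T.Finite ∧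
        Disjoint (clusBar (rect (-n) n (-n) n) (topClus (-n) n (-n) n A₀) ∩ rect (-n) n (-n) n) T ∧
        DepOn T F ∧ δ ≤ pr μ F ∧ ∀ A, topClus (-n) n (-n) n A = topClus (-n) n (-n) n A₀ → F A →
          HasPivotal n (lowStrip n m) A) :
    δ * pr μ (LowCrossing n M) ≤ pr μ (HasPivotal n (lowStrip n m)) := by
  have hY := rect_finite (-n) n (-n) n
  refine pr_le_of_cond hμ hY (topClus (-n) n (-n) n) (fun A B => clus_congr)
    ((LowCrossing.depOn (by omega)).local hY) ((HasPivotal.depOn _ _).local hY) δ fun A₀ hA₀ => ?_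
  obtain ⟨c, hc, hcM⟩ : ∃ c ∈ topClus (-n) n (-n) n A₀, c.2 ≤ -n + 1 + M := by
    obtain ⟨p, q, hpq, hp, hq⟩ := (LR_or_TB (by omega) (by omega) A₀).resolve_left hA₀.2
    refine ⟨q, mem_topClus_of_conn (hpq.mono ?_) hp, hq.le⟩
    rintro z ⟨⟨h1, h2, h3, h4⟩, h5⟩
    exact ⟨⟨h1, h2, by omega, h4⟩, h5⟩
  obtain ⟨T, F, hT, hdis, hF, hδF, hFA⟩ := H A₀ (fun v hv => topClus_above hA₀.1 hv) c hc hcM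
  have hind := pr_indep hμ (hY.subset Set.inter_subset_right) hT hdis
    (clus_dep (V := topSeed (-n) n n) (Y := rect (-n) n (-n) n) (s := topClus (-n) n (-n) n A₀)) hF
  calc _ ≤ pr μ (fun A => topClus (-n) n (-n) n A = topClus (-n) n (-n) n A₀) * pr μ F := by
        rw [mul_comm]
        exact mul_le_mul (pr_mono hμ fun A hA => hA.1) hδF hδ (pr_nonneg _ _)
    _ = _ := hind.symm
    _ ≤ _ := pr_mono hμ fun A hA => ⟨hA.1, hFA A hA.1 hA.2⟩

theorem pr_closed_site (hμ : IsBernoulliHalf μ) (v : Site) : pr μ (fun A => v ∉ A) = 1 / 2 := by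
  have h : LocalEv (fun A : Set Site => v ∈ A) :=
    ⟨{v}, Set.finite_singleton v, fun A B hAB => by
      have := congrArg (v ∈ ·) hAB
      simpa using this⟩
  have h1 := pr_not hμ h
  have h2 := pr_compl hμ h
  simp only [Set.mem_compl_iff] at h2
  linarith

theorem pr_hasPivotal_small (hμ : IsBernoulliHalf μ) {n m : ℤ} (hn : 1 ≤ n) (hm : 1 ≤ m) :
    1 / 2 * pr μ (LowCrossing n 1) ≤ pr μ (HasPivotal n (lowStrip n m)) := by
  refine pr_hasPivotal_of hμ le_rfl (by omega) (by norm_num) fun A₀ hlow c hc hc1 => ?_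
  have hc2 := hlow c hc
  have hcl := topClus_le hc
  obtain ⟨x, hx, hxn, hxc⟩ : ∃ x, -n < x ∧ x ≤ n ∧ (x = c.1 ∨ x = c.1 + 1) := by
    by_cases h : c.1 = -n
    · exact ⟨c.1 + 1, by omega, by omega, Or.inr rfl⟩
    · exact ⟨c.1, by omega, by omega, Or.inl rfl⟩
  have hnot : ∀ y ≤ -n + 1, ∀ x, ((x, y) : Site) ∉ topClus (-n) n (-n) n A₀ := fun y hy x h => by
    have := hlow _ h
    dsimp only at this
    omega
  refine ⟨{(x, -n)}, fun A => (x, -n) ∉ A, Set.finite_singleton _, ?_, ?_,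
    (pr_closed_site hμ _).ge, fun A hA hF => ⟨(x, -n + 1), ⟨hx, hxn, by dsimp only; omega,
      by dsimp only; omega⟩, ?_⟩⟩
  · rw [Set.disjoint_singleton_right]
    rintro ⟨h | ⟨-, w, hw, hadj⟩, -⟩
    · exact hnot _ (by omega) _ h
    · have := hlow w hw
      rw [adj_iff] at hadj
      dsimp only at hadj
      omega
  · intro A B hAB
    have := congrArg (((x, -n) : Site) ∈ ·) hAB
    simpa [not_iff_not] using this
  · refine Pivotal.of_conn (f := (x, -n)) (e := (x, -n)) (w := c) (by omega) ?_ ?_ (by omega)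
      ⟨by dsimp only; omega, by dsimp only; omega, by dsimp only; omega, by dsimp only; omega⟩
      ?_ ?_ (Conn.refl ⟨⟨⟨by dsimp only; omega, by dsimp only; omega, by dsimp only; omega,
        by dsimp only; omega⟩, ?_⟩, ?_⟩) rfl
    all_goals try rw [opn_cfg]
    · intro v hv
      rw [hA] at hv
      have := hlow v hv
      omega
    · rwa [hA]
    · rw [adj_iff]; dsimp only; omega
    · rw [adj_iff]; dsimp only; omega
    · exact hF
    · rw [hA]
      exact hnot _ (by omega) _

theorem pr_hasPivotal_large (hμ : IsBernoulliHalf μ)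
    {n m r : ℤ} {δ : ℝ} (hδ : 0 ≤ δ) (hr : 1 ≤ r) (hrm : 8 * r ≤ m)
    (hmn : m ≤ n)
    (H : ∀ c, -n + 1 ≤ c → c ≤ n → δ ≤ pr μ (Cap (-n + 1) n (-n) c r)) :
    δ * pr μ (LowCrossing n r) ≤ pr μ (HasPivotal n (lowStrip n m)) := by
  refine pr_hasPivotal_of hμ hr (by omega) hδ fun A₀ hlow w hw hw1 => ?_
  set R := rect (-n) n (-n) n with hR
  set s := topClus (-n) n (-n) n A₀ with hs
  set sb := clusBar R s with hsb
  have hwl := topClus_le hw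
  set c := max w.1 (-n + 1) with hc
  have hc1 : -n + 1 ≤ c := le_max_right _ _
  have hc2 : c ≤ n := by omega
  set O := rect (max (c - 2 * r) (-n + 1)) (min (c + 2 * r) n) (-n) (-n + 4 * r) with hO
  have hOR : ∀ v ∈ O, v ∈ R ∧ -n < v.1 ∧ v.2 ≤ -n + 4 * r := by
    rintro v ⟨h1, h2, h3, h4⟩
    exact ⟨⟨by omega, by omega, by omega, by omega⟩, by omega, h4⟩
  have hsblow : ∀ v ∈ sb, -n < v.2 := by
    rintro v (h | ⟨-, u, hu, huv⟩)
    · have := hlow v h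
      omega
    · have := hlow u hu
      rw [adj_iff] at huv
      omega
  have hCdep := Cap.depOn (a₁ := -n + 1) (a₂ := n) (β := -n) (c := c) (r := r) hc1 hc2
  refine ⟨O \ sb, fun A => Cap (-n + 1) n (-n) c r (A \ sb)ᶜ,
    (rect_finite _ _ _ _).subset Set.sdiff_subset, ?_, ?_, ?_, fun A hA hcap => ?_⟩
  · exact Set.disjoint_left.2 fun v hv hv' => hv'.2 hv.1
  · intro A B hAB
    refine hCdep _ _ ?_
    ext v
    have := congrArg (v ∈ ·) hAB
    simp only [Set.mem_inter_iff, Set.mem_sdiff, Set.mem_compl_iff, eq_iff_iff] at this ⊢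
    tauto
  · refine (H c hc1 hc2).trans ?_
    rw [← pr_compl hμ (hCdep.local (rect_finite _ _ _ _))]
    exact pr_mono hμ fun A => Cap.monotone hc1 hc2 (Set.compl_subset_compl.2 Set.sdiff_subset)
  · obtain ⟨v₀, hv₀, hv₀w⟩ := conn_clus hw
    have hsub : s ⊆ topSeed (-n) n n ∪ R \ A₀ := clus_subset
    have hpath : Conn (sb ∩ {v | -n + 1 ≤ v.1 ∧ v.1 ≤ n ∧ -n ≤ v.2}) (max v₀.1 (-n + 1), v₀.2)
        (c, w.2) := by
      refine hv₀w.map (fun v => (max v.1 (-n + 1), v.2)) ?_ ?_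
      · intro a b hab
        simp only [adj_iff, Prod.ext_iff] at hab ⊢
        omega
      · intro a ha
        have h1 := hlow a ha
        have h2 := topClus_le ha
        refine ⟨?_, by dsimp only; omega, by dsimp only; omega, by dsimp only; omega⟩
        by_cases ha1 : -n + 1 ≤ a.1
        · rw [max_eq_left ha1]
          exact Or.inl ha
        · rw [max_eq_right (by omega)]
          rcases hsub ha with h3 | h3
          · exact Or.inl (subset_clus ⟨h3.1, by dsimp only; omega, by dsimp only; omega⟩)
          · have := h3.1.2.2.2
            refine Or.inr ⟨⟨by dsimp only; omega, by dsimp only; omega, by dsimp only; omega, this⟩,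
              a, ha, ?_⟩
            rw [adj_iff]; dsimp only; omega
    have hv₀n := hv₀.1
    obtain ⟨z, e, hpz, hze, he⟩ := hcap.meet (by omega) hc1 hc2 (by omega) hpath
      (fun v hv => hv.2) (by dsimp only; omega) (by dsimp only; omega) (by dsimp only; omega)
      (by dsimp only; omega)
    have hesb : e ∉ sb := fun h => by
      have := hsblow e h
      omega
    obtain ⟨f, b, hef, hfb, hbO, hbsb, -⟩ := hze.symm.exit (T := sbᶜ) hesb
      (fun h => h hpz.mem_right.1)
    rw [Set.notMem_compl_iff] at hbsb
    have hf := hef.mem_right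
    have hbR := hOR b hbO.1
    have hfsb : f ∉ sb := hf.2
    have hfR := hOR f hf.1.1
    obtain ⟨w', hw', hadj⟩ : ∃ w' ∈ s, Adj w' b := by
      rcases hbsb with h | ⟨-, h⟩
      · exact absurd (Or.inr ⟨hfR.1, b, h, hfb.symm⟩) hfsb
      · exact h
    refine ⟨b, ⟨hbR.2.1, hbR.1.2.1, hbR.1.2.2.1, by omega⟩, ?_⟩
    refine Pivotal.of_conn (f := f) (e := e) (w := w') (by omega) ?_ ?_ ?_ hbR.1 hadj.symm hfb.symm
      ?_ he
    · intro v hv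
      rw [opn_cfg, hA] at hv
      have := hlow v hv
      omega
    · rwa [opn_cfg, hA]
    · rw [adj_iff] at hadj
      omega
    · rw [opn_cfg, hA]
      refine hef.symm.mono ?_
      rintro v ⟨⟨h1, h2⟩, h3⟩
      exact ⟨⟨(hOR v h1).1, fun h4 => h2 ⟨h4, h3⟩⟩, fun h4 => h3 (Or.inl h4)⟩

end Lower

theorem pr_hasPivotal_lower : ∃ δ : ℝ, 0 < δ ∧ ∀ μ : Measure Config, IsBernoulliHalf μ →
    ∀ n m : ℕ, 1 ≤ m → m ≤ n → δ * m / n ≤ pr μ (HasPivotal n (lowStrip n m)) := by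
  obtain ⟨δ₁, hδ₁, H₁⟩ := pr_lowCrossing
  obtain ⟨δ₂, hδ₂, H₂⟩ := pr_Cap
  set δ := min (1 / 2) δ₂ with hδ
  have hδ0 : 0 < δ := lt_min (by norm_num) hδ₂
  refine ⟨δ * δ₁ / 16, by positivity, fun μ hμ n m hm hmn => ?_⟩
  obtain ⟨r, hr, hrn, hrm, H⟩ : ∃ r : ℕ, 1 ≤ r ∧ r ≤ n ∧ m ≤ 16 * r ∧
      δ * pr μ (LowCrossing n r) ≤ pr μ (HasPivotal n (lowStrip n m)) := by
    by_cases h8 : 8 ≤ m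
    · refine ⟨m / 8, by omega, by omega, by omega, ?_⟩
      refine pr_hasPivotal_large hμ hδ0.le (by omega) (by omega) (by omega) fun c h1 h2 => ?_
      exact (min_le_right _ _).trans (H₂ μ hμ _ _ _ _ _ (by omega) h1 h2)
    · refine ⟨1, le_rfl, by omega, by omega, ?_⟩
      refine le_trans ?_ (pr_hasPivotal_small hμ (n := n) (m := m) (by omega) (by omega))
      exact mul_le_mul_of_nonneg_right (min_le_left _ _) (pr_nonneg _ _)
  refine le_trans ?_ H
  have h1 := H₁ μ hμ n r hr hrn
  have hn : (0 : ℝ) < n := by exact_mod_cast (by omega : 0 < n)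
  have hrm' : (m : ℝ) ≤ 16 * r := by exact_mod_cast hrm
  calc δ * δ₁ / 16 * m / n ≤ δ * δ₁ / 16 * (16 * r) / n := by gcongr
    _ = δ * (δ₁ * r / n) := by ring
    _ ≤ _ := by gcongr

/-- Crossings surrounding the square of radius `8 * m` around `(c, b)`, truncated to the columns
between `-n` and `n`. -/
def Annulus (n m b c : ℤ) (A : Set Site) : Prop :=
  (LR (max (c - 16 * m) (-n)) (min (c + 16 * m) n) (b + 8 * m + 1) (b + 16 * m) A ∧
    LR (max (c - 16 * m) (-n)) (min (c + 16 * m) n) (b - 16 * m) (b - 8 * m - 1) A) ∧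
  ((c + 16 * m ≤ n → TB (c + 8 * m + 1) (c + 16 * m) (b - 16 * m) (b + 16 * m) A) ∧
    (-n ≤ c - 16 * m → TB (c - 16 * m) (c - 8 * m - 1) (b - 16 * m) (b + 16 * m) A))

section Annulus

variable {n m b c : ℤ}

theorem Annulus.mono {A B : Set Site} (h : Annulus n m b c A)
    (hAB : ∀ v ∈ A, v ∈ rect (-n) n (b - 16 * m) (b + 16 * m) → v ∈ B) (h₁ : -n ≤ c)
    (h₂ : c ≤ n) : Annulus n m b c B := by
  refine ⟨⟨h.1.1.mono ?_, h.1.2.mono ?_⟩, fun h3 => (h.2.1 h3).mono ?_,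
    fun h3 => (h.2.2 h3).mono ?_⟩
  all_goals
    rintro v ⟨⟨h4, h5, h6, h7⟩, h8⟩
    exact hAB v h8 ⟨by omega, by omega, by omega, by omega⟩

theorem Annulus.monotone (h₁ : -n ≤ c) (h₂ : c ≤ n) : Monotone (Annulus n m b c) :=
  fun _ _ hAB hA => hA.mono (fun _ hv _ => hAB hv) h₁ h₂

theorem Annulus.depOn (h₁ : -n ≤ c) (h₂ : c ≤ n) :
    DepOn (rect (-n) n (b - 16 * m) (b + 16 * m)) (Annulus n m b c) := by
  have key : ∀ A B : Set Site, A ∩ rect (-n) n (b - 16 * m) (b + 16 * m) =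
      B ∩ rect (-n) n (b - 16 * m) (b + 16 * m) → Annulus n m b c A → Annulus n m b c B :=
    fun A B h hA => hA.mono (fun v hv hv' => (h.subset ⟨hv, hv'⟩ :).1) h₁ h₂
  exact fun A B h => ⟨key A B h, key B A h.symm⟩

/-- The distance to `(c, b)` in the supremum norm. -/
def radius (c b : ℤ) (v : Site) : ℤ := max (max (v.1 - c) (c - v.1)) (max (v.2 - b) (b - v.2))

theorem stepOne_radius (c b : ℤ) : StepOne (radius c b) := fun v w h => by
  rw [adj_iff] at h
  simp only [radius]
  omega

theorem Annulus.no_crossing {A S : Set Site} (hA : Annulus n m b c A) (hm : 1 ≤ m) {u v : Site}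
    (huv : Conn S u v) (hS : ∀ z ∈ S, -n ≤ z.1 ∧ z.1 ≤ n)
    (hSA : ∀ z ∈ S, radius c b z ≤ 16 * m → z ∉ A) (hu : radius c b u ≤ 8 * m + 1)
    (hv : 16 * m ≤ radius c b v) : False := by
  obtain ⟨p, q, hpq, hp, hq, -⟩ := huv.strip (stepOne_radius c b) (by omega) hu hv
  have hsub : ∀ z ∈ S ∩ {z | 8 * m + 1 ≤ radius c b z ∧ radius c b z ≤ 16 * m},
      z ∈ Aᶜ ∧ -n ≤ z.1 ∧ z.1 ≤ n ∧ radius c b z ≤ 16 * m := fun z hz =>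
    ⟨hSA z hz.1 hz.2.2, hS z hz.1 |>.1, hS z hz.1 |>.2, hz.2.2⟩
  have hpq' := hpq.mono hsub
  have hqn := hpq'.mem_right.2
  have hq' : q.1 = c + 16 * m ∨ q.1 = c - 16 * m ∨ q.2 = b + 16 * m ∨ q.2 = b - 16 * m := by
    simp only [radius] at hq
    omega
  simp only [radius] at hp
  rcases hq' with h | h | h | h
  · obtain ⟨s, t, hst, hs, ht, -⟩ := hpq'.strip stepOne_fst (c := c + 8 * m + 1) (d := c + 16 * m)
      (by omega) (by omega) (by omega)
    obtain ⟨p', q', hpq', hp', hq'⟩ := hA.2.1 (by omega)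
    refine LR.not_TB (x₀ := c + 8 * m + 1) (x₁ := c + 16 * m) (y₀ := b - 16 * m)
      (y₁ := b + 16 * m) (A := Aᶜ) ⟨s, t, hst.mono ?_, hs, ht⟩ ⟨p', q', hpq'.mono ?_, hp', hq'⟩
    · rintro z ⟨⟨h1, h2, h3, h4⟩, h5⟩
      simp only [radius] at h4
      exact ⟨⟨h5.1, h5.2, by omega, by omega⟩, h1⟩
    · rw [compl_compl]
  · obtain ⟨s, t, hst, hs, ht, -⟩ := hpq'.strip stepOne_neg_fst (c := -(c - 8 * m - 1))
      (d := -(c - 16 * m)) (by omega) (by omega) (by omega)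
    obtain ⟨p', q', hpq', hp', hq'⟩ := hA.2.2 (by omega)
    refine LR.not_TB (x₀ := c - 16 * m) (x₁ := c - 8 * m - 1) (y₀ := b - 16 * m)
      (y₁ := b + 16 * m) (A := Aᶜ) ⟨t, s, hst.symm.mono ?_, by omega, by omega⟩
      ⟨p', q', hpq'.mono ?_, hp', hq'⟩
    · rintro z ⟨⟨h1, h2, h3, h4⟩, h5⟩
      simp only [radius] at h4
      have h6 : -(c - 8 * m - 1) ≤ -z.1 := h5.1
      have h7 : -z.1 ≤ -(c - 16 * m) := h5.2
      exact ⟨⟨by omega, by omega, by omega, by omega⟩, h1⟩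
    · rw [compl_compl]
  · obtain ⟨s, t, hst, hs, ht, -⟩ := hpq'.strip stepOne_snd (c := b + 8 * m + 1) (d := b + 16 * m)
      (by omega) (by omega) (by omega)
    refine hA.1.1.not_TB ⟨t, s, hst.symm.mono ?_, ht, hs⟩
    rintro z ⟨⟨h1, h2, h3, h4⟩, h5⟩
    simp only [radius] at h4
    exact ⟨⟨by omega, by omega, h5.1, h5.2⟩, h1⟩
  · obtain ⟨s, t, hst, hs, ht, -⟩ := hpq'.strip stepOne_neg_snd (c := -(b - 8 * m - 1))
      (d := -(b - 16 * m)) (by omega) (by omega) (by omega)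
    refine hA.1.2.not_TB ⟨s, t, hst.mono ?_, by omega, by omega⟩
    rintro z ⟨⟨h1, h2, h3, h4⟩, h5⟩
    simp only [radius] at h4
    have h6 : -(b - 8 * m - 1) ≤ -z.2 := h5.1
    have h7 : -z.2 ≤ -(b - 16 * m) := h5.2
    exact ⟨⟨by omega, by omega, by omega, by omega⟩, h1⟩

end Annulus

theorem pr_annulus : ∃ δ : ℝ, 0 < δ ∧ ∀ μ : Measure Config, IsBernoulliHalf μ →
    ∀ n m b c : ℤ, 1 ≤ m → -n ≤ c → c ≤ n → δ ≤ pr μ (Annulus n m b c) := by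
  obtain ⟨δ, hδ, H⟩ := rsw 5
  refine ⟨δ * δ * (δ * δ), by positivity, fun μ hμ n m b c hm h₁ h₂ => ?_⟩
  have t1 := H μ hμ (max (c - 16 * m) (-n)) (min (c + 16 * m) n) (b + 8 * m + 1) (b + 16 * m)
    (by omega) (by omega) (by push_cast; omega)
  have t2 := H μ hμ (max (c - 16 * m) (-n)) (min (c + 16 * m) n) (b - 16 * m) (b - 8 * m - 1)
    (by omega) (by omega) (by push_cast; omega)
  have leg : ∀ (P : Prop) (x y : ℤ), y = x + (8 * m - 1) →
      δ ≤ pr μ (fun A => P → TB x y (b - 16 * m) (b + 16 * m) A) := by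
    intro P x y hxy
    refine (H μ hμ (b - 16 * m) (b + 16 * m) x y (by omega) (by omega)
      (by push_cast; omega)).trans ?_
    rw [← pr_TB_swap hμ]
    exact pr_mono hμ fun A hA _ => hA
  have hloc : ∀ (P : Prop) (x y : ℤ), LocalEv (fun A => P → TB x y (b - 16 * m) (b + 16 * m) A) :=
    fun P x y => DepOn.local (fun A B hAB => by rw [TB.depOn _ _ _ _ A B hAB]) (rect_finite _ _ _ _)
  have hmon : ∀ (P : Prop) (x y : ℤ), Monotone (fun A => P → TB x y (b - 16 * m) (b + 16 * m) A) :=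
    fun P x y A B hAB hA hP => TB.monotone _ _ _ _ hAB (hA hP)
  have h3 := (mul_le_mul t1 t2 hδ.le (pr_nonneg _ _)).trans
    (pr_harris hμ (LR.local _ _ _ _) (LR.local _ _ _ _) (LR.monotone _ _ _ _) (LR.monotone _ _ _ _))
  have h4 := (mul_le_mul (leg (c + 16 * m ≤ n) (c + 8 * m + 1) (c + 16 * m) (by ring))
    (leg (-n ≤ c - 16 * m) (c - 16 * m) (c - 8 * m - 1) (by ring)) hδ.le (pr_nonneg _ _)).trans
    (pr_harris hμ (hloc _ _ _) (hloc _ _ _) (hmon _ _ _) (hmon _ _ _))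
  exact (mul_le_mul h3 h4 (by positivity) (pr_nonneg _ _)).trans
    (pr_harris hμ ((LR.local _ _ _ _).and (LR.local _ _ _ _)) ((hloc _ _ _).and (hloc _ _ _))
      (Monotone.and_ev (LR.monotone _ _ _ _) (LR.monotone _ _ _ _))
      (Monotone.and_ev (hmon _ _ _) (hmon _ _ _)))

/-- The box of radius `R` around `(c, b)`. -/
def ball (b c R : ℤ) : Set Site := rect (c - R) (c + R) (b - R) (b + R)

/-- The region in which separating crossings are looked for. -/
def sepDom (n m b t' c d : ℤ) : Set Site :=
  {v | v ∈ rect (-n) n (b - 16 * m) t' ∧ (b ≤ v.2 ∨ v ∈ ball b c (16 * m) ∪ ball b d (16 * m))}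

/-- The sites available to separating crossings. -/
def sepSites (n m b t' c d : ℤ) (A : Set Site) : Set Site :=
  (A ∩ sepDom n m b t' c d) \ (ball b c (8 * m) ∪ ball b d (8 * m))

/-- There is an open crossing below the two base points. -/
def Separated (n m b t' c d : ℤ) (A : Set Site) : Prop :=
  LR (-n) n (b - 16 * m) t' (sepSites n m b t' c d A)

/-- The base box at `c`. -/
def baseBox (m b c : ℤ) : Set Site := rect (c - m - 1) (c + m + 1) b (b + m + 1)

/-- There is a closed connection from the top side to the base box at `c`. -/
def Reach (n m b t' c : ℤ) (A : Set Site) : Prop :=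
  ∃ p w, Conn (rect (-n) n b t' \ A) p w ∧ p.2 = t' ∧ w ∈ baseBox m b c

/-- The top cluster visits both base boxes and avoids the bottom side. -/
def TwoArms (n m b t c d : ℤ) (A : Set Site) : Prop :=
  (∀ v ∈ topClus (-n) n b t A, b < v.2) ∧ (∃ w ∈ topClus (-n) n b t A, w ∈ baseBox m b c) ∧
    ∃ w ∈ topClus (-n) n b t A, w ∈ baseBox m b d

/-- A crossing of the lower middle part of the box. -/
def Band (n b : ℤ) (A : Set Site) : Prop := LR (-n) n (b + n / 2) (b + n) A

section Upper

variable {n m b t t' c d : ℤ} {A : Set Site}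

theorem mem_topClus_of_mem_clusBar {x₀ x₁ b t : ℤ} {A : Set Site} {v : Site}
    (hv : v ∈ clusBar (rect x₀ x₁ b t) (topClus x₀ x₁ b t A)) (hvA : v ∉ A) :
    v ∈ topClus x₀ x₁ b t A := by
  rcases hv with h | ⟨h1, w, hw, hwv⟩
  · exact h
  · exact clus_step hw hwv (Or.inr ⟨h1, hvA⟩)

theorem reach_of_topClus (hm : 1 ≤ m) (hn : 64 * m ≤ n) (ht' : b + n ≤ t') (ht : t' ≤ t)
    (hC : ∃ w ∈ topClus (-n) n b t A, w ∈ baseBox m b c) : Reach n m b t' c A := by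
  obtain ⟨w, hw, hwc⟩ := hC
  have hw2 := hwc.2.2.2
  obtain ⟨u, hwu, hu⟩ := topClus_conn hw (by omega)
  obtain ⟨p, hwp, hp, -⟩ := hwu.first_hit stepOne_snd (c := t') (by omega) (by omega)
  refine ⟨p, w, hwp.symm.mono ?_, hp, hwc⟩
  rintro z ⟨⟨h1, h2⟩, h3⟩
  have := topClus_mem h1 h2
  exact ⟨⟨this.1.1, this.1.2.1, this.1.2.2.1, h3⟩, this.2⟩

theorem radius_le_iff {c b R : ℤ} {v : Site} : radius c b v ≤ R ↔ v ∈ ball b c R := by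
  simp only [radius, ball, mem_rect]
  omega

theorem separated_of_annulus (hm : 1 ≤ m) (hn : 64 * m ≤ n) (ht' : b + n ≤ t') (ht : t' ≤ t)
    (hlow : ∀ v ∈ topClus (-n) n b t A, b < v.2)
    (hc : Annulus n m b c (A ∪ clusBar (rect (-n) n b t) (topClus (-n) n b t A)))
    (hd : Annulus n m b d (A ∪ clusBar (rect (-n) n b t) (topClus (-n) n b t A)))
    (hband : Band n b (A ∪ clusBar (rect (-n) n b t) (topClus (-n) n b t A))) :
    Separated n m b t' c d A := by
  set s := topClus (-n) n b t A with hs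
  set sb := clusBar (rect (-n) n b t) s with hsb
  set R := rect (-n) n (b - 16 * m) t' with hR
  set Z := R ∩ (sepSites n m b t' c d A)ᶜ with hZ
  set N := ball b c (8 * m) ∪ ball b d (8 * m) with hN
  refine (LR_or_TB (by omega) (by omega) _).resolve_right ?_
  rintro ⟨u, e, hue, hu, he⟩
  have hclosed : ∀ v ∈ Z, v ∉ N → v ∈ sepDom n m b t' c d → v ∉ A := fun v h1 h2 h3 h4 =>
    h1.2 ⟨⟨h4, h3⟩, h2⟩
  have hfree : ∀ v, v ∉ A → v ∉ s → v ∉ A ∪ sb := fun v h1 h2 h3 => h3.elim h1 fun h4 =>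
    h2 (mem_topClus_of_mem_clusBar h4 h1)
  have heN : e ∉ N := by
    rintro (h | h) <;> have := h.2.2.1 <;> omega
  have hes : e ∉ s := fun h => by
    have := hlow e h
    omega
  rcases hue.symm.exit_or (T := {v | v ∉ N ∧ v ∉ s}) ⟨heN, hes⟩ with
    h | ⟨a, g, hea, hag, hg, hgT, -⟩
  · obtain ⟨p, q, hpq, hp, hq, -⟩ := h.strip stepOne_snd (c := b + n / 2) (d := b + n) (by omega)
      (by omega) (by omega)
    refine hband.not_TB ⟨q, p, hpq.symm.mono ?_, hq, hp⟩
    rintro v ⟨⟨h1, h2, h3⟩, h4, h5⟩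
    refine ⟨⟨h1.1.1, h1.1.2.1, h4, h5⟩, hfree v (hclosed v h1 h2 ⟨h1.1, Or.inl ?_⟩) h3⟩
    omega
  · have ha := hea.mem_right
    have haR : a ∈ R := ha.1.1
    by_cases hgs : g ∈ s
    · have h1 := hlow g hgs
      have h2 := haR.2.2.2
      have hadj := adj_iff.1 hag
      have haA := hclosed a ha.1 ha.2.1 ⟨haR, Or.inl (by omega)⟩
      exact ha.2.2 (clus_step hgs hag.symm
        (Or.inr ⟨⟨haR.1, haR.2.1, by omega, by omega⟩, haA⟩))
    · have hgN : g ∈ N := by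
        by_contra h
        exact hgT ⟨h, hgs⟩
      have key : ∀ x, Annulus n m b x (A ∪ sb) →
          ball b x (16 * m) ⊆ ball b c (16 * m) ∪ ball b d (16 * m) →
          g ∈ ball b x (8 * m) → False := by
        intro x hx hsub hgx
        refine hx.no_crossing (by omega) hea.symm (fun z hz => ⟨hz.1.1.1, hz.1.1.2.1⟩) ?_ ?_ ?_
        · rintro z ⟨h1, h2, h3⟩ h4
          exact hfree z (hclosed z h1 h2 ⟨h1.1, Or.inr (hsub (radius_le_iff.1 h4))⟩) h3
        · have h1 := radius_le_iff.2 hgx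
          have h2 := stepOne_radius x b g a hag.symm
          omega
        · simp only [radius]
          omega
      rcases hgN with h | h
      · exact key c hc Set.subset_union_left h
      · exact key d hd Set.subset_union_right h

end Upper

theorem union_inter_eq {A B R s : Set Site} (h : A ∩ (R \ s) = B ∩ (R \ s)) :
    (A ∪ s) ∩ R = (B ∪ s) ∩ R := by
  ext v
  have := congrArg (v ∈ ·) h
  simp only [Set.mem_inter_iff, Set.mem_sdiff, Set.mem_union, eq_iff_iff] at this ⊢
  tauto

theorem compl_inter_eq {A B S : Set Site} (h : A ∩ S = B ∩ S) : Aᶜ ∩ S = Bᶜ ∩ S := by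
  ext v
  have := congrArg (v ∈ ·) h
  simp only [Set.mem_inter_iff, Set.mem_compl_iff, eq_iff_iff] at this ⊢
  tauto

theorem conn_rect {x₀ x₁ y₀ y₁ : ℤ} {u v : Site} (hu : u ∈ rect x₀ x₁ y₀ y₁)
    (hv : v ∈ rect x₀ x₁ y₀ y₁) : Conn (rect x₀ x₁ y₀ y₁) u v := by
  obtain ⟨a, b⟩ := u
  obtain ⟨c, d⟩ := v
  obtain ⟨h1, h2, h3, h4⟩ := hu
  obtain ⟨k1, k2, k3, k4⟩ := hv
  dsimp only at h1 h2 h3 h4 k1 k2 k3 k4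
  refine Conn.trans (v := (c, b)) ?_ ?_
  · rcases le_total a c with h | h
    · exact conn_row h fun x _ _ => ⟨by omega, by omega, h3, h4⟩
    · exact Conn.symm (conn_row h fun x _ _ => ⟨by omega, by omega, h3, h4⟩)
  · rcases le_total b d with h | h
    · exact conn_col h fun y _ _ => ⟨k1, k2, by omega, by omega⟩
    · exact Conn.symm (conn_col h fun y _ _ => ⟨k1, k2, by omega, by omega⟩)

theorem Reach.depOn (n m b t' c : ℤ) : DepOn (rect (-n) n b t') (Reach n m b t' c) :=
  fun A B h => by
    rw [Reach, Reach, diff_eq_of_inter_eq h]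

theorem Separated.depOn (n m b t' c d : ℤ) :
    DepOn (rect (-n) n (b - 16 * m) t') (Separated n m b t' c d) := fun A B h => by
  have : A ∩ sepDom n m b t' c d = B ∩ sepDom n m b t' c d :=
    inter_eq_of_subset (fun v hv => hv.1) h
  rw [Separated, Separated, sepSites, sepSites, this]

theorem TwoArms.depOn (n m b t c d : ℤ) : DepOn (rect (-n) n b t) (TwoArms n m b t c d) :=
  fun A B h => by
    have : topClus (-n) n b t A = topClus (-n) n b t B := clus_congr h
    rw [TwoArms, TwoArms, this]

theorem pr_separated : ∃ δ : ℝ, 0 < δ ∧ ∀ μ : Measure Config, IsBernoulliHalf μ →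
    ∀ n m b t t' c d : ℤ, 1 ≤ m → 64 * m ≤ n → b + n ≤ t' → t' ≤ t → -n ≤ c → c ≤ n → -n ≤ d →
      d ≤ n → δ * pr μ (TwoArms n m b t c d) ≤
        pr μ (fun A => (Reach n m b t' c A ∧ Reach n m b t' d A) ∧ Separated n m b t' c d A) := by
  obtain ⟨δ₁, hδ₁, H₁⟩ := pr_annulus
  obtain ⟨δ₂, hδ₂, H₂⟩ := rsw 5
  refine ⟨δ₁ * δ₁ * δ₂, by positivity,
    fun μ hμ n m b t t' c d hm hn ht' ht hc₁ hc₂ hd₁ hd₂ => ?_⟩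
  have hY := rect_finite (-n) n b t
  have hB := rect_finite (-n) n (b - 16 * m) t
  have hdepE : DepOn (rect (-n) n (b - 16 * m) t') (fun A =>
      (Reach n m b t' c A ∧ Reach n m b t' d A) ∧ Separated n m b t' c d A) := by
    have hsub : rect (-n) n b t' ⊆ rect (-n) n (b - 16 * m) t' := by
      rintro v ⟨h1, h2, h3, h4⟩
      exact ⟨h1, h2, by omega, h4⟩
    exact (((Reach.depOn n m b t' c).mono hsub).and ((Reach.depOn n m b t' d).mono hsub)).and
      (Separated.depOn n m b t' c d)
  refine pr_le_of_cond hμ hY (topClus (-n) n b t) (fun A B => clus_congr)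
    ((TwoArms.depOn n m b t c d).local hY) (hdepE.local (rect_finite _ _ _ _)) _ fun A₀ hA₀ => ?_
  set s := topClus (-n) n b t A₀ with hs
  set sb := clusBar (rect (-n) n b t) s with hsb
  set G : Set Site → Prop := fun A => (Annulus n m b c A ∧ Annulus n m b d A) ∧ Band n b A with hG
  have hA1 : ∀ x, -n ≤ x → x ≤ n → DepOn (rect (-n) n (b - 16 * m) t) (Annulus n m b x) := by
    intro x h1 h2
    refine (Annulus.depOn h1 h2).mono ?_
    rintro v ⟨h1, h2, h3, h4⟩
    exact ⟨h1, h2, h3, by omega⟩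
  have hA2 : DepOn (rect (-n) n (b - 16 * m) t) (Band n b) := by
    refine (LR.depOn _ _ _ _).mono ?_
    rintro v ⟨h1, h2, h3, h4⟩
    exact ⟨h1, h2, by omega, by omega⟩
  have hAc := hA1 c hc₁ hc₂
  have hAd := hA1 d hd₁ hd₂
  have hGdep : DepOn (rect (-n) n (b - 16 * m) t) G := (hAc.and hAd).and hA2
  have hGpr : δ₁ * δ₁ * δ₂ ≤ pr μ G := by
    have h1 := (mul_le_mul (H₁ μ hμ n m b c hm hc₁ hc₂) (H₁ μ hμ n m b d hm hd₁ hd₂) hδ₁.le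
      (pr_nonneg _ _)).trans (pr_harris hμ (hAc.local hB) (hAd.local hB)
        (Annulus.monotone hc₁ hc₂) (Annulus.monotone hd₁ hd₂))
    exact (mul_le_mul h1 (H₂ μ hμ (-n) n (b + n / 2) (b + n) (by omega) (by omega)
      (by push_cast; omega)) hδ₂.le (pr_nonneg _ _)).trans
      (pr_harris hμ ((hAc.and hAd).local hB) (hA2.local hB)
        (Monotone.and_ev (Annulus.monotone hc₁ hc₂) (Annulus.monotone hd₁ hd₂))
        (LR.monotone _ _ _ _))
  have hGmono : Monotone G := Monotone.and_ev
    (Monotone.and_ev (Annulus.monotone hc₁ hc₂) (Annulus.monotone hd₁ hd₂)) (LR.monotone _ _ _ _)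
  have hFdep : DepOn (rect (-n) n (b - 16 * m) t \ sb) (fun A => G (A ∪ sb)) := by
    intro A B hAB
    exact hGdep _ _ (union_inter_eq hAB)
  have hind := pr_indep hμ (hY.subset Set.inter_subset_right) (hB.subset Set.sdiff_subset)
    (Set.disjoint_left.2 fun v hv hv' => hv'.2 hv.1)
    (clus_dep (V := topSeed (-n) n t) (Y := rect (-n) n b t) (s := s)) hFdep
  calc _ ≤ pr μ (fun A => topClus (-n) n b t A = s) * pr μ (fun A => G (A ∪ sb)) := by
        rw [mul_comm]
        refine mul_le_mul (pr_mono hμ fun A hA => hA.1) (hGpr.trans (pr_mono hμ fun A hA => ?_))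
          (by positivity) (pr_nonneg _ _)
        exact hGmono Set.subset_union_left hA
    _ = _ := hind.symm
    _ ≤ _ := pr_mono hμ ?_
  rintro A ⟨hA, ⟨h1, h2⟩, h3⟩
  change topClus (-n) n b t A = s at hA
  rw [hsb] at h1 h2 h3
  obtain ⟨k1, k2, k3⟩ := hA₀
  rw [← hs] at k1 k2 k3
  rw [← hA] at h1 h2 h3 k1 k2 k3
  exact ⟨hA, ⟨reach_of_topClus hm hn ht' ht k2, reach_of_topClus hm hn ht' ht k3⟩,
    separated_of_annulus hm hn ht' ht k1 h1 h2 h3⟩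

/-- The row below the rectangle. -/
def botSeed (x₀ x₁ b : ℤ) : Set Site := {v | v.2 = b - 1 ∧ x₀ ≤ v.1 ∧ v.1 ≤ x₁}

/-- The closed cluster of the bottom side of the rectangle. -/
def botClus (x₀ x₁ b t : ℤ) (A : Set Site) : Set Site :=
  clus (botSeed x₀ x₁ b) (rect x₀ x₁ b t) A

section BotClus

variable {x₀ x₁ b t : ℤ} {A : Set Site}

theorem LR.not_conn_botSeed (hA : LR x₀ x₁ b t A) (hbt : b ≤ t) {u v : Site}
    (huv : Conn (botSeed x₀ x₁ b ∪ rect x₀ x₁ b t \ A) u v) (hu : u ∈ botSeed x₀ x₁ b)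
    (hv : t ≤ v.2) : False := by
  obtain ⟨p, q, hpq, hp, hq, -⟩ := huv.strip stepOne_snd hbt (by have := hu.1; omega) hv
  refine hA.not_TB ⟨q, p, hpq.symm.mono ?_, hq, hp⟩
  rintro z ⟨h1 | h1, h2, h3⟩
  · have := h1.1
    omega
  · exact h1

theorem LR_iff_botClus (hx : x₀ ≤ x₁) (hbt : b ≤ t) :
    LR x₀ x₁ b t A ↔ ∀ v ∈ botClus x₀ x₁ b t A, v.2 < t := by
  constructor
  · rintro hA v ⟨u, hu, huv⟩
    by_contra! h
    exact hA.not_conn_botSeed hbt huv hu h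
  · intro h
    refine (LR_or_TB hx hbt A).resolve_right ?_
    rintro ⟨p, q, hpq, hp, hq⟩
    have hqm := hpq.mem_right
    have h1 : ((q.1, b - 1) : Site) ∈ botSeed x₀ x₁ b := ⟨rfl, hqm.1.1, hqm.1.2.1⟩
    have h2 : Adj ((q.1, b - 1) : Site) q := by
      rw [adj_iff]
      dsimp only
      omega
    have h3 : q ∈ botClus x₀ x₁ b t A := clus_step (subset_clus h1) h2 (Or.inr hqm)
    have := h p (clus_conn h3 (hpq.symm.mono fun z hz => Or.inr hz))
    omega

end BotClus

/-- There is a closed connection from the top side to the row below the base box at `c`. -/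
def Foot (n m b t' c : ℤ) (A : Set Site) : Prop :=
  ∃ p e, Conn (rect (-n) n (b - 1) t' \ A) p e ∧ p.2 = t' ∧ e.2 = b - 1 ∧ c - 4 * m ≤ e.1 ∧
    e.1 ≤ c + 4 * m

/-- The base point at `c` is reached off the set `s`. -/
def ReachOff (n m b t' c : ℤ) (s A : Set Site) : Prop :=
  ∃ p w, Conn ((rect (-n) n b t' \ s) \ A) p w ∧ p.2 = t' ∧ w ∈ baseBox m b c

theorem ReachOff.antitone (n m b t' c : ℤ) (s : Set Site) : Antitone (ReachOff n m b t' c s) :=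
  fun _ _ hAB ⟨p, w, h1, h2⟩ => ⟨p, w, h1.mono (Set.sdiff_subset_sdiff_right hAB), h2⟩

theorem ReachOff.depOn (n m b t' c : ℤ) (s : Set Site) :
    DepOn (rect (-n) n b t' \ s) (ReachOff n m b t' c s) := fun A B h => by
  rw [ReachOff, ReachOff, diff_eq_of_inter_eq h]

theorem ReachOff.reach {n m b t' c : ℤ} {s A : Set Site} (h : ReachOff n m b t' c s A) :
    Reach n m b t' c A := by
  obtain ⟨p, w, h1, h2⟩ := h
  exact ⟨p, w, h1.mono fun z hz => ⟨hz.1.1, hz.2⟩, h2⟩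

theorem Foot.depOn (n m b t' c : ℤ) : DepOn (rect (-n) n (b - 1) t') (Foot n m b t' c) :=
  fun A B h => by rw [Foot, Foot, diff_eq_of_inter_eq h]

theorem Reach.foot {n m b t' c : ℤ} {A : Set Site} (h : Reach n m b t' c A)
    (hcap : Cap (-n) n (b - 1) c (2 * m) Aᶜ) (hm : 1 ≤ m) (hn : 64 * m ≤ n) (ht' : b + n ≤ t')
    (hc₁ : -n ≤ c) (hc₂ : c ≤ n) : Foot n m b t' c A := by
  obtain ⟨p, w, hpw, hp, hw⟩ := h
  obtain ⟨hw1, hw2, hw3, hw4⟩ := hw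
  obtain ⟨z, e, hpz, hze, he⟩ := Cap.meet (S := rect (-n) n b t' \ A) (p := p) (w := w) (by omega)
    hc₁ hc₂ (by omega) hcap hpw
    (fun v hv => ⟨hv.1.1, hv.1.2.1, by have := hv.1.2.2.1; omega⟩)
    (by omega) (by omega) (by omega) (by omega)
  refine ⟨p, e, (hpz.mono ?_).trans (hze.mono ?_), hp, he, ?_, ?_⟩
  · rintro v ⟨⟨h1, h2, h3, h4⟩, h5⟩
    exact ⟨⟨h1, h2, by omega, h4⟩, h5⟩
  · rintro v ⟨⟨h1, h2, h3, h4⟩, h5⟩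
    exact ⟨⟨by omega, by omega, h3, by omega⟩, h5⟩
  · have := hze.mem_right.1.1
    omega
  · have := hze.mem_right.1.2.1
    omega

section StepB

variable {n m b t' c d : ℤ} {A : Set Site}

theorem sepSites_subset : sepSites n m b t' c d A ⊆ A ∩ sepDom n m b t' c d := Set.sdiff_subset

theorem Separated.botClus_disjoint (hA : Separated n m b t' c d A) (hm : 1 ≤ m) (hn : 64 * m ≤ n)
    (ht' : b + n ≤ t') {x : ℤ} (hx : ball b x (8 * m) ⊆ ball b c (8 * m) ∪ ball b d (8 * m))
    (hr : Reach n m b t' x A) {g : Site}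
    (hg : g ∈ clusBar (rect (-n) n (b - 16 * m) t')
      (botClus (-n) n (b - 16 * m) t' (A ∩ sepDom n m b t' c d)))
    (hgx : g ∈ ball b x (8 * m)) (hgY : g ∈ rect (-n) n (b - 16 * m) t') : False := by
  set Y := rect (-n) n (b - 16 * m) t' with hY
  set Z := sepSites n m b t' c d A with hZ
  have hball : ∀ v ∈ Y, v ∈ ball b x (8 * m) → v ∈ botSeed (-n) n (b - 16 * m) ∪ Y \ Z :=
    fun v h1 h2 => Or.inr ⟨h1, fun h3 => h3.2 (hx h2)⟩
  have hsub : botSeed (-n) n (b - 16 * m) ∪ Y \ (A ∩ sepDom n m b t' c d) ⊆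
      botSeed (-n) n (b - 16 * m) ∪ Y \ Z :=
    Set.union_subset_union_right _ (Set.sdiff_subset_sdiff_right sepSites_subset)
  obtain ⟨u, hu, hug⟩ : ∃ u ∈ botSeed (-n) n (b - 16 * m),
      Conn (botSeed (-n) n (b - 16 * m) ∪ Y \ Z) u g := by
    rcases hg with ⟨u, hu, hug⟩ | ⟨-, w, ⟨u, hu, huw⟩, hwg⟩
    · exact ⟨u, hu, hug.mono hsub⟩
    · exact ⟨u, hu, (huw.mono hsub).tail hwg (hball g hgY hgx)⟩
  obtain ⟨p, w, hpw, hp, hw⟩ := hr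
  have hwY : w ∈ Y := by
    obtain ⟨h1, h2, h3, h4⟩ := hpw.mem_right.1
    exact ⟨h1, h2, by omega, h4⟩
  have hwx : w ∈ ball b x (8 * m) := by
    obtain ⟨h1, h2, h3, h4⟩ := hw
    exact ⟨by omega, by omega, by omega, by omega⟩
  have hgw : Conn (botSeed (-n) n (b - 16 * m) ∪ Y \ Z) g w := by
    have h1 : ∀ v, v ∈ Y ∧ v ∈ ball b x (8 * m) ↔ v ∈ rect (max (-n) (x - 8 * m))
        (min n (x + 8 * m)) (b - 8 * m) (b + 8 * m) := fun v => by
      simp only [hY, ball, mem_rect]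
      omega
    exact (conn_rect ((h1 g).1 ⟨hgY, hgx⟩) ((h1 w).1 ⟨hwY, hwx⟩)).mono fun v hv =>
      hball v ((h1 v).2 hv).1 ((h1 v).2 hv).2
  have hwp : Conn (botSeed (-n) n (b - 16 * m) ∪ Y \ Z) w p := by
    refine hpw.symm.mono ?_
    rintro v ⟨⟨h1, h2, h3, h4⟩, h5⟩
    exact Or.inr ⟨⟨h1, h2, by omega, h4⟩, fun h => h5 (sepSites_subset h).1⟩
  exact LR.not_conn_botSeed hA (by omega) ((hug.trans hgw).trans hwp) hu hp.ge

theorem Reach.off {x : ℤ} (hr : Reach n m b t' x A) (hm : 0 ≤ m)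
    (hlt : ∀ v ∈ botClus (-n) n (b - 16 * m) t' (A ∩ sepDom n m b t' c d), v.2 < t') :
    ReachOff n m b t' x (clusBar (rect (-n) n (b - 16 * m) t')
      (botClus (-n) n (b - 16 * m) t' (A ∩ sepDom n m b t' c d))) A := by
  obtain ⟨p, w, hpw, hp, hw⟩ := hr
  have hsub : rect (-n) n b t' \ A ⊆ botSeed (-n) n (b - 16 * m) ∪
      rect (-n) n (b - 16 * m) t' \ (A ∩ sepDom n m b t' c d) := by
    rintro v ⟨⟨h1, h2, h3, h4⟩, h5⟩
    exact Or.inr ⟨⟨h1, h2, by omega, h4⟩, fun h => h5 h.1⟩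
  refine ⟨p, w, hpw.restrict.mono fun z hz => ?_, hp, hw⟩
  have hzm := hz.mem_right
  refine ⟨⟨hzm.1, fun hzs => ?_⟩, hzm.2⟩
  have hzc : z ∈ botClus (-n) n (b - 16 * m) t' (A ∩ sepDom n m b t' c d) := by
    rcases hzs with h | ⟨-, v, hv, hvz⟩
    · exact h
    · exact clus_step hv hvz (hsub hzm)
  have := hlt p (clus_conn hzc (hz.symm.mono hsub))
  omega

end StepB

/-- There is an open crossing near the row `b`, and closed connections from the top side to
the row below it near both base points. -/
def TwoFeet (n m b t' c d : ℤ) (A : Set Site) : Prop :=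
  LR (-n) n (b - 16 * m) t' (A ∩ sepDom n m b t' c d) ∧ Foot n m b t' c A ∧ Foot n m b t' d A

theorem TwoFeet.depOn {n m b t' c d : ℤ} (hm : 1 ≤ m) :
    DepOn (rect (-n) n (b - 16 * m) t') (TwoFeet n m b t' c d) := by
  have hsub : rect (-n) n (b - 1) t' ⊆ rect (-n) n (b - 16 * m) t' := by
    rintro v ⟨h1, h2, h3, h4⟩
    exact ⟨h1, h2, by omega, h4⟩
  refine DepOn.and (fun A B h => ?_)
    (((Foot.depOn n m b t' c).mono hsub).and ((Foot.depOn n m b t' d).mono hsub))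
  have : A ∩ sepDom n m b t' c d = B ∩ sepDom n m b t' c d :=
    inter_eq_of_subset (fun v hv => hv.1) h
  rw [this]

theorem pr_twoFeet : ∃ δ : ℝ, 0 < δ ∧ ∀ μ : Measure Config, IsBernoulliHalf μ →
    ∀ n m b t' c d : ℤ, 1 ≤ m → 64 * m ≤ n → b + n ≤ t' → -n ≤ c → c ≤ n → -n ≤ d →
      d ≤ n → δ * pr μ (fun A => (Reach n m b t' c A ∧ Reach n m b t' d A) ∧
        Separated n m b t' c d A) ≤ pr μ (TwoFeet n m b t' c d) := by
  obtain ⟨δ, hδ, H⟩ := pr_Cap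
  refine ⟨δ * δ, by positivity, fun μ hμ n m b t' c d hm hn ht' hc₁ hc₂ hd₁ hd₂ => ?_⟩
  set Y := rect (-n) n (b - 16 * m) t' with hYdef
  set D := sepDom n m b t' c d with hD
  have hY : Y.Finite := rect_finite _ _ _ _
  have hRY : rect (-n) n b t' ⊆ Y := by
    rintro v ⟨h1, h2, h3, h4⟩
    exact ⟨h1, h2, by omega, h4⟩
  have hdepE : DepOn Y (fun A =>
      (Reach n m b t' c A ∧ Reach n m b t' d A) ∧ Separated n m b t' c d A) :=
    (((Reach.depOn n m b t' c).mono hRY).and ((Reach.depOn n m b t' d).mono hRY)).and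
      (Separated.depOn n m b t' c d)
  have hinter : ∀ {A B S : Set Site}, A ∩ S = B ∩ S → (A ∩ D) ∩ S = (B ∩ D) ∩ S := by
    intro A B S h
    rw [Set.inter_right_comm, h, Set.inter_right_comm]
  refine pr_le_of_cond hμ hY (fun A => botClus (-n) n (b - 16 * m) t' (A ∩ D))
    (fun A B h => clus_congr (hinter h)) (hdepE.local hY) ((TwoFeet.depOn hm).local hY) _
    fun A₀ hA₀ => ?_
  obtain ⟨⟨hrc, hrd⟩, hsep⟩ := hA₀
  set s := botClus (-n) n (b - 16 * m) t' (A₀ ∩ D) with hs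
  have hlt : ∀ v ∈ s, v.2 < t' :=
    (LR_iff_botClus (by omega) (by omega)).1 (LR.mono hsep fun v hv => sepSites_subset hv.2)
  set sb := clusBar Y s with hsb
  have hκdep : DepOn (sb ∩ Y) (fun A => botClus (-n) n (b - 16 * m) t' (A ∩ D) = s) :=
    fun A B h => clus_dep (V := botSeed (-n) n (b - 16 * m)) (Y := Y) (s := s) _ _ (hinter h)
  have hdis : Disjoint (sb ∩ Y) (Y \ sb) := Set.disjoint_left.2 fun v hv hv' => hv'.2 hv.1
  have hRdep : ∀ x, DepOn (Y \ sb) (ReachOff n m b t' x sb) := fun x =>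
    (ReachOff.depOn n m b t' x sb).mono (Set.sdiff_subset_sdiff_left hRY)
  have hCdep : ∀ x, -n ≤ x → x ≤ n → ball b x (8 * m) ⊆ ball b c (8 * m) ∪ ball b d (8 * m) →
      Reach n m b t' x A₀ → DepOn (Y \ sb) (fun A => Cap (-n) n (b - 1) x (2 * m) Aᶜ) := by
    intro x h1 h2 h3 h4
    have h5 : DepOn (Y \ sb) (Cap (-n) n (b - 1) x (2 * m)) := by
      refine (Cap.depOn h1 h2).mono ?_
      rintro v ⟨k1, k2, k3, k4⟩
      have hvY : v ∈ Y := ⟨by omega, by omega, by omega, by omega⟩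
      refine ⟨hvY, fun hv => ?_⟩
      exact hsep.botClus_disjoint hm hn ht' h3 h4 hv ⟨by omega, by omega, by omega, by omega⟩ hvY
    exact fun A B hAB => h5 _ _ (compl_inter_eq hAB)
  have hCc := hCdep c hc₁ hc₂ Set.subset_union_left hrc
  have hCd := hCdep d hd₁ hd₂ Set.subset_union_right hrd
  have hT : (Y \ sb).Finite := hY.subset Set.sdiff_subset
  set R2 : Set Site → Prop := fun A => ReachOff n m b t' c sb A ∧ ReachOff n m b t' d sb A with hR2
  set C2 : Set Site → Prop := fun A => Cap (-n) n (b - 1) c (2 * m) Aᶜ ∧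
    Cap (-n) n (b - 1) d (2 * m) Aᶜ with hC2
  have hRd : DepOn (Y \ sb) R2 := (hRdep c).and (hRdep d)
  have hCC : DepOn (Y \ sb) C2 := hCc.and hCd
  have hCap : ∀ x, -n ≤ x → x ≤ n → Antitone (fun A => Cap (-n) n (b - 1) x (2 * m) Aᶜ) :=
    fun x h1 h2 A B hAB => Cap.monotone h1 h2 (Set.compl_subset_compl.2 hAB)
  have hCp : ∀ x, -n ≤ x → x ≤ n → δ ≤ pr μ (fun A => Cap (-n) n (b - 1) x (2 * m) Aᶜ) := by
    intro x h1 h2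
    rw [pr_compl hμ ((Cap.depOn h1 h2).local (rect_finite _ _ _ _))]
    exact H μ hμ _ _ _ _ _ (by omega) h1 h2
  have hCpr : δ * δ ≤ pr μ C2 :=
    (mul_le_mul (hCp c hc₁ hc₂) (hCp d hd₁ hd₂) hδ.le (pr_nonneg _ _)).trans
      (pr_harris_anti hμ (hCc.local hT) (hCd.local hT) (hCap c hc₁ hc₂) (hCap d hd₁ hd₂))
  have hRC : pr μ R2 * (δ * δ) ≤ pr μ (fun A => R2 A ∧ C2 A) :=
    (mul_le_mul_of_nonneg_left hCpr (pr_nonneg _ _)).trans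
      (pr_harris_anti hμ (hRd.local hT) (hCC.local hT)
        (Antitone.and_ev (ReachOff.antitone _ _ _ _ _ _) (ReachOff.antitone _ _ _ _ _ _))
        (Antitone.and_ev (hCap c hc₁ hc₂) (hCap d hd₁ hd₂)))
  have hi₁ := pr_indep hμ (hY.subset Set.inter_subset_right) hT hdis hκdep hRd
  have hi₂ := pr_indep hμ (hY.subset Set.inter_subset_right) hT hdis hκdep (hRd.and hCC)
  calc _ ≤ δ * δ * pr μ (fun A => botClus (-n) n (b - 16 * m) t' (A ∩ D) = s ∧ R2 A) := by
        refine mul_le_mul_of_nonneg_left (pr_mono hμ ?_) (by positivity)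
        rintro A ⟨h1, ⟨h2, h3⟩, -⟩
        refine ⟨h1, ?_⟩
        have h1' : botClus (-n) n (b - 16 * m) t' (A ∩ D) = s := h1
        have hlt' := hlt
        rw [← h1'] at hlt'
        have k2 := h2.off (by omega) hlt'
        have k3 := h3.off (by omega) hlt'
        rw [h1'] at k2 k3
        exact ⟨k2, k3⟩
    _ = pr μ (fun A => botClus (-n) n (b - 16 * m) t' (A ∩ D) = s) * (pr μ R2 * (δ * δ)) := by
        rw [hi₁]
        ring
    _ ≤ _ := mul_le_mul_of_nonneg_left hRC (pr_nonneg _ _)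
    _ = _ := hi₂.symm
    _ ≤ _ := pr_mono hμ ?_
  rintro A ⟨hA, ⟨h1, h2⟩, h3, h4⟩
  have hA' : botClus (-n) n (b - 16 * m) t' (A ∩ D) = s := hA
  refine ⟨hA, (LR_iff_botClus (by omega) (by omega)).2 ?_, h1.reach.foot h3 hm hn ht' hc₁ hc₂,
    h2.reach.foot h4 hm hn ht' hd₁ hd₂⟩
  rw [hA']
  exact hlt

section PivotalArms

variable {n m : ℤ} {A : Set Site}

theorem opn_eq_of_cfg {p : List Site} (hp : IsOpenOn (cfg A) p) : ∀ v ∈ p, v ∈ A :=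
  fun v hv => by simpa [cfg] using hp v hv

theorem Pivotal.topClus {v : Site} (hv : Pivotal n (cfg A) v) :
    (∀ z ∈ topClus (-n) n (-n) n A, -n < z.2) ∧
      ∃ w ∈ topClus (-n) n (-n) n A, Adj v w ∧ w ∈ rect (-n) n (-n) n := by
  obtain ⟨⟨p, ⟨hp, hpo, ⟨a, ha, hpa⟩, ⟨b, hb, hpb⟩⟩, -⟩,
    q, -, hq, hqc, ⟨w, hw, hqw⟩, ⟨u, hu, hqu⟩, -⟩ := hv
  constructor
  · have h1 := Conn.of_list (S := rect (-n) n (-n) n ∩ A)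
      ⟨hp.1, fun z hz => ⟨hp.2 z hz, opn_eq_of_cfg hpo z hz⟩⟩ hpa (List.mem_of_getLast? hpb)
    exact fun z hz => topClus_above ⟨a, b, h1, ha.2, hb.2⟩ hz
  · have h1 := Conn.of_list (S := rect (-n) n (-n) n \ A)
      ⟨hq.1, fun z hz => ⟨hq.2 z hz, by simpa [cfg] using hqc z hz⟩⟩ hqw (List.mem_of_getLast? hqu)
    exact ⟨w, mem_topClus_of_conn h1.symm hu.2, hw, h1.mem_left.1⟩

theorem HasPivotal.twoArms {k l : ℕ} (hk : HasPivotal n (Hblock n m k) A)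
    (hl : HasPivotal n (Hblock n m l) A) : TwoArms n m (-n) n (-n + k * m) (-n + l * m) A := by
  have key : ∀ i : ℕ, HasPivotal n (Hblock n m i) A →
      ∃ w ∈ topClus (-n) n (-n) n A, w ∈ baseBox m (-n) (-n + i * m) := by
    rintro i ⟨v, ⟨h1, h2, h3, h4⟩, hv⟩
    obtain ⟨w, hw, hvw, hwR⟩ := hv.topClus.2
    have h5 := hwR.2.2.1
    rw [adj_iff] at hvw
    rw [sub_mul, one_mul] at h1
    exact ⟨w, hw, by omega, by omega, h5, by omega⟩
  obtain ⟨v, hvH, hv⟩ := hk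
  exact ⟨hv.topClus.1, key k ⟨v, hvH, hv⟩, key l hl⟩

end PivotalArms

/-- The lowest open crossing passes at height between `b - 16 * m` and `b - 1`. -/
def LowBand (n m b t' : ℤ) (A : Set Site) : Prop :=
  LR (-n) n (b - 16 * m) t' A ∧ ¬ LR (-n) n (b - 1) t' A

theorem LowBand.depOn {n m b t' : ℤ} (hm : 1 ≤ m) :
    DepOn (rect (-n) n (b - 16 * m) t') (LowBand n m b t') := by
  refine (LR.depOn _ _ _ _).and (DepOn.mono (LR.depOn _ _ _ _).not ?_)
  rintro v ⟨h1, h2, h3, h4⟩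
  exact ⟨h1, h2, by omega, h4⟩

section Counting

variable {n m b t' c d : ℤ} {A : Set Site}

theorem TwoFeet.lowBand (h : TwoFeet n m b t' c d A) : LowBand n m b t' A := by
  obtain ⟨h1, ⟨p, e, hpe, hp, he, -⟩, -⟩ := h
  exact ⟨h1.mono fun v hv => hv.2.1, fun h2 => h2.not_TB ⟨p, e, hpe, hp, he⟩⟩

theorem TwoFeet.symm (h : TwoFeet n m b t' c d A) : TwoFeet n m b t' d c A := by
  refine ⟨h.1.mono ?_, h.2.2, h.2.1⟩
  rintro v ⟨-, h1, h2, h3⟩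
  exact ⟨h1, h2, h3.imp_right fun h => h.symm⟩

/-- The columns at which the top side is joined to the row `b - 1`. -/
def feet (n b t' : ℤ) (A : Set Site) : Set ℤ :=
  {x | ∃ p, Conn (rect (-n) n (b - 1) t' \ A) p (x, b - 1) ∧ p.2 = t'}

theorem Foot.exists_feet (h : Foot n m b t' c A) :
    ∃ x ∈ feet n b t' A, c - 4 * m ≤ x ∧ x ≤ c + 4 * m := by
  obtain ⟨p, ⟨x, y⟩, hpe, hp, he, h1, h2⟩ := h
  obtain rfl : y = b - 1 := he
  exact ⟨x, ⟨p, hpe, hp⟩, h1, h2⟩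

theorem TwoFeet.near (h : TwoFeet n m b t' c d A) (hm : 1 ≤ m) {x : ℤ} (hx : x ∈ feet n b t' A) :
    (c - 16 * m ≤ x ∧ x ≤ c + 16 * m) ∨ (d - 16 * m ≤ x ∧ x ≤ d + 16 * m) := by
  by_contra hcon
  obtain ⟨p, hpx, hp⟩ := hx
  have hxm := hpx.mem_right.1
  refine h.1.not_TB ⟨p, (x, b - 16 * m), Conn.trans (v := (x, b - 1)) (hpx.mono ?_)
    (Conn.symm (conn_col (by omega) fun y h1 h2 => ⟨⟨hxm.1, hxm.2.1, h1, ?_⟩, ?_⟩)), hp, rfl⟩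
  · rintro v ⟨⟨h1, h2, h3, h4⟩, h5⟩
    exact ⟨⟨h1, h2, by omega, h4⟩, fun h => h5 h.1⟩
  · exact h2.trans hxm.2.2.2
  · rintro ⟨-, -, h3 | h3 | h3⟩
    · dsimp only at h3
      omega
    · exact hcon (Or.inl ⟨h3.1, h3.2.1⟩)
    · exact hcon (Or.inr ⟨h3.1, h3.2.1⟩)

theorem exists_twoFeet_near (n b t' : ℤ) (hm : 1 ≤ m) (A : Set Site) : ∃ x y : ℤ, ∀ c d,
    TwoFeet n m b t' c d A →
      (c - 36 * m ≤ x ∧ x ≤ c + 36 * m) ∨ (c - 36 * m ≤ y ∧ y ≤ c + 36 * m) := by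
  by_cases hne : (feet n b t' A).Nonempty
  · have hfin : (feet n b t' A).Finite := by
      refine (Set.finite_Icc (-n) n).subset ?_
      rintro x ⟨p, hpx, -⟩
      exact ⟨hpx.mem_right.1.1, hpx.mem_right.1.2.1⟩
    obtain ⟨x, hx, hxle⟩ := hfin.exists_minimalFor id _ hne
    obtain ⟨y, hy, hyle⟩ := hfin.exists_maximalFor id _ hne
    refine ⟨x, y, fun c d h => ?_⟩
    obtain ⟨z, hz, hz1, hz2⟩ := h.2.1.exists_feet
    have h1 : x ≤ z := (le_total x z).elim id fun h => hxle hz h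
    have h2 : z ≤ y := (le_total z y).elim id fun h => hyle hz h
    have h3 := h.near hm hx
    have h4 := h.near hm hy
    have h5 := h.near hm hz
    omega
  · refine ⟨0, 0, fun c d h => ?_⟩
    obtain ⟨z, hz, -⟩ := h.2.1.exists_feet
    exact absurd ⟨z, hz⟩ hne

theorem exists_finset_near (hm : 1 ≤ m) (a x : ℤ) : ∃ T : Finset ℕ, T.card ≤ 75 ∧
    ∀ k : ℕ, a + k * m - 36 * m ≤ x → x ≤ a + k * m + 36 * m → k ∈ T := by
  set q := (x - a) / m with hq
  have h1 : m * q ≤ x - a := Int.mul_ediv_self_le (by omega)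
  have h2 : x - a < m * q + m := Int.lt_mul_ediv_self_add (by omega)
  refine ⟨Finset.Icc (q - 37).toNat (q + 37).toNat, ?_, fun k h3 h4 => ?_⟩
  · rw [Nat.card_Icc]
    omega
  · have h5 : (k : ℤ) < q + 37 := by nlinarith
    have h6 : q - 37 < (k : ℤ) := by nlinarith
    rw [Finset.mem_Icc]
    omega

theorem exists_finset_twoFeet (n b t' a : ℤ) (hm : 1 ≤ m) (A : Set Site) :
    ∃ T : Finset (ℕ × ℕ), T.card ≤ 22500 ∧
      ∀ q : ℕ × ℕ, TwoFeet n m b t' (a + q.1 * m) (a + q.2 * m) A → q ∈ T := by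
  classical
  obtain ⟨x, y, h⟩ := exists_twoFeet_near n b t' hm A
  obtain ⟨S, hS, hS'⟩ := exists_finset_near hm a x
  obtain ⟨T, hT, hT'⟩ := exists_finset_near hm a y
  have hcard := Finset.card_union_le S T
  refine ⟨(S ∪ T) ×ˢ (S ∪ T), ?_, fun q hq => ?_⟩
  · rw [Finset.card_product]
    calc _ ≤ 150 * 150 := Nat.mul_le_mul (by omega) (by omega)
      _ = 22500 := by norm_num
  · rw [Finset.mem_product, Finset.mem_union, Finset.mem_union]
    exact ⟨(h _ _ hq).imp (fun h => hS' _ h.1 h.2) fun h => hT' _ h.1 h.2,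
      (h _ _ hq.symm).imp (fun h => hS' _ h.1 h.2) fun h => hT' _ h.1 h.2⟩

end Counting

theorem sum_pr_le {μ : Measure Config} (hμ : IsBernoulliHalf μ) {ι : Type*} (s : Finset ι)
    {E : ι → Set Site → Prop} {F : Set Site → Prop} (hE : ∀ i, LocalEv (E i)) (hF : LocalEv F)
    {N : ℕ} (h : ∀ A, ∃ T : Finset ι, T.card ≤ N ∧ ∀ i, E i A → i ∈ T ∧ F A) :
    ∑ i ∈ s, pr μ (E i) ≤ N * pr μ F := by
  classical
  have := hμ.1
  have h_int : ∀ G : Set Site → Prop, LocalEv G →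
      Integrable ({ω | G (opn ω)}.indicator (1 : Config → ℝ)) μ := fun G hG =>
    (integrable_const (1 : ℝ)).indicator (hG.measurableSet hμ)
  have hpr : ∀ G : Set Site → Prop, LocalEv G →
      pr μ G = ∫ ω, {ω | G (opn ω)}.indicator (1 : Config → ℝ) ω ∂μ := fun G hG =>
    (integral_indicator_one (hG.measurableSet hμ)).symm
  rw [Finset.sum_congr rfl fun i _ => hpr (E i) (hE i), hpr F hF,
    ← integral_finsetSum s fun i _ => h_int (E i) (hE i), ← integral_const_mul]
  refine integral_mono (integrable_finsetSum s fun i _ => h_int (E i) (hE i))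
    ((h_int F hF).const_mul _) fun ω => ?_
  obtain ⟨T, hT, hT'⟩ := h (opn ω)
  simp only [Set.indicator_apply, Set.mem_ofPred_eq, Pi.one_apply, Finset.sum_boole]
  by_cases hFω : F (opn ω)
  · rw [if_pos hFω, mul_one, Nat.cast_le]
    exact (Finset.card_le_card fun i hi => (hT' i (Finset.mem_filter.1 hi).2).1).trans hT
  · rw [if_neg hFω, mul_zero, Finset.filter_false_of_mem fun i _ hi => hFω (hT' i hi).2]
    simp

theorem sum_pr_lowBand_le {μ : Measure Config} (hμ : IsBernoulliHalf μ) {n m b : ℤ} (hm : 1 ≤ m)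
    (J : ℕ) : ∑ j ∈ Finset.range J, pr μ (LowBand n m b (b + n + 16 * m * j)) ≤ 1 := by
  set e : ℕ → Site ≃ Site := fun j => Equiv.addRight ((0, -(16 * m * j)) : Site) with he
  have hloc : ∀ j : ℕ, LocalEv (LowBand n m b (b + n + 16 * m * j)) := fun j =>
    (LowBand.depOn hm).local (rect_finite _ _ _ _)
  rw [Finset.sum_congr rfl fun j _ => (pr_equiv hμ (hloc j) (e j)).symm,
    pr_sum_disjoint hμ _ fun j _ => (hloc j).equiv (e j)]
  · exact pr_le_one hμ _
  · have key : ∀ i j : ℕ, i < j → ∀ A, LowBand n m b (b + n + 16 * m * i) (e i ⁻¹' A) →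
        ¬ LowBand n m b (b + n + 16 * m * j) (e j ⁻¹' A) := by
      rintro i j hij A ⟨h1, -⟩ ⟨-, h2⟩
      rw [he, LR_preimage] at h1 h2
      have hij' : m * (i + 1) ≤ m * j :=
        mul_le_mul_of_nonneg_left (by exact_mod_cast hij) (by omega)
      exact h2 (h1.mono_rect (by linarith) (by linarith))
    intro i _ j _ hij A h1 h2
    rcases lt_or_gt_of_ne hij with h | h
    · exact key i j h A h1 h2
    · exact key j i h A h2 h1

theorem sum_pr_twoArms_le : ∃ C : ℝ, 0 < C ∧ ∀ μ : Measure Config, IsBernoulliHalf μ →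
    ∀ n m K : ℕ, 1 ≤ m → 64 * m ≤ n → K * m = 2 * n →
      ∑ q ∈ Finset.Icc 1 K ×ˢ Finset.Icc 1 K,
        pr μ (TwoArms n m (-n) n (-n + q.1 * m) (-n + q.2 * m)) ≤ C * m / n := by
  obtain ⟨δ₁, hδ₁, H₁⟩ := pr_separated
  obtain ⟨δ₂, hδ₂, H₂⟩ := pr_twoFeet
  refine ⟨720000 / (δ₁ * δ₂), by positivity, fun μ hμ n m K hm hn hK => ?_⟩
  set I := Finset.Icc 1 K ×ˢ Finset.Icc 1 K with hI
  set S := ∑ q ∈ I, pr μ (TwoArms n m (-n) n (-n + q.1 * m) (-n + q.2 * m)) with hS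
  set J := n / (16 * m) with hJ
  have hJ1 : J * (16 * m) ≤ n := Nat.div_mul_le_self _ _
  have hJ2 : n < J * (16 * m) + 16 * m := Nat.lt_div_mul_add (by omega)
  have hJ3 : 1 ≤ J := (Nat.one_le_div_iff (by omega)).2 (by omega)
  have hJ4 : n ≤ 32 * m * J := by nlinarith
  have hmZ : (1 : ℤ) ≤ m := by exact_mod_cast hm
  have hnZ : (64 : ℤ) * m ≤ n := by exact_mod_cast hn
  have hbase : ∀ k ∈ Finset.Icc 1 K, (-n : ℤ) ≤ -n + k * m ∧ (-n + k * m : ℤ) ≤ n := by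
    intro k hk
    have h1 : k * m ≤ 2 * n := hK ▸ Nat.mul_le_mul_right m (Finset.mem_Icc.1 hk).2
    have h2 : ((k * m : ℕ) : ℤ) ≤ 2 * n := by exact_mod_cast h1
    push_cast at h2
    have h3 : (0 : ℤ) ≤ k * m := by positivity
    omega
  have hstep : ∀ j ∈ Finset.range J,
      δ₁ * δ₂ * S ≤ 22500 * pr μ (LowBand n m (-n) (-n + n + 16 * m * j)) := by
    intro j hj
    have hjn : (16 : ℤ) * m * j ≤ n := by
      have : 16 * m * j ≤ n := le_trans (by
        rw [mul_comm]
        exact Nat.mul_le_mul_right _ (Finset.mem_range.1 hj).le) hJ1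
      exact_mod_cast this
    have hj0 : (0 : ℤ) ≤ 16 * m * j := by positivity
    refine le_trans ?_ (sum_pr_le hμ I (N := 22500) (E := fun q =>
      TwoFeet n m (-n) (-n + n + 16 * m * j) (-n + q.1 * m) (-n + q.2 * m))
      (fun q => (TwoFeet.depOn hmZ).local (rect_finite _ _ _ _))
      ((LowBand.depOn hmZ).local (rect_finite _ _ _ _)) fun A => ?_)
    · rw [hS, Finset.mul_sum]
      refine Finset.sum_le_sum fun q hq => ?_
      obtain ⟨hq1, hq2⟩ := Finset.mem_product.1 hq
      have h1 := H₁ μ hμ n m (-n) n (-n + n + 16 * m * j) (-n + q.1 * m) (-n + q.2 * m) hmZ hnZ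
        (by omega) (by omega) (hbase _ hq1).1 (hbase _ hq1).2 (hbase _ hq2).1 (hbase _ hq2).2
      have h2 := H₂ μ hμ n m (-n) (-n + n + 16 * m * j) (-n + q.1 * m) (-n + q.2 * m) hmZ hnZ
        (by omega) (hbase _ hq1).1 (hbase _ hq1).2 (hbase _ hq2).1 (hbase _ hq2).2
      rw [mul_comm δ₁, mul_assoc]
      exact (mul_le_mul_of_nonneg_left h1 hδ₂.le).trans h2
    · obtain ⟨T, hT, hT'⟩ := exists_finset_twoFeet n (-n) (-n + n + 16 * m * j) (-n) hmZ A
      exact ⟨T, hT, fun q hq => ⟨hT' q hq, hq.lowBand⟩⟩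
  have hsum := Finset.sum_le_sum hstep
  rw [Finset.sum_const, Finset.card_range, nsmul_eq_mul, ← Finset.mul_sum] at hsum
  have hsum' := hsum.trans (mul_le_mul_of_nonneg_left (sum_pr_lowBand_le hμ hmZ J) (by norm_num))
  have hS0 : 0 ≤ S := Finset.sum_nonneg fun q _ => pr_nonneg _ _
  have hnR : (0 : ℝ) < n := by exact_mod_cast (by omega : 0 < n)
  have hJ4' : (n : ℝ) ≤ 32 * m * J := by exact_mod_cast hJ4
  rw [div_mul_eq_mul_div, div_div, le_div_iff₀ (by positivity)]
  calc S * (δ₁ * δ₂ * n) ≤ S * (δ₁ * δ₂ * (32 * m * J)) := by gcongr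
    _ = 32 * m * (J * (δ₁ * δ₂ * S)) := by ring
    _ ≤ 32 * m * (22500 * 1) := by gcongr
    _ = _ := by ring

theorem sum_pr_hasPivotal_le : ∃ C : ℝ, 0 < C ∧ ∀ μ : Measure Config, IsBernoulliHalf μ →
    ∀ n m K : ℕ, 1 ≤ m → m ≤ n → K * m = 2 * n →
      ∑ q ∈ Finset.Icc 1 K ×ˢ Finset.Icc 1 K,
        pr μ (fun A => HasPivotal n (Hblock n m q.1) A ∧ HasPivotal n (Hblock n m q.2) A) ≤
          C * m / n := by
  obtain ⟨C, hC, H⟩ := sum_pr_twoArms_le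
  refine ⟨max C 1048576, by positivity, fun μ hμ n m K hm hmn hK => ?_⟩
  have hnR : (0 : ℝ) < n := by exact_mod_cast (by omega : 0 < n)
  by_cases hn : 64 * m ≤ n
  · calc _ ≤ _ := Finset.sum_le_sum fun q _ => pr_mono hμ fun A hA => hA.1.twoArms hA.2
      _ ≤ C * m / n := H μ hμ n m K hm hn hK
      _ ≤ _ := by
        gcongr
        exact le_max_left _ _
  · have hK' : K ≤ 128 := by
      by_contra! h
      have := Nat.mul_le_mul_right m h.le
      omega
    have hnm : (n : ℝ) ≤ 64 * m := by exact_mod_cast (by omega : n ≤ 64 * m)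
    calc _ ≤ ∑ q ∈ Finset.Icc 1 K ×ˢ Finset.Icc 1 K, (1 : ℝ) :=
          Finset.sum_le_sum fun q _ => pr_le_one hμ _
      _ = (K : ℝ) * K := by simp
      _ ≤ 128 * 128 := by
        have : (K : ℝ) ≤ 128 := by exact_mod_cast hK'
        gcongr
      _ ≤ 1048576 * m / n := by
        rw [le_div_iff₀ hnR]
        linarith
      _ ≤ _ := by
        gcongr
        exact le_max_right _ _

theorem lintegral_ncard_sq {μ : Measure Config} (hμ : IsBernoulliHalf μ)
    {E : ℕ → Set Site → Prop} (hE : ∀ k, LocalEv (E k)) (K : ℕ) :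
    ∫⁻ ω, (({k : ℕ | 1 ≤ k ∧ k ≤ K ∧ E k (opn ω)}.ncard : ℕ) : ℝ≥0∞) ^ 2 ∂μ =
      ENNReal.ofReal (∑ q ∈ Finset.Icc 1 K ×ˢ Finset.Icc 1 K,
        pr μ (fun A => E q.1 A ∧ E q.2 A)) := by
  classical
  have := hμ.1
  have hms : ∀ q : ℕ × ℕ, MeasurableSet {ω | E q.1 (opn ω) ∧ E q.2 (opn ω)} := fun q =>
    ((hE q.1).and (hE q.2)).measurableSet hμ
  rw [ENNReal.ofReal_sum_of_nonneg fun _ _ => pr_nonneg _ _]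
  have h1 : ∀ q : ℕ × ℕ, ENNReal.ofReal (pr μ (fun A => E q.1 A ∧ E q.2 A)) =
      ∫⁻ ω, {ω | E q.1 (opn ω) ∧ E q.2 (opn ω)}.indicator 1 ω ∂μ := fun q => by
    rw [lintegral_indicator_one (hms q), pr, ofReal_measureReal]
  rw [Finset.sum_congr rfl fun q _ => h1 q,
    ← lintegral_finsetSum _ fun q _ => (measurable_one.indicator (hms q))]
  refine lintegral_congr fun ω => ?_
  have h2 : {k : ℕ | 1 ≤ k ∧ k ≤ K ∧ E k (opn ω)} =
      ↑((Finset.Icc 1 K).filter fun k => E k (opn ω)) := by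
    ext k
    simp [and_assoc]
  simp only [Set.indicator_apply, Set.mem_ofPred_eq, Pi.one_apply, Finset.sum_boole]
  rw [h2, Set.ncard_coe_finset, Finset.filter_product (fun k => E k (opn ω)) (fun k => E k (opn ω)),
    Finset.card_product, sq, Nat.cast_mul]

theorem Xnm_eq (j₀ i₀ : ℕ) (ω : Config) :
    Xnm j₀ i₀ ω = {k : ℕ | 1 ≤ k ∧ k ≤ 2 ^ (i₀ + 1) ∧ HasPivotal ((2 : ℤ) ^ j₀)
      (Hblock ((2 : ℤ) ^ j₀) ((2 : ℤ) ^ (j₀ - i₀)) k) (opn ω)}.ncard := by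
  rw [Xnm]
  congr 1
  ext k
  simp only [HasPivotal, cfg_opn, Set.Nonempty, Qset, Set.mem_inter_iff, Set.mem_ofPred_eq]
  simp only [and_comm]

theorem HasPivotal.exists_block {n m K : ℕ} (hm : 1 ≤ m) (hK : K * m = 2 * n) {A : Set Site}
    (h : HasPivotal n (lowStrip n m) A) :
    ∃ k, 1 ≤ k ∧ k ≤ K ∧ HasPivotal n (Hblock n m k) A := by
  obtain ⟨v, ⟨h1, h2, h3, h4⟩, hv⟩ := h
  obtain ⟨x, hx⟩ : ∃ x : ℕ, v.1 = -n + 1 + x := ⟨(v.1 + n - 1).toNat, by omega⟩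
  have h5 : x / m * m ≤ x := Nat.div_mul_le_self _ _
  have h6 : x < x / m * m + m := Nat.lt_div_mul_add (by omega)
  have h5' : ((x / m : ℕ) : ℤ) * m ≤ x := by exact_mod_cast h5
  have h6' : (x : ℤ) < ((x / m : ℕ) : ℤ) * m + m := by exact_mod_cast h6
  refine ⟨x / m + 1, Nat.le_add_left 1 _, ?_, v, ⟨?_, ?_, h3, h4⟩, hv⟩
  · refine Nat.div_lt_of_lt_mul ?_
    rw [mul_comm, hK]
    omega
  · push_cast
    rw [add_sub_cancel_right]
    push_cast at h5'
    omega
  · push_cast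
    push_cast at h6'
    rw [add_mul, one_mul]
    omega

theorem ENNReal.ofReal_mul_natCast_div (c : ℝ) (hc : 0 ≤ c) {m n : ℕ} (hn : 0 < n) :
    ENNReal.ofReal (c * m / n) = ENNReal.ofReal c * m / n := by
  rw [ENNReal.ofReal_div_of_pos (by exact_mod_cast hn), ENNReal.ofReal_mul hc,
    ENNReal.ofReal_natCast, ENNReal.ofReal_natCast]

theorem pr_hasPivotal_le_sum {μ : Measure Config} (hμ : IsBernoulliHalf μ) {n m K : ℕ}
    (hm : 1 ≤ m) (hK : K * m = 2 * n) :
    pr μ (HasPivotal n (lowStrip n m)) ≤ ∑ q ∈ Finset.Icc 1 K ×ˢ Finset.Icc 1 K,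
      pr μ (fun A => HasPivotal n (Hblock n m q.1) A ∧ HasPivotal n (Hblock n m q.2) A) := by
  have := hμ.1
  calc pr μ (HasPivotal n (lowStrip n m))
      ≤ μ.real (⋃ k ∈ Finset.Icc 1 K, {ω | HasPivotal n (Hblock n m k) (opn ω)}) := by
        refine measureReal_mono (fun ω hω => ?_) (measure_ne_top _ _)
        obtain ⟨k, hk1, hk2, hk⟩ := HasPivotal.exists_block hm hK hω
        exact Set.mem_biUnion (Finset.mem_coe.2 (Finset.mem_Icc.2 ⟨hk1, hk2⟩)) hk
    _ ≤ ∑ k ∈ Finset.Icc 1 K, pr μ (HasPivotal n (Hblock n m k)) :=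
        measureReal_biUnion_finset_le _ _
    _ ≤ _ := by
        rw [Finset.sum_product]
        refine Finset.sum_le_sum fun k hk => ?_
        refine le_trans (le_of_eq ?_) (Finset.single_le_sum
          (f := fun l => pr μ (fun A => HasPivotal n (Hblock n m k) A ∧
            HasPivotal n (Hblock n m l) A)) (fun _ _ => measureReal_nonneg) hk)
        simp only [and_self]

/-- There exist constants `0 < c ≤ C < ∞` such that for all `n = 2^{j₀}` and
`m = 2^{-i₀}n`, `c·m/n ≤ E(X_{n,m}²) ≤ C·m/n`. -/
theorem statement9 :
    ∃ c C : ℝ≥0∞, 0 < c ∧ c ≤ C ∧ C < ⊤ ∧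
      ∀ μ : Measure Config, IsBernoulliHalf μ →
        ∀ j₀ i₀ : ℕ, i₀ ≤ j₀ →
          ∀ n m : ℕ, n = 2 ^ j₀ → m = 2 ^ (j₀ - i₀) →
            c * m / n ≤ ∫⁻ ω, (Xnm j₀ i₀ ω : ℝ≥0∞) ^ 2 ∂μ ∧
              ∫⁻ ω, (Xnm j₀ i₀ ω : ℝ≥0∞) ^ 2 ∂μ ≤ C * m / n := by
  obtain ⟨δ, hδ, hlow⟩ := pr_hasPivotal_lower
  obtain ⟨C, hC, hup⟩ := sum_pr_hasPivotal_le
  refine ⟨ENNReal.ofReal δ, ENNReal.ofReal (max C δ), ENNReal.ofReal_pos.2 hδ,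
    ENNReal.ofReal_le_ofReal (le_max_right _ _), ENNReal.ofReal_lt_top, ?_⟩
  intro μ hμ j₀ i₀ hij n m hn hm
  have hm1 : 1 ≤ m := hm ▸ Nat.one_le_two_pow
  have hn1 : 0 < n := hn ▸ Nat.two_pow_pos _
  have hmn : m ≤ n := by
    rw [hm, hn]
    exact Nat.pow_le_pow_right two_pos (Nat.sub_le _ _)
  have hK : 2 ^ (i₀ + 1) * m = 2 * n := by
    rw [hm, hn, ← pow_add, ← pow_succ']
    congr 1
    omega
  have hnz : (2 : ℤ) ^ j₀ = n := by rw [hn]; push_cast; rfl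
  have hmz : (2 : ℤ) ^ (j₀ - i₀) = m := by rw [hm]; push_cast; rfl
  simp_rw [Xnm_eq, hnz, hmz]
  rw [lintegral_ncard_sq hμ
      (fun k => (HasPivotal.depOn (n : ℤ) (Hblock n m k)).local (rect_finite _ _ _ _)),
    ← ENNReal.ofReal_mul_natCast_div _ hδ.le hn1,
    ← ENNReal.ofReal_mul_natCast_div _ (hδ.le.trans (le_max_right _ _)) hn1]
  refine ⟨ENNReal.ofReal_le_ofReal ((hlow μ hμ n m hm1 hmn).trans
    (pr_hasPivotal_le_sum hμ hm1 hK)), ENNReal.ofReal_le_ofReal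
    ((hup μ hμ n m _ hm1 hmn hK).trans ?_)⟩
  gcongr
  exact le_max_left _ _
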